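/- Let p and q be prime numbers with p ≡ 5 (mod 8), q ≡ 3 (mod 8), and Legendre symbol (p/q) = 1. Let K = ℚ(√2, √p, √q, i), the imaginary multiquadratic field of degree 16. Then the 2-class number of K equals the 2-class number of the imaginary quadratic field ℚ(√(−pq)). -/

import Mathlib

/-- The class number of a subfield `K` of `ℂ` (the cardinality of the class
group of its ring of integers). -/
noncomputable def classNum (K : IntermediateField ℚ ℂ) : ℕ :=
  Nat.card (ClassGroup (integralClosure ℤ K))

/-- The 2-class number of a subfield `K` of `ℂ`: the largest power of `2`
dividing its class number. -/
noncomputable def twoClassNum (K : IntermediateField ℚ ℂ) : ℕ :=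
  2 ^ ((classNum K).factorization 2)

namespace TwoClass

open Module

theorem index_range_two_nsmul_int_pi (n : ℕ) :
    (nsmulAddMonoidHom (α := Fin n → ℤ) 2).range.index = 2 ^ n := by
  have h : (nsmulAddMonoidHom (α := Fin n → ℤ) 2).range =
      AddSubgroup.pi Set.univ fun _ => AddSubgroup.zmultiples (2 : ℤ) := by
    ext x
    simp only [AddMonoidHom.mem_range, nsmulAddMonoidHom_apply, AddSubgroup.mem_pi, Set.mem_univ,
      true_implies, Int.mem_zmultiples_iff]
    refine ⟨fun ⟨y, hy⟩ i => ⟨y i, by rw [← hy]; simp⟩, fun hx => ?_⟩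
    choose y hy using hx
    exact ⟨y, funext fun i => by rw [hy i]; simp⟩
  rw [h, AddSubgroup.index_pi]
  simp [Int.index_zmultiples]

theorem index_range_two_nsmul_of_equiv {A T : Type*} [AddCommGroup A] [AddCommGroup T] [Finite T]
    (n : ℕ) (f : A ≃+ (Fin n → ℤ) × T) :
    (nsmulAddMonoidHom (α := A) 2).range.index =
      2 ^ n * Nat.card (nsmulAddMonoidHom (α := A) 2).ker := by
  have h1 : (nsmulAddMonoidHom (α := A) 2).range.map (f : A →+ (Fin n → ℤ) × T) =
      (nsmulAddMonoidHom (α := Fin n → ℤ) 2).range.prod (nsmulAddMonoidHom (α := T) 2).range := by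
    ext ⟨x, y⟩
    simp only [AddSubgroup.mem_map, AddMonoidHom.mem_range, AddSubgroup.mem_prod,
      nsmulAddMonoidHom_apply]
    constructor
    · rintro ⟨_, ⟨z, rfl⟩, hz⟩
      have hz' : 2 • f z = (x, y) := by simpa using hz
      exact ⟨⟨(f z).1, congrArg Prod.fst hz'⟩, ⟨(f z).2, congrArg Prod.snd hz'⟩⟩
    · rintro ⟨⟨a, rfl⟩, ⟨b, rfl⟩⟩
      exact ⟨_, ⟨f.symm (a, b), rfl⟩, by simp⟩
  have h2 : (nsmulAddMonoidHom (α := A) 2).ker ≃ (nsmulAddMonoidHom (α := T) 2).ker :=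
    { toFun := fun x => ⟨(f x.1).2, by
        have hx : 2 • x.1 = 0 := x.2
        have : 2 • f x.1 = 0 := by rw [← map_nsmul, hx, map_zero]
        exact congrArg Prod.snd this⟩
      invFun := fun y => ⟨f.symm (0, y.1), by
        have hy : 2 • y.1 = 0 := y.2
        change 2 • f.symm (0, y.1) = 0
        rw [← map_nsmul, Prod.smul_mk, hy, smul_zero]
        exact map_zero f.symm⟩
      left_inv := fun x => by
        have hx : 2 • x.1 = 0 := x.2
        have h3 : 2 • f x.1 = 0 := by rw [← map_nsmul, hx, map_zero]
        have h4 : (f x.1).1 = 0 := by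
          have h5 : 2 • (f x.1).1 = 0 := congrArg Prod.fst h3
          funext i
          have := congrFun h5 i
          simp only [Pi.smul_apply, nsmul_eq_mul, Pi.zero_apply] at this
          simpa using this
        apply Subtype.ext
        rw [f.symm_apply_eq]
        exact Prod.ext h4.symm rfl
      right_inv := fun y => by simp }
  have h3 := AddSubgroup.index_map_of_bijective (f := (f : A →+ (Fin n → ℤ) × T)) f.bijective
    (nsmulAddMonoidHom (α := A) 2).range
  rw [← h3, h1, AddSubgroup.index_prod, index_range_two_nsmul_int_pi, AddSubgroup.index_range,
    Nat.card_congr h2]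

theorem finrank_eq_add_of_surjective {A B : Type*} [AddCommGroup A] [AddCommGroup B]
    [Module.Finite ℤ A] (F : A →ₗ[ℤ] B) (hF : Function.Surjective F) :
    finrank ℤ A = finrank ℤ B + finrank ℤ (LinearMap.ker F) := by
  rw [← (LinearMap.ker F).finrank_quotient_add_finrank,
    (F.quotKerEquivOfSurjective hF).finrank_eq]

theorem finrank_eq_zero_of_nsmul {A : Type*} [AddCommGroup A] (n : ℕ) (hn : n ≠ 0)
    (h : ∀ x : A, n • x = 0) : finrank ℤ A = 0 :=
  Module.finrank_eq_zero_of_rank_eq_zero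
    (rank_eq_zero_iff.mpr fun x => ⟨n, by exact_mod_cast hn, by simpa using h x⟩)

theorem index_range_two_nsmul (A : Type*) [AddCommGroup A] [Module.Finite ℤ A] :
    (nsmulAddMonoidHom (α := A) 2).range.index =
      2 ^ finrank ℤ A * Nat.card (nsmulAddMonoidHom (α := A) 2).ker := by
  have hfg : AddGroup.FG A := Module.Finite.iff_addGroup_fg.mp inferInstance
  obtain ⟨n, ι, _, P, hP, e, ⟨f⟩⟩ := AddCommGroup.equiv_free_prod_directSum_zmod A
  have hne : ∀ i, NeZero (P i ^ e i) := fun i => ⟨pow_ne_zero _ (hP i).ne_zero⟩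
  have hfin : Finite (DirectSum ι fun i => ZMod (P i ^ e i)) :=
    Finite.of_equiv _ (DirectSum.addEquivProd fun i => ZMod (P i ^ e i)).symm.toEquiv
  let g := f.trans ((Finsupp.linearEquivFunOnFinite ℤ ℤ (Fin n)).toAddEquiv.prodCongr
    (AddEquiv.refl _))
  have hn : finrank ℤ A = n := by
    have hs : Function.Surjective
        ((LinearMap.fst ℤ (Fin n → ℤ) (DirectSum ι fun i => ZMod (P i ^ e i))).comp
          (g.toIntLinearEquiv : A →ₗ[ℤ] _)) := fun x => ⟨g.symm (x, 0), by simp⟩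
    rw [finrank_eq_add_of_surjective _ hs, finrank_eq_zero_of_nsmul (A := LinearMap.ker _)
      (Nat.card (DirectSum ι fun i => ZMod (P i ^ e i))) Nat.card_pos.ne']
    · simp
    · intro x
      apply Subtype.ext
      apply g.injective
      have hx : (g x.1).1 = 0 := x.2
      change g (Nat.card (DirectSum ι fun i => ZMod (P i ^ e i)) • x.1) = g 0
      rw [map_nsmul, map_zero]
      refine Prod.ext ?_ ?_
      · rw [Prod.smul_fst, hx, smul_zero]; rfl
      · rw [Prod.smul_snd, card_nsmul_eq_zero']; rfl
  rw [hn]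
  exact index_range_two_nsmul_of_equiv n g

/-- The rank of a commutative group. -/
noncomputable def rk (G : Type*) [CommGroup G] : ℕ := finrank ℤ (Additive G)

theorem rk_congr {G H : Type*} [CommGroup G] [CommGroup H] (e : G ≃* H) : rk G = rk H :=
  (MulEquiv.toAdditive e).toIntLinearEquiv.finrank_eq

theorem index_range_pow_two (G : Type*) [CommGroup G] [Group.FG G] :
    (powMonoidHom (α := G) 2).range.index =
      2 ^ rk G * Nat.card (powMonoidHom (α := G) 2).ker := by
  have : AddGroup.FG (Additive G) := inferInstance
  have : Module.Finite ℤ (Additive G) := Module.Finite.iff_addGroup_fg.mpr this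
  exact index_range_two_nsmul (Additive G)

theorem rk_eq_add_of_surjective {G H : Type*} [CommGroup G] [CommGroup H] [Group.FG G] (f : G →* H)
    (hf : Function.Surjective f) : rk G = rk H + rk f.ker := by
  have h1 : AddGroup.FG (Additive G) := inferInstance
  have : Module.Finite ℤ (Additive G) := Module.Finite.iff_addGroup_fg.mpr h1
  let F : Additive G →ₗ[ℤ] Additive H := (MonoidHom.toAdditive f).toIntLinearMap
  exact finrank_eq_add_of_surjective F hf

theorem rk_le_of_injective {G H : Type*} [CommGroup G] [CommGroup H] [Group.FG H] (f : G →* H)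
    (hf : Function.Injective f) : rk G ≤ rk H := by
  have h1 : AddGroup.FG (Additive H) := inferInstance
  have : Module.Finite ℤ (Additive H) := Module.Finite.iff_addGroup_fg.mpr h1
  let F : Additive G →ₗ[ℤ] Additive H := (MonoidHom.toAdditive f).toIntLinearMap
  exact F.finrank_le_finrank_of_injective hf

theorem rk_range_pow_two (G : Type*) [CommGroup G] [Group.FG G] :
    rk (powMonoidHom (α := G) 2).range = rk G := by
  have h := rk_eq_add_of_surjective (powMonoidHom (α := G) 2).rangeRestrict
    (MonoidHom.rangeRestrict_surjective _)
  have h0 : rk (powMonoidHom (α := G) 2).rangeRestrict.ker = 0 := by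
    rw [rk]
    refine finrank_eq_zero_of_nsmul 2 two_ne_zero fun x => ?_
    have hx : (powMonoidHom (α := G) 2).rangeRestrict x.toMul.1 = 1 := x.toMul.2
    apply Additive.toMul.injective
    apply Subtype.ext
    have := congrArg Subtype.val hx
    simpa using this
  omega

end TwoClass

namespace TwoClass

open Module

theorem fg_subgroup {G : Type*} [CommGroup G] [Group.FG G] (H : Subgroup G) : Group.FG H := by
  have h1 : AddGroup.FG (Additive G) := inferInstance
  have : Module.Finite ℤ (Additive G) := Module.Finite.iff_addGroup_fg.mpr h1
  have h2 : (AddSubgroup.toIntSubmodule (Subgroup.toAddSubgroup H)).FG := IsNoetherian.noetherian _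
  rw [Group.fg_iff_subgroup_fg, Subgroup.fg_iff_add_fg, ← AddGroup.fg_iff_addSubgroup_fg]
  exact Module.Finite.iff_addGroup_fg.mp (Module.Finite.iff_fg.mpr h2)

theorem relIndex_map_pow_two {G : Type*} [CommGroup G] [Group.FG G] (H : Subgroup G) :
    (H.map (powMonoidHom 2)).relIndex H =
      2 ^ rk H * Nat.card ((powMonoidHom (α := G) 2).ker ⊓ H : Subgroup G) := by
  have := fg_subgroup H
  have h := index_range_pow_two H
  have h1 : (H.map (powMonoidHom 2)).subgroupOf H = (powMonoidHom (α := H) 2).range := by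
    ext x
    simp only [Subgroup.mem_subgroupOf, Subgroup.mem_map, MonoidHom.mem_range, powMonoidHom_apply]
    constructor
    · rintro ⟨y, hy, hyx⟩
      exact ⟨⟨y, hy⟩, Subtype.ext hyx⟩
    · rintro ⟨y, rfl⟩
      exact ⟨y, y.2, rfl⟩
  have h2 : (powMonoidHom (α := H) 2).ker ≃ ((powMonoidHom (α := G) 2).ker ⊓ H : Subgroup G) :=
    { toFun := fun x => ⟨x.1.1, congrArg Subtype.val x.2, x.1.2⟩
      invFun := fun x => ⟨⟨x.1, x.2.2⟩, Subtype.ext x.2.1⟩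
      left_inv := fun _ => rfl
      right_inv := fun _ => rfl }
  rw [Subgroup.relIndex, h1, h, Nat.card_congr h2]

section Herbrand

variable {E : Type*} [CommGroup E] (s : E →* E)

/-- `x ↦ x * s x`. -/
def nm : E →* E := MonoidHom.id E * s

/-- `x ↦ x / s x`. -/
def df : E →* E := MonoidHom.id E / s

@[simp] theorem nm_apply (x : E) : nm s x = x * s x := rfl
@[simp] theorem df_apply (x : E) : df s x = x / s x := rfl

theorem mem_ker_df {x : E} : x ∈ (df s).ker ↔ s x = x := by
  rw [MonoidHom.mem_ker, df_apply, div_eq_one, eq_comm]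

theorem mem_ker_nm {x : E} : x ∈ (nm s).ker ↔ x * s x = 1 := Iff.rfl

variable {s} (hs : ∀ x, s (s x) = x)
include hs

theorem range_nm_le : (nm s).range ≤ (df s).ker := by
  rintro _ ⟨x, rfl⟩
  rw [mem_ker_df, nm_apply, map_mul, hs, mul_comm]

theorem range_df_le : (df s).range ≤ (nm s).ker := by
  rintro _ ⟨x, rfl⟩
  rw [mem_ker_nm, df_apply, map_div, hs]
  simp

omit hs in
theorem map_nm_ker_df : (df s).ker.map (nm s) = (df s).ker.map (powMonoidHom 2) := by
  ext x
  simp only [Subgroup.mem_map]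
  refine exists_congr fun y => and_congr_right fun hy => ?_
  rw [mem_ker_df] at hy
  rw [nm_apply, hy, powMonoidHom_apply, sq]

omit hs in
theorem map_df_ker_nm : (nm s).ker.map (df s) = (nm s).ker.map (powMonoidHom 2) := by
  ext x
  simp only [Subgroup.mem_map]
  refine exists_congr fun y => and_congr_right fun hy => ?_
  rw [mem_ker_nm] at hy
  rw [df_apply, powMonoidHom_apply, sq, eq_inv_of_mul_eq_one_right hy, div_inv_eq_mul]

omit hs in
theorem pow_two_ker_inf : (powMonoidHom (α := E) 2).ker ⊓ (df s).ker =
    (powMonoidHom (α := E) 2).ker ⊓ (nm s).ker := by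
  ext x
  simp only [Subgroup.mem_inf]
  refine and_congr_right fun hx => ?_
  have hx' : x * x = 1 := by rw [← sq]; exact hx
  rw [mem_ker_df, mem_ker_nm]
  constructor
  · intro h; rw [h, hx']
  · intro h; exact mul_left_cancel (h.trans hx'.symm)

variable [Group.FG E]

theorem rk_add : rk E = rk (df s).ker + rk (nm s).ker := by
  have h1 := rk_eq_add_of_surjective (nm s).rangeRestrict (nm s).rangeRestrict_surjective
  rw [MonoidHom.ker_rangeRestrict] at h1
  have f1 := fg_subgroup (df s).ker
  have f2 := fg_subgroup (nm s).range
  have h2 : rk (nm s).range ≤ rk (df s).ker :=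
    rk_le_of_injective (Subgroup.inclusion (range_nm_le hs)) (Subgroup.inclusion_injective _)
  have h3 : rk (df s).ker ≤ rk (nm s).range := by
    rw [← rk_range_pow_two]
    refine rk_le_of_injective
      (((df s).ker.subtype.comp (powMonoidHom (α := (df s).ker) 2).range.subtype).codRestrict
        (nm s).range ?_) ?_
    · rintro ⟨_, y, rfl⟩
      refine ⟨y.1, ?_⟩
      have := (mem_ker_df s).mp y.2
      rw [nm_apply, this, ← sq]; rfl
    · intro a b hab
      have : (a.1.1 : E) = b.1.1 := congrArg (fun z : (nm s).range => z.1) hab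
      exact Subtype.ext (Subtype.ext this)
  omega

omit hs in
theorem finite_sq_ker : Nat.card (powMonoidHom (α := E) 2).ker ≠ 0 := by
  have h1 : AddGroup.FG (Additive E) := inferInstance
  have := fg_subgroup (powMonoidHom (α := E) 2).ker
  have h2 : Finite (powMonoidHom (α := E) 2).ker := by
    refine CommGroup.finite_of_fg_isMulTorsion _ fun x => ?_
    refine isOfFinOrder_iff_pow_eq_one.mpr ⟨2, two_pos, Subtype.ext x.2⟩
  exact Nat.card_pos.ne'

theorem herbrand :
    (df s).range.relIndex (nm s).ker * 2 ^ rk (df s).ker =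
        (nm s).range.relIndex (df s).ker * 2 ^ rk (nm s).ker ∧
      (nm s).range.relIndex (df s).ker ≠ 0 := by
  have a1 := relIndex_map_pow_two (df s).ker
  have a2 := relIndex_map_pow_two (nm s).ker
  rw [← map_nm_ker_df, pow_two_ker_inf] at a1
  rw [← map_df_ker_nm] at a2
  have b1 := Subgroup.relIndex_mul_relIndex _ _ _
    (Subgroup.map_mono (f := nm s) (le_top (a := (df s).ker))) (MonoidHom.range_eq_map (nm s) ▸ range_nm_le hs)
  have b2 := Subgroup.relIndex_mul_relIndex _ _ _
    (Subgroup.map_mono (f := df s) (le_top (a := (nm s).ker))) (MonoidHom.range_eq_map (df s) ▸ range_df_le hs)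
  rw [Subgroup.relIndex_map_map, a1, ← MonoidHom.range_eq_map] at b1
  rw [Subgroup.relIndex_map_map, a2, ← MonoidHom.range_eq_map, sup_comm (nm s).ker] at b2
  have hfin := finite_sq_ker (E := E)
  have hc : Nat.card ((powMonoidHom (α := E) 2).ker ⊓ (nm s).ker : Subgroup E) ≠ 0 := by
    have : Finite (powMonoidHom (α := E) 2).ker := Nat.finite_of_card_ne_zero hfin
    have : Finite ((powMonoidHom (α := E) 2).ker ⊓ (nm s).ker : Subgroup E) :=
      Finite.of_injective _ (Subgroup.inclusion_injective (inf_le_left))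
    exact Nat.card_pos.ne'
  rw [top_sup_eq] at b1 b2
  set c := ((df s).ker ⊔ (nm s).ker).relIndex ⊤
  set t := Nat.card ((powMonoidHom (α := E) 2).ker ⊓ (nm s).ker : Subgroup E)
  have hc0 : c ≠ 0 := by
    rintro h
    rw [h, zero_mul] at b1
    exact mul_ne_zero (by positivity) hc b1.symm
  constructor
  · apply Nat.eq_of_mul_eq_mul_left (Nat.pos_of_ne_zero (mul_ne_zero hc0 hc))
    linear_combination (2 ^ rk (df s).ker * t) * b2 - (2 ^ rk (nm s).ker * t) * b1
  · intro h
    rw [h, mul_zero] at b1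
    exact mul_ne_zero (by positivity) hc b1.symm

end Herbrand

end TwoClass

namespace TwoClass

theorem relIndex_dvd_of_le_right' {G : Type*} [CommGroup G] (H : Subgroup G) {K L : Subgroup G}
    (h : K ≤ L) : H.relIndex K ∣ H.relIndex L := by
  rw [← Subgroup.relIndex_sup_left K H, ← Subgroup.relIndex_sup_left L H]
  exact ⟨_, (Subgroup.relIndex_mul_relIndex _ _ _ le_sup_left (sup_le_sup_left h H)).symm⟩

theorem mem_of_pow_mem_of_coprime {G : Type*} [CommGroup G] (H : Subgroup G) {b : G} {m n : ℕ}
    (hmn : Nat.Coprime m n) (hm : b ^ m ∈ H) (hn : b ^ n ∈ H) : b ∈ H := by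
  have h := Nat.gcd_eq_gcd_ab m n
  rw [Nat.Coprime.gcd_eq_one hmn] at h
  have : b = (b ^ m) ^ m.gcdA n * (b ^ n) ^ m.gcdB n := by
    rw [← zpow_natCast, ← zpow_natCast, ← zpow_mul, ← zpow_mul, ← zpow_add, ← h]
    simp
  rw [this]
  exact H.mul_mem (H.zpow_mem hm _) (H.zpow_mem hn _)

section Ambiguous

variable {L I : Type*} [CommGroup L] [CommGroup I] {d : L →* I} {s : L →* L} {S : I →* I}

theorem relIndex_principal_fixed (hs : ∀ x, s (s x) = x) (hd : ∀ x, d (s x) = S (d x))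
    (h90 : ∀ x, x * s x = 1 → ∃ y, x = y / s y) :
    ((df s).ker.map d).relIndex (d.range ⊓ (df S).ker) =
      (d.ker.map (df s)).relIndex ((nm s).ker ⊓ d.ker) := by
  set U := (df S).ker.comap d with hU
  have h1 : d.range ⊓ (df S).ker = U.map d := by
    rw [hU, Subgroup.map_comap_eq]
  have h2 : (nm s).ker ⊓ d.ker = U.map (df s) := by
    ext x
    simp only [Subgroup.mem_inf, Subgroup.mem_map, hU, Subgroup.mem_comap, mem_ker_df, mem_ker_nm]
    constructor
    · rintro ⟨hx1, hx2⟩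
      obtain ⟨y, rfl⟩ := h90 x hx1
      refine ⟨y, ?_, rfl⟩
      rw [MonoidHom.mem_ker, map_div, div_eq_one, hd] at hx2
      exact hx2.symm
    · rintro ⟨y, hy, rfl⟩
      refine ⟨range_df_le hs ⟨y, rfl⟩, ?_⟩
      rw [MonoidHom.mem_ker, df_apply, map_div, hd, hy, div_self']
  have h3 : d.ker ≤ U := by
    intro x hx
    rw [MonoidHom.mem_ker] at hx
    rw [hU, Subgroup.mem_comap, mem_ker_df, hx, map_one]
  have h4 : (df s).ker ≤ U := by
    intro x hx
    rw [mem_ker_df] at hx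
    rw [hU, Subgroup.mem_comap, mem_ker_df, ← hd, hx]
  rw [h1, h2, Subgroup.relIndex_map_map, Subgroup.relIndex_map_map, sup_of_le_left h3,
    sup_of_le_left h4, sup_comm]

variable {J : Subgroup I}

theorem ambiguous_dvd (hs : ∀ x, s (s x) = x) (hS : ∀ x, S (S x) = x)
    (hd : ∀ x, d (s x) = S (d x)) (h90 : ∀ x, x * s x = 1 → ∃ y, x = y / s y)
    (hJN : ∀ a, a * S a ∈ J)
    (hodd : ∃ n, Odd n ∧ ∀ b ∈ J, b ^ n ∈ (df s).ker.map d) :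
    (d.ker.map (df s)).relIndex ((nm s).ker ⊓ d.ker) ∣ J.relIndex (df S).ker ∧
    d.range.relIndex (d.range.comap (powMonoidHom 2)) *
        (d.ker.map (df s)).relIndex ((nm s).ker ⊓ d.ker) ∣
      (d.ker.map (nm s)).relIndex ((df s).ker ⊓ d.ker ⊓ (nm s).range) * J.relIndex (df S).ker := by
  obtain ⟨n, hn, hodd⟩ := hodd
  rw [← relIndex_principal_fixed hs hd h90]
  set P := d.range with hP
  set C := P.comap (powMonoidHom 2) with hC
  set Ip := (df S).ker with hIp
  set Q := (df s).ker.map d with hQ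
  have hPC : P ≤ C := fun x hx => P.pow_mem hx 2
  have hQP : Q ≤ P ⊓ Ip := by
    rintro _ ⟨x, hx, rfl⟩
    rw [SetLike.mem_coe, mem_ker_df] at hx
    refine ⟨⟨x, rfl⟩, ?_⟩
    exact (mem_ker_df S).mpr (by rw [← hd, hx])
  have hnQ : ∀ x, d (x * s x) ∈ Q := fun x => ⟨_, range_nm_le hs ⟨x, rfl⟩, rfl⟩
  have h4n : Nat.Coprime 4 n := (Nat.coprime_pow_left_iff (n := 2) two_pos 2 n).mpr hn.coprime_two_left
  have h2n : Nat.Coprime 2 n := hn.coprime_two_left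
  have hJQ : J ⊓ (C ⊓ Ip) ≤ Q := by
    rintro b ⟨hbJ, ⟨x, hx⟩, hb⟩
    refine mem_of_pow_mem_of_coprime Q h4n ?_ (hodd b hbJ)
    have h1 := hnQ x
    replace hb := (mem_ker_df S).mp hb
    have hx' : d x = b ^ 2 := hx
    rw [map_mul, hd, hx', map_pow, hb, ← pow_add] at h1
    exact h1
  have hA : Q.relIndex (C ⊓ Ip) ∣ J.relIndex Ip :=
    (Subgroup.relIndex_dvd_of_le_left (C ⊓ Ip) hJQ).trans
      ((Subgroup.inf_relIndex_right J (C ⊓ Ip)) ▸ relIndex_dvd_of_le_right' J inf_le_right)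
  have hB := Subgroup.relIndex_mul_relIndex _ _ _ hQP (inf_le_inf_right Ip hPC)
  refine ⟨(Dvd.intro _ hB).trans hA, ?_⟩
  set C0 := C ⊓ (P ⊔ Ip) with hC0
  have hPC0 : P ≤ C0 := le_inf hPC le_sup_left
  have h1 : P.relIndex C0 ∣ (P ⊓ Ip).relIndex (C ⊓ Ip) := by
    have e1 : C0 ≤ P ⊔ (C ⊓ Ip) := by
      rintro x ⟨hx, hx2⟩
      obtain ⟨y, hy, z, hz, rfl⟩ := Subgroup.mem_sup.mp hx2
      refine Subgroup.mul_mem_sup hy ⟨?_, hz⟩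
      have : (y * z) * y⁻¹ ∈ C := C.mul_mem hx (C.inv_mem (hPC hy))
      simpa using this
    have e2 : P ⊓ (C ⊓ Ip) = P ⊓ Ip := by rw [← inf_assoc, inf_of_le_left hPC]
    have := relIndex_dvd_of_le_right' P e1
    rwa [Subgroup.relIndex_sup_left, ← Subgroup.inf_relIndex_right P (C ⊓ Ip), e2] at this
  have h2 : C0.relIndex C ∣
      (d.ker.map (nm s)).relIndex ((df s).ker ⊓ d.ker ⊓ (nm s).range) := by
    let Γ : Subgroup (I × L) :=
      { carrier := {z | z.1 ∈ C ∧ S z.1 = z.1 * d z.2}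
        one_mem' := by simp [C.one_mem]
        mul_mem' := by
          rintro ⟨a, x⟩ ⟨b, y⟩ ⟨h1, h2⟩ ⟨h3, h4⟩
          refine ⟨C.mul_mem h1 h3, ?_⟩
          simp only [Prod.fst_mul, Prod.snd_mul, map_mul] at *
          rw [h2, h4, mul_mul_mul_comm]
        inv_mem' := by
          rintro ⟨a, x⟩ ⟨h1, h2⟩
          refine ⟨C.inv_mem h1, ?_⟩
          simp only [Prod.fst_inv, Prod.snd_inv, map_inv] at *
          rw [h2, mul_inv] }
    let ν : I × L →* L := (nm s).comp (MonoidHom.snd I L)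
    have g1 : C = Γ.map (MonoidHom.fst I L) := by
      ext a
      constructor
      · intro ha
        obtain ⟨y, hy⟩ := id ha
        have hy' : d y = a ^ 2 := hy
        have hc : a * S a ∈ Q := by
          refine mem_of_pow_mem_of_coprime Q h2n ?_ (hodd _ (hJN a))
          have := hnQ y
          rwa [map_mul, hd, hy', map_pow, ← mul_pow] at this
        obtain ⟨x, -, hx⟩ := hc
        refine ⟨(a, x / y), ⟨ha, ?_⟩, rfl⟩
        simp only [map_div]
        rw [hx, hy', sq, mul_div_mul_left_eq_div, mul_div_cancel]
      · rintro ⟨⟨b, x⟩, ⟨hb, -⟩, rfl⟩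
        exact hb
    have g2 : C0.relIndex C = (C0.comap (MonoidHom.fst I L)).relIndex Γ := by
      conv_lhs => rw [g1]
      rw [Subgroup.relIndex_comap]
    have g3 : Γ.map ν ≤ (df s).ker ⊓ d.ker ⊓ (nm s).range := by
      rintro _ ⟨⟨a, x⟩, ⟨ha, hx⟩, rfl⟩
      refine ⟨⟨range_nm_le hs ⟨x, rfl⟩, ?_⟩, ⟨x, rfl⟩⟩
      simp only [] at hx
      have h := congrArg S hx
      rw [hS, map_mul, ← hd, hx, mul_assoc, ← map_mul] at h
      exact mul_left_cancel (h.symm.trans (mul_one a).symm)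
    refine dvd_trans ?_ (relIndex_dvd_of_le_right' _ g3)
    rw [← Subgroup.relIndex_comap, g2, ← Subgroup.inf_relIndex_right ((d.ker.map (nm s)).comap ν)]
    apply Subgroup.relIndex_dvd_of_le_left
    rintro ⟨a, x⟩ ⟨⟨e, he, hex⟩, ha, hx⟩
    refine ⟨ha, ?_⟩
    have hex' : e * s e = x * s x := hex
    obtain ⟨y, hy⟩ := h90 (x / e) (by
      rw [map_div, div_mul_div_comm, hex', div_self'])
    simp only [] at hx
    have hdx : d x = d y / S (d y) := by
      have := congrArg d hy
      rw [map_div, map_div, hd, MonoidHom.mem_ker.mp he, div_one] at this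
      exact this
    have : a = (d y)⁻¹ * (a * d y) := by rw [mul_comm a, inv_mul_cancel_left]
    change a ∈ P ⊔ Ip
    rw [this]
    refine Subgroup.mul_mem_sup (P.inv_mem ⟨y, rfl⟩) ?_
    rw [hIp, mem_ker_df, map_mul, hx, hdx, mul_assoc, div_mul_cancel]
  have h3 := Subgroup.relIndex_mul_relIndex _ _ _ hPC0 (inf_le_left : C0 ≤ C)
  rw [← h3]
  calc P.relIndex C0 * C0.relIndex C * Q.relIndex (P ⊓ Ip)
      = C0.relIndex C * (Q.relIndex (P ⊓ Ip) * P.relIndex C0) := by ring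
    _ ∣ _ := mul_dvd_mul h2 (((mul_dvd_mul_left _ h1).trans (by rw [hB])).trans hA)

end Ambiguous

end TwoClass

namespace TwoClass

/-- The Herbrand quotient of a finitely generated subgroup stable under an involution. -/
theorem herbrand_subgroup {L : Type*} [CommGroup L] {s : L →* L} (hs : ∀ x, s (s x) = x)
    (E : Subgroup L) [Group.FG E] (hE : ∀ x ∈ E, s x ∈ E) :
    (E.map (df s)).relIndex ((nm s).ker ⊓ E) * 2 ^ (2 * rk ((df s).ker ⊓ E : Subgroup L)) =
      (E.map (nm s)).relIndex ((df s).ker ⊓ E) * 2 ^ rk E ∧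
    (E.map (nm s)).relIndex ((df s).ker ⊓ E) ≠ 0 ∧ E.map (nm s) ≤ (df s).ker ⊓ E := by
  let sE : E →* E := (s.comp E.subtype).codRestrict E fun x => hE x x.2
  have hsE2 : ∀ x, sE (sE x) = x := fun x => Subtype.ext (hs x)
  obtain ⟨q1, q2⟩ := herbrand hsE2
  have q3 := rk_add hsE2
  have e1 : (df sE).ker.map E.subtype = (df s).ker ⊓ E := by
    ext x
    simp only [Subgroup.mem_map, Subgroup.mem_inf, mem_ker_df]
    constructor
    · rintro ⟨y, hy, rfl⟩
      exact ⟨congrArg Subtype.val hy, y.2⟩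
    · rintro ⟨h1, h2⟩
      exact ⟨⟨x, h2⟩, Subtype.ext h1, rfl⟩
  have e2 : (nm sE).ker.map E.subtype = (nm s).ker ⊓ E := by
    ext x
    simp only [Subgroup.mem_map, Subgroup.mem_inf, mem_ker_nm]
    constructor
    · rintro ⟨y, hy, rfl⟩
      exact ⟨congrArg Subtype.val hy, y.2⟩
    · rintro ⟨h1, h2⟩
      exact ⟨⟨x, h2⟩, Subtype.ext h1, rfl⟩
  have e3 : (df sE).range.map E.subtype = E.map (df s) := by
    ext x
    simp only [Subgroup.mem_map, MonoidHom.mem_range]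
    constructor
    · rintro ⟨_, ⟨y, rfl⟩, rfl⟩
      exact ⟨y.1, y.2, rfl⟩
    · rintro ⟨y, hy, rfl⟩
      exact ⟨_, ⟨⟨y, hy⟩, rfl⟩, rfl⟩
  have e4 : (nm sE).range.map E.subtype = E.map (nm s) := by
    ext x
    simp only [Subgroup.mem_map, MonoidHom.mem_range]
    constructor
    · rintro ⟨_, ⟨y, rfl⟩, rfl⟩
      exact ⟨y.1, y.2, rfl⟩
    · rintro ⟨y, hy, rfl⟩
      exact ⟨_, ⟨⟨y, hy⟩, rfl⟩, rfl⟩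
  have hinj := E.subtype_injective
  rw [← Subgroup.relIndex_map_map_of_injective _ _ hinj, e2, e3] at q1
  rw [← Subgroup.relIndex_map_map_of_injective _ _ hinj, e1, e4] at q1 q2
  have e5 : rk (df sE).ker = rk ((df s).ker ⊓ E : Subgroup L) := by
    rw [← e1]
    exact rk_congr ((df sE).ker.equivMapOfInjective _ hinj)
  rw [e5] at q1 q3
  refine ⟨?_, q2, ?_⟩
  · rw [q3, pow_add, mul_left_comm, ← q1]; ring
  · rw [← e1, ← e4]
    exact Subgroup.map_mono (range_nm_le hsE2)

section Ambiguous

variable {L I : Type*} [CommGroup L] [CommGroup I] {d : L →* I} {s : L →* L} {S : I →* I}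
  {J : Subgroup I}

theorem ambiguous_bound (hs : ∀ x, s (s x) = x) (hS : ∀ x, S (S x) = x)
    (hd : ∀ x, d (s x) = S (d x)) (h90 : ∀ x, x * s x = 1 → ∃ y, x = y / s y)
    (hJN : ∀ a, a * S a ∈ J)
    (hodd : ∃ n, Odd n ∧ ∀ b ∈ J, b ^ n ∈ (df s).ker.map d) [Group.FG d.ker]
    {t : ℕ} (ht : J.relIndex (df S).ker ∣ 2 ^ t) :
    (d.ker.map (nm s)).relIndex ((df s).ker ⊓ d.ker) ≠ 0 ∧
    (d.ker.map (nm s)).relIndex ((df s).ker ⊓ d.ker) * 2 ^ rk d.ker ∣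
      2 ^ (t + 2 * rk ((df s).ker ⊓ d.ker : Subgroup L)) ∧
    d.range.relIndex (d.range.comap (powMonoidHom 2)) *
        ((df s).ker ⊓ d.ker ⊓ (nm s).range).relIndex ((df s).ker ⊓ d.ker) * 2 ^ rk d.ker ∣
      2 ^ (t + 2 * rk ((df s).ker ⊓ d.ker : Subgroup L)) := by
  obtain ⟨q1, q2, hle⟩ := herbrand_subgroup hs d.ker fun x hx => by
    rw [MonoidHom.mem_ker, hd, MonoidHom.mem_ker.mp hx, map_one]
  obtain ⟨h1, h2⟩ := ambiguous_dvd hs hS hd h90 hJN hodd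
  have h3 := Subgroup.relIndex_mul_relIndex (d.ker.map (nm s))
    ((df s).ker ⊓ d.ker ⊓ (nm s).range) ((df s).ker ⊓ d.ker)
    (le_inf hle (MonoidHom.range_eq_map (nm s) ▸ Subgroup.map_mono le_top)) inf_le_left
  set a := (d.ker.map (nm s)).relIndex ((df s).ker ⊓ d.ker)
  set b := (d.ker.map (df s)).relIndex ((nm s).ker ⊓ d.ker)
  set m := ((df s).ker ⊓ d.ker ⊓ (nm s).range).relIndex ((df s).ker ⊓ d.ker)
  set w := (d.ker.map (nm s)).relIndex ((df s).ker ⊓ d.ker ⊓ (nm s).range)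
  set c := d.range.relIndex (d.range.comap (powMonoidHom 2))
  set rX := rk ((df s).ker ⊓ d.ker : Subgroup L)
  refine ⟨q2, ?_, ?_⟩
  · rw [← q1, pow_add]
    exact mul_dvd_mul_right (h1.trans ht) _
  · apply Nat.dvd_of_mul_dvd_mul_left (Nat.pos_of_ne_zero q2)
    calc a * (c * m * 2 ^ rk d.ker) = c * b * (m * 2 ^ (2 * rX)) := by
          rw [show a * (c * m * 2 ^ rk d.ker) = c * m * (a * 2 ^ rk d.ker) by ring, ← q1]; ring
      _ ∣ (w * 2 ^ t) * (m * 2 ^ (2 * rX)) :=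
          mul_dvd_mul_right (h2.trans (mul_dvd_mul_left _ ht)) _
      _ = _ := by rw [← h3]; ring

end Ambiguous

theorem four_le_relIndex {G : Type*} [CommGroup G] (H K : Subgroup G) (h0 : H.relIndex K ≠ 0)
    {a b : G} (ha : a ∈ K) (hb : b ∈ K) (ha' : a ∉ H) (hb' : b ∉ H) (hab : a * b ∉ H)
    (hsq : a ^ 2 ∈ H) : 4 ≤ H.relIndex K := by
  set H' := H ⊔ Subgroup.zpowers a
  have h1 : H.relIndex (K ⊓ H') * (K ⊓ H').relIndex K = (H ⊓ K).relIndex K := by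
    rw [← Subgroup.inf_relIndex_right H (K ⊓ H')]
    have : H ⊓ (K ⊓ H') = H ⊓ K := le_antisymm (inf_le_inf_left _ inf_le_left)
      (le_inf inf_le_left (le_inf inf_le_right (inf_le_left.trans le_sup_left)))
    rw [this]
    exact Subgroup.relIndex_mul_relIndex _ _ _
      (le_inf inf_le_right (inf_le_left.trans le_sup_left)) inf_le_left
  rw [Subgroup.inf_relIndex_right] at h1
  have h2 : H.relIndex (K ⊓ H') ≠ 1 := by
    rw [Ne, Subgroup.relIndex_eq_one]
    exact fun h => ha' (h ⟨ha, Subgroup.mem_sup_right (Subgroup.mem_zpowers a)⟩)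
  have h3 : (K ⊓ H').relIndex K ≠ 1 := by
    rw [Ne, Subgroup.relIndex_eq_one]
    intro h
    obtain ⟨x, hx, y, ⟨n, rfl⟩, hxy⟩ := Subgroup.mem_sup.mp (h hb).2
    have hz : ∀ k : ℤ, a ^ (2 * k) ∈ H := fun k => by
      rw [zpow_mul]; exact H.zpow_mem (by exact_mod_cast hsq) k
    rcases Int.even_or_odd' n with ⟨k, rfl | rfl⟩
    · exact hb' (hxy ▸ H.mul_mem hx (hz k))
    · apply hab
      have : a * b = x * a ^ (2 * (k + 1)) := by
        rw [← hxy, mul_left_comm]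
        congr 1
        simp only []
        rw [← zpow_one_add]; ring_nf
      rw [this]
      exact H.mul_mem hx (hz _)
  have h4 : H.relIndex (K ⊓ H') ≠ 0 := fun h => h0 (by rw [← h1, h, zero_mul])
  have h5 : (K ⊓ H').relIndex K ≠ 0 := fun h => h0 (by rw [← h1, h, mul_zero])
  rw [← h1]
  exact Nat.mul_le_mul (show 2 ≤ _ by omega) (show 2 ≤ _ by omega)

theorem two_le_relIndex {G : Type*} [CommGroup G] (H K : Subgroup G) (h0 : H.relIndex K ≠ 0)
    {a : G} (ha : a ∈ K) (ha' : a ∉ H) : 2 ≤ H.relIndex K := by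
  have h2 : H.relIndex K ≠ 1 := by
    rw [Ne, Subgroup.relIndex_eq_one]
    exact fun h => ha' (h ha)
  omega

theorem card_ker_pow_two_of_surjective {I C : Type*} [CommGroup I] [CommGroup C] (π : I →* C)
    (hπ : Function.Surjective π) :
    Nat.card (powMonoidHom (α := C) 2).ker = π.ker.relIndex (π.ker.comap (powMonoidHom 2)) := by
  have : (powMonoidHom (α := C) 2).ker = (π.ker.comap (powMonoidHom 2)).map π := by
    ext x
    constructor
    · intro hx
      obtain ⟨y, rfl⟩ := hπ x
      refine ⟨y, ?_, rfl⟩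
      have : (π y) ^ 2 = 1 := hx
      simpa [MonoidHom.mem_ker] using this
    · rintro ⟨y, hy, rfl⟩
      have : π (y ^ 2) = 1 := hy
      simpa [MonoidHom.mem_ker] using this
  rw [this, ← Subgroup.relIndex_bot_left, ← Subgroup.relIndex_comap, MonoidHom.comap_bot]

theorem odd_card_of_sq_injective {G : Type*} [CommGroup G] [Finite G]
    (h : ∀ x : G, x ^ 2 = 1 → x = 1) : Odd (Nat.card G) := by
  rw [← Nat.not_even_iff_odd, even_iff_two_dvd]
  intro h2
  obtain ⟨x, hx⟩ := exists_prime_orderOf_dvd_card' 2 h2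
  have h3 := h x (by rw [← hx]; exact pow_orderOf_eq_one x)
  rw [h3, orderOf_one] at hx
  omega

theorem index_sq_of_finite (G : Type*) [CommGroup G] [Finite G] :
    (powMonoidHom (α := G) 2).range.index = Nat.card (powMonoidHom (α := G) 2).ker :=
  Subgroup.index_range

theorem exists_mul_sq {G : Type*} [CommGroup G] [Finite G]
    (h2 : Nat.card (powMonoidHom (α := G) 2).ker ≤ 2) {g : G} (hg : ¬ ∃ y, g = y ^ 2) (x : G) :
    (∃ y, x = y ^ 2) ∨ ∃ y, x = g * y ^ 2 := by
  have hg' : g ∉ (powMonoidHom (α := G) 2).range := fun ⟨y, hy⟩ => hg ⟨y, hy.symm⟩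
  have hi : (powMonoidHom (α := G) 2).range.index = 2 := by
    have h1 := index_sq_of_finite G
    have h3 : (powMonoidHom (α := G) 2).range.index ≠ 1 := by
      rw [Ne, Subgroup.index_eq_one]
      exact fun h => hg' (h ▸ Subgroup.mem_top g)
    have h4 : Nat.card (powMonoidHom (α := G) 2).ker ≠ 0 := Nat.card_pos.ne'
    omega
  by_cases hx : x ∈ (powMonoidHom (α := G) 2).range
  · obtain ⟨y, rfl⟩ := hx; exact Or.inl ⟨y, rfl⟩
  · right
    have := (Subgroup.mul_mem_iff_of_index_two hi (a := g⁻¹) (b := x)).mpr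
      (by simp [hg', hx])
    obtain ⟨y, hy⟩ := this
    exact ⟨y, by rw [show y ^ 2 = g⁻¹ * x from hy, mul_inv_cancel_left]⟩

theorem factorization_two_orderOf {G : Type*} [CommGroup G] [Finite G]
    (h2 : Nat.card (powMonoidHom (α := G) 2).ker ≤ 2) {g : G} (hg : ¬ ∃ y, g = y ^ 2) :
    (orderOf g).factorization 2 = (Nat.card G).factorization 2 := by
  have hodd : Odd (Nat.card (G ⧸ Subgroup.zpowers g)) := by
    apply odd_card_of_sq_injective
    have hsurj : Function.Surjective (fun x : G ⧸ Subgroup.zpowers g => x ^ 2) := by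
      intro x
      obtain ⟨x, rfl⟩ := QuotientGroup.mk_surjective x
      rcases exists_mul_sq h2 hg x with ⟨y, rfl⟩ | ⟨y, rfl⟩
      · exact ⟨y, rfl⟩
      · refine ⟨y, ?_⟩
        have : ((g : G) : G ⧸ Subgroup.zpowers g) = 1 :=
          (QuotientGroup.eq_one_iff g).mpr (Subgroup.mem_zpowers g)
        simp [this]
    intro x hx
    exact (Finite.injective_iff_surjective.mpr hsurj) (by simpa using hx)
  have h1 := Subgroup.card_eq_card_quotient_mul_card_subgroup (Subgroup.zpowers g)
  rw [h1, Nat.card_zpowers, Nat.factorization_mul hodd.pos.ne' (orderOf_pos g).ne',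
    Finsupp.add_apply, Nat.factorization_eq_zero_of_not_dvd (n := Nat.card (G ⧸ Subgroup.zpowers g)), zero_add]
  rw [← even_iff_two_dvd, Nat.not_even_iff_odd]
  exact hodd

end TwoClass

namespace TwoClass
open NumberField nonZeroDivisors
open Complex (I I_sq)
open IntermediateField (adjoin subset_adjoin)
open Module (finrank)
set_option linter.unusedSectionVars false

/-- The group of invertible fractional ideals of a number field. -/
abbrev FI (K : Type*) [Field K] := (FractionalIdeal (𝓞 K)⁰ K)ˣ

/-- The homomorphism sending a nonzero element to its principal fractional ideal. -/
noncomputable abbrev prin (K : Type*) [Field K] [NumberField K] : Kˣ →* FI K :=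
  toPrincipalIdeal (𝓞 K) K

section
variable {X K M : Type*} [Field X] [NumberField X] [Field K] [NumberField K]
  [Field M] [NumberField M]

theorem mapRingHom_injective (f : X →+* K) :
    Function.Injective (RingOfIntegers.mapRingHom f) := fun a b h => by
  apply RingOfIntegers.ext
  apply f.injective
  simpa using congrArg (algebraMap (𝓞 K) K) h

theorem le_comap_mapRingHom (f : X →+* K) :
    (𝓞 X)⁰ ≤ Submonoid.comap (RingOfIntegers.mapRingHom f) (𝓞 K)⁰ := fun x hx => by
  rw [Submonoid.mem_comap, mem_nonZeroDivisors_iff_ne_zero]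
  rw [mem_nonZeroDivisors_iff_ne_zero] at hx
  exact fun h => hx ((map_eq_zero_iff _ (mapRingHom_injective f)).1 h)

/-- Extension of fractional ideals along an embedding of number fields. -/
noncomputable def extI (f : X →+* K) : FI X →* FI K :=
  Units.map (FractionalIdeal.extendedHom' K (le_comap_mapRingHom f)).toMonoidHom

theorem coe_extI (f : X →+* K) (I : FI X) :
    (extI f I : FractionalIdeal (𝓞 K)⁰ K) =
      FractionalIdeal.extended K (le_comap_mapRingHom f) (I : FractionalIdeal (𝓞 X)⁰ X) := rfl

theorem isLocalization_map_mapRingHom (f : X →+* K) (x : X) :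
    IsLocalization.map K (RingOfIntegers.mapRingHom f) (le_comap_mapRingHom f) x = f x := by
  have : IsLocalization.map K (RingOfIntegers.mapRingHom f) (le_comap_mapRingHom f) = f := by
    apply IsLocalization.ringHom_ext (𝓞 X)⁰
    ext y
    simp
  rw [this]

theorem map_mem_extI (f : X →+* K) {I : FI X} {x : X}
    (hx : x ∈ (I : FractionalIdeal (𝓞 X)⁰ X)) :
    f x ∈ (extI f I : FractionalIdeal (𝓞 K)⁰ K) := by
  rw [coe_extI, FractionalIdeal.mem_extended_iff]
  exact Submodule.subset_span ⟨x, hx, isLocalization_map_mapRingHom f x⟩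

theorem extI_comp (f : X →+* K) (g : K →+* M) (I : FI X) :
    extI g (extI f I) = extI (g.comp f) I := by
  apply Units.ext
  exact FractionalIdeal.extended_extended (W := M) K (le_comap_mapRingHom f)
    (I : FractionalIdeal (𝓞 X)⁰ X) (le_comap_mapRingHom g)

theorem extI_prin (f : X →+* K) (x : Xˣ) :
    extI f (prin X x) = prin K (Units.map f.toMonoidHom x) := by
  apply Units.ext
  rw [coe_extI, coe_toPrincipalIdeal, FractionalIdeal.extended_spanSingleton,
    isLocalization_map_mapRingHom, coe_toPrincipalIdeal]
  rfl

theorem mem_one_iff {x : K} : x ∈ (1 : FractionalIdeal (𝓞 K)⁰ K) ↔ IsIntegral ℤ x := by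
  rw [FractionalIdeal.mem_one_iff]
  exact ⟨fun ⟨y, hy⟩ => hy ▸ y.isIntegral_coe, fun h => ⟨⟨x, h⟩, rfl⟩⟩

theorem FI_eq_one {I : FI K} (h1 : ∀ x ∈ (I : FractionalIdeal (𝓞 K)⁰ K), IsIntegral ℤ x)
    (h2 : ∀ x ∈ ((I⁻¹ : FI K) : FractionalIdeal (𝓞 K)⁰ K), IsIntegral ℤ x) : I = 1 := by
  have h1' : (I : FractionalIdeal (𝓞 K)⁰ K) ≤ 1 := fun x hx => mem_one_iff.2 (h1 x hx)
  have h2' : ((I⁻¹ : FI K) : FractionalIdeal (𝓞 K)⁰ K) ≤ 1 := fun x hx => mem_one_iff.2 (h2 x hx)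
  apply Units.ext
  apply le_antisymm h1'
  calc (1 : FractionalIdeal (𝓞 K)⁰ K) = ((I * I⁻¹ : FI K) : FractionalIdeal (𝓞 K)⁰ K) := by simp
    _ = I * ((I⁻¹ : FI K) : FractionalIdeal (𝓞 K)⁰ K) := Units.val_mul _ _
    _ ≤ I * 1 := mul_le_mul_right h2' _
    _ = I := mul_one _

theorem extI_injective (f : X →+* K) : Function.Injective (extI f) := by
  rw [injective_iff_map_eq_one]
  have key : ∀ I : FI X, extI f I = 1 →
      ∀ x ∈ (I : FractionalIdeal (𝓞 X)⁰ X), IsIntegral ℤ x := fun I hI x hx => by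
    have := map_mem_extI f hx
    rw [hI, Units.val_one, mem_one_iff] at this
    exact (isIntegral_algHom_iff f.toIntAlgHom f.injective).1 this
  exact fun I hI => FI_eq_one (key I hI) (key _ (by rw [map_inv, hI, inv_one]))

theorem extI_id (I : FI K) : extI (RingHom.id K) I = I := by
  apply extI_injective (RingHom.id K)
  rw [extI_comp]
  rfl

theorem FI_pow_left_injective {n : ℕ} (hn : n ≠ 0) : Function.Injective fun I : FI K => I ^ n := by
  have key : ∀ I : FI K, I ^ n = 1 →
      ∀ x ∈ (I : FractionalIdeal (𝓞 K)⁰ K), IsIntegral ℤ x := fun I hI x hx => by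
    have : x ^ n ∈ ((I : FractionalIdeal (𝓞 K)⁰ K) ^ n) := by
      clear hn hI
      induction n with
      | zero => simp
      | succ n ih => rw [pow_succ, pow_succ]; exact FractionalIdeal.mul_mem_mul ih hx
    rw [← Units.val_pow_eq_pow_val, hI, Units.val_one, mem_one_iff] at this
    exact this.of_pow (Nat.pos_of_ne_zero hn)
  intro I J h
  have h1 : (I / J) ^ n = 1 := by
    rw [div_pow, div_eq_one]; exact h
  exact div_eq_one.1 (FI_eq_one (key _ h1) (key _ (by rw [inv_pow, h1, inv_one])))

/-- The fractional ideal attached to a nonzero integral ideal. -/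
noncomputable def mkI (I : Ideal (𝓞 K)) (h : I ≠ ⊥) : FI K :=
  Units.mk0 (I : FractionalIdeal (𝓞 K)⁰ K) (by simpa using h)

theorem coe_mkI (I : Ideal (𝓞 K)) (h : I ≠ ⊥) :
    (mkI I h : FractionalIdeal (𝓞 K)⁰ K) = (I : FractionalIdeal (𝓞 K)⁰ K) := rfl

theorem mkI_mul (I J : Ideal (𝓞 K)) (hI : I ≠ ⊥) (hJ : J ≠ ⊥) (h : I * J ≠ ⊥) :
    mkI (I * J) h = mkI I hI * mkI J hJ := by
  apply Units.ext; simp [coe_mkI]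

theorem mkI_pow (I : Ideal (𝓞 K)) (n : ℕ) (hI : I ≠ ⊥) (h : I ^ n ≠ ⊥) :
    mkI (I ^ n) h = mkI I hI ^ n := by
  apply Units.ext; rw [Units.val_pow_eq_pow_val, coe_mkI, coe_mkI, FractionalIdeal.coeIdeal_pow]

theorem mkI_inj {I J : Ideal (𝓞 K)} {hI : I ≠ ⊥} {hJ : J ≠ ⊥} (h : mkI I hI = mkI J hJ) : I = J := by
  have := congrArg Units.val h
  rw [coe_mkI, coe_mkI] at this
  exact FractionalIdeal.coeIdeal_injective this

theorem mkI_span (a : 𝓞 K) (u : Kˣ) (h : (a : K) = u) (h0 : Ideal.span {a} ≠ ⊥) :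
    mkI (Ideal.span {a}) h0 = prin K u := by
  apply Units.ext
  rw [coe_mkI, coe_toPrincipalIdeal, FractionalIdeal.coeIdeal_span_singleton, ← h]

theorem map_ne_bot (f : X →+* K) {I : Ideal (𝓞 X)} (h : I ≠ ⊥) :
    I.map (RingOfIntegers.mapRingHom f) ≠ ⊥ := by
  rw [Ne, Ideal.map_eq_bot_iff_of_injective (mapRingHom_injective f)]
  exact h

theorem extI_mkI (f : X →+* K) (I : Ideal (𝓞 X)) (h : I ≠ ⊥) :
    extI f (mkI I h) = mkI (I.map (RingOfIntegers.mapRingHom f)) (map_ne_bot f h) := by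
  apply Units.ext
  rw [coe_extI, coe_mkI, coe_mkI]
  exact FractionalIdeal.extended_coeIdeal_eq_map K (le_comap_mapRingHom f) I

/-- Every fractional ideal is integral after scaling by a nonzero integer. -/
theorem exists_scale (I : FI K) : ∃ (n : ℕ) (u : Kˣ) (J : Ideal (𝓞 K)) (h : J ≠ ⊥),
    (u : K) = n ∧ prin K u * I = mkI J h := by
  obtain ⟨a, J, ha, hJ⟩ := FractionalIdeal.exists_eq_spanSingleton_mul (I : FractionalIdeal (𝓞 K)⁰ K)
  have hn : Ideal.absNorm (Ideal.span {a}) ≠ 0 := by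
    rw [Ne, Ideal.absNorm_eq_zero_iff, Ideal.span_singleton_eq_bot]; exact ha
  obtain ⟨b, hb⟩ := Ideal.mem_span_singleton'.1 (Ideal.absNorm_mem (Ideal.span {a}))
  set n := Ideal.absNorm (Ideal.span {a})
  have hnK : (n : K) ≠ 0 := by exact_mod_cast hn
  have hJ0 : J ≠ ⊥ := by
    rintro rfl
    simp at hJ
  have hb0 : b ≠ 0 := by
    rintro rfl
    rw [zero_mul] at hb
    exact hn (by exact_mod_cast hb.symm)
  have h0 : Ideal.span {b} * J ≠ ⊥ := mul_ne_zero (by simpa using hb0) hJ0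
  refine ⟨n, Units.mk0 (n : K) hnK, _, h0, rfl, ?_⟩
  apply Units.ext
  rw [Units.val_mul, coe_toPrincipalIdeal, coe_mkI, hJ, ← mul_assoc,
    FractionalIdeal.spanSingleton_mul_spanSingleton, FractionalIdeal.coeIdeal_mul,
    FractionalIdeal.coeIdeal_span_singleton]
  congr 2
  have : (b : K) * (a : K) = n := by
    have := congrArg (algebraMap (𝓞 K) K) hb
    simpa using this
  have ha' : (a : K) ≠ 0 := by simpa using ha
  rw [Units.val_mk0, ← this]
  field_simp

/-- The class of a fractional ideal. -/
noncomputable def cl (K : Type*) [Field K] [NumberField K] : FI K →* ClassGroup (𝓞 K) :=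
  ((ClassGroup.equiv (R := 𝓞 K) K).symm.toMonoidHom).comp (QuotientGroup.mk' (prin K).range)

theorem cl_surjective : Function.Surjective (cl K) := 
  (ClassGroup.equiv (R := 𝓞 K) K).symm.surjective.comp (QuotientGroup.mk'_surjective _)

theorem cl_ker : (cl K).ker = (prin K).range := by
  ext I
  rw [MonoidHom.mem_ker, cl, MonoidHom.comp_apply]
  exact (MulEquiv.map_eq_one_iff (ClassGroup.equiv (R := 𝓞 K) K).symm).trans
    (QuotientGroup.eq_one_iff _)

theorem cl_eq_one_iff {I : FI K} : cl K I = 1 ↔ ∃ x, prin K x = I := by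
  rw [← MonoidHom.mem_ker, cl_ker]; rfl

theorem mem_prin_ker {x : Kˣ} : x ∈ (prin K).ker ↔ IsIntegral ℤ (x : K) ∧ IsIntegral ℤ ((x⁻¹ : Kˣ) : K) := by
  have aux : ∀ x : Kˣ, prin K x = 1 → IsIntegral ℤ (x : K) := fun x hx => by
    rw [← mem_one_iff, ← Units.val_one, ← hx, coe_toPrincipalIdeal]
    exact FractionalIdeal.mem_spanSingleton_self _ _
  have aux2 : ∀ x : Kˣ, IsIntegral ℤ (x : K) → ∀ y ∈ (prin K x : FractionalIdeal (𝓞 K)⁰ K),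
      IsIntegral ℤ y := fun x hx y hy => by
    rw [coe_toPrincipalIdeal, FractionalIdeal.mem_spanSingleton] at hy
    obtain ⟨z, rfl⟩ := hy
    rw [Algebra.smul_def]
    exact z.isIntegral_coe.mul hx
  rw [MonoidHom.mem_ker]
  refine ⟨fun h => ⟨aux x h, aux _ (by rw [map_inv, h, inv_one])⟩, fun h => FI_eq_one (aux2 _ h.1) ?_⟩
  rw [← map_inv]
  exact aux2 _ h.2

end

section
variable {X K M : Type*} [Field X] [NumberField X] [Field K] [NumberField K]
  [Field M] [NumberField M]

theorem mem_extI_inv (f : X →+* K) {I : FI X} {t : K}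
    (h : ∀ c ∈ (I : FractionalIdeal (𝓞 X)⁰ X), IsIntegral ℤ (t * f c)) :
    t ∈ (((extI f I)⁻¹ : FI K) : FractionalIdeal (𝓞 K)⁰ K) := by
  have h1 : FractionalIdeal.spanSingleton (𝓞 K)⁰ t * (extI f I : FI K) ≤ 1 := by
    rw [FractionalIdeal.spanSingleton_mul_le_iff]
    intro z hz
    rw [coe_extI, FractionalIdeal.mem_extended_iff] at hz
    rw [mem_one_iff]
    induction hz using Submodule.span_induction with
    | mem x hx =>
      obtain ⟨c, hc, rfl⟩ := hx
      rw [isLocalization_map_mapRingHom]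
      exact h c hc
    | zero => rw [mul_zero]; exact isIntegral_zero
    | add x y _ _ hx hy => rw [mul_add]; exact hx.add hy
    | smul a x _ hx =>
      rw [Algebra.smul_def, mul_left_comm]
      exact a.isIntegral_coe.mul hx
  have h2 : FractionalIdeal.spanSingleton (𝓞 K)⁰ t ≤ (((extI f I)⁻¹ : FI K) : _) := by
    calc FractionalIdeal.spanSingleton (𝓞 K)⁰ t
        = FractionalIdeal.spanSingleton (𝓞 K)⁰ t * (extI f I : FI K) *
            (((extI f I)⁻¹ : FI K) : _) := by rw [mul_assoc, Units.mul_inv, mul_one]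
      _ ≤ 1 * (((extI f I)⁻¹ : FI K) : _) := mul_le_mul_left h1 _
      _ = _ := one_mul _
  exact h2 (FractionalIdeal.mem_spanSingleton_self _ _)

theorem integral_mul_of_mem {I : FI K} {x y : K} (hx : x ∈ (I : FractionalIdeal (𝓞 K)⁰ K))
    (hy : y ∈ ((I⁻¹ : FI K) : FractionalIdeal (𝓞 K)⁰ K)) : IsIntegral ℤ (x * y) := by
  rw [← mem_one_iff, ← Units.val_one, ← mul_inv_cancel I, Units.val_mul]
  exact FractionalIdeal.mul_mem_mul hx hy

/-- `σ` is an involution of `K` with fixed field the image of `φ`. -/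
structure QuadInv (φ : X →+* K) (σ : K →+* K) : Prop where
  invol : ∀ x, σ (σ x) = x
  fix : ∀ x, σ (φ x) = φ x
  mem : ∀ x, σ x = x → ∃ y, φ y = x
  skew : ∃ θ, σ θ = -θ ∧ θ ≠ 0

variable {φ : X →+* K} {σ : K →+* K}

theorem integral_of_map (f : X →+* K) {x : X} (h : IsIntegral ℤ (f x)) : IsIntegral ℤ x :=
  (isIntegral_algHom_iff f.toIntAlgHom f.injective).1 h

theorem QuadInv.memInt (h : QuadInv φ σ) {x : K} (hx : IsIntegral ℤ x) (hs : σ x = x) :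
    ∃ y : 𝓞 X, φ y = x := by
  obtain ⟨y, hy⟩ := h.mem x hs
  exact ⟨⟨y, integral_of_map φ (hy ▸ hx)⟩, hy⟩

theorem mem_mkI {I : Ideal (𝓞 K)} {hI : I ≠ ⊥} {x : 𝓞 K} :
    (x : K) ∈ (mkI I hI : FractionalIdeal (𝓞 K)⁰ K) ↔ x ∈ I := by
  rw [coe_mkI, FractionalIdeal.mem_coeIdeal]
  constructor
  · rintro ⟨y, hy, hxy⟩
    rwa [← RingOfIntegers.ext hxy]
  · exact fun h => ⟨x, h, rfl⟩

theorem QuadInv.exists_norm_integral (h : QuadInv φ σ) (I : Ideal (𝓞 K)) (hI : I ≠ ⊥) :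
    ∃ C : FI X, extI φ C = mkI I hI * extI σ (mkI I hI) := by
  obtain ⟨a, haI, ha⟩ := Submodule.exists_mem_ne_zero_of_ne_bot hI
  obtain ⟨b, hb⟩ := IsDedekindDomain.exists_eq_span_pair haI ha
  have ha0 : (a : K) ≠ 0 := by simpa using ha
  have hint : ∀ x : 𝓞 K, IsIntegral ℤ (σ x) := fun x => x.isIntegral_coe.map σ.toIntAlgHom
  have ia : IsIntegral ℤ (a : K) := a.isIntegral_coe
  have ib : IsIntegral ℤ (b : K) := b.isIntegral_coe
  obtain ⟨n1, hn1⟩ := h.memInt (ia.mul (hint a))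
    (by rw [map_mul, h.invol, mul_comm])
  obtain ⟨n2, hn2⟩ := h.memInt (ib.mul (hint b))
    (by rw [map_mul, h.invol, mul_comm])
  obtain ⟨T, hT⟩ := h.memInt ((ia.mul (hint b)).add ((hint a).mul ib))
    (by rw [map_add, map_mul, map_mul, h.invol, h.invol]; ring)
  have hn1' : n1 ≠ 0 := by
    rintro rfl
    have : (a : K) * σ a ≠ 0 := mul_ne_zero ha0 ((map_ne_zero σ).2 ha0)
    exact this (by rw [← hn1]; simp)
  set c : Ideal (𝓞 X) := Ideal.span {n1, n2, T} with hc
  have hc0 : c ≠ ⊥ := fun h0 => hn1' <| by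
    rw [← Ideal.mem_bot, ← h0]; exact Ideal.subset_span (by simp)
  refine ⟨mkI c hc0, ?_⟩
  rw [extI_mkI, extI_mkI, ← mkI_mul _ _ _ _ (mul_ne_zero hI (map_ne_bot σ hI))]
  congr 1
  rw [hb, hc, Ideal.map_span, Ideal.map_span]
  set sg := RingOfIntegers.mapRingHom σ with hsg
  set ph := RingOfIntegers.mapRingHom φ with hph
  have e1 : ph n1 = a * sg a := RingOfIntegers.ext hn1
  have e2 : ph n2 = b * sg b := RingOfIntegers.ext hn2
  have e3 : ph T = a * sg b + sg a * b := RingOfIntegers.ext hT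
  have key : a * sg b ∈ c.map ph := by
    rw [← mem_mkI (hI := map_ne_bot φ hc0), ← extI_mkI φ c hc0, ← inv_inv (mkI c hc0), map_inv]
    apply mem_extI_inv
    intro x hx
    have i1 := integral_mul_of_mem (mem_mkI.2 (show n1 ∈ c from Ideal.subset_span (by simp))) hx
    have i2 := integral_mul_of_mem (mem_mkI.2 (show n2 ∈ c from Ideal.subset_span (by simp))) hx
    have i3 := integral_mul_of_mem (mem_mkI.2 (show T ∈ c from Ideal.subset_span (by simp))) hx
    set A1 : 𝓞 K := ph ⟨_, i1⟩ with hA1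
    set A2 : 𝓞 K := ph ⟨_, i2⟩ with hA2
    set A3 : 𝓞 K := ph ⟨_, i3⟩ with hA3
    have j1 : (A1 : K) = a * σ a * φ x := by
      rw [← hn1]; exact map_mul φ _ _
    have j2 : (A2 : K) = b * σ b * φ x := by
      rw [← hn2]; exact map_mul φ _ _
    have j3 : (A3 : K) = (a * σ b + σ a * b) * φ x := by
      rw [← hT]; exact map_mul φ _ _
    have hmon : (Polynomial.X ^ 2 + (- Polynomial.C A3 * Polynomial.X +
        Polynomial.C (A1 * A2))).Monic := by
      apply Polynomial.monic_X_pow_add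
      compute_degree!
    have hI' : IsIntegral (𝓞 K) (((a * sg b : 𝓞 K) : K) * φ x) := by
      refine ⟨_, hmon, ?_⟩
      simp only [Polynomial.eval₂_add, Polynomial.eval₂_pow, Polynomial.eval₂_X,
        Polynomial.eval₂_mul, Polynomial.eval₂_neg, Polynomial.eval₂_C, map_mul]
      rw [show algebraMap (𝓞 K) K A1 = _ from j1, show algebraMap (𝓞 K) K A2 = _ from j2,
        show algebraMap (𝓞 K) K A3 = _ from j3, show algebraMap (𝓞 K) K (sg b) = σ b from rfl]
      ring
    exact isIntegral_trans _ hI'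
  have key2 : sg a * b ∈ c.map ph := by
    have : sg a * b = ph T - a * sg b := by rw [e3]; ring
    rw [this]
    exact sub_mem (Ideal.mem_map_of_mem ph (Ideal.subset_span (by simp))) key
  rw [hc, Ideal.map_span] at key key2
  apply le_antisymm
  · rw [Ideal.span_le]
    have m1 : a ∈ Ideal.span {a, b} := Ideal.subset_span (by simp)
    have m2 : b ∈ Ideal.span {a, b} := Ideal.subset_span (by simp)
    have m3 : sg a ∈ Ideal.span (sg '' {a, b}) := Ideal.subset_span ⟨a, by simp, rfl⟩
    have m4 : sg b ∈ Ideal.span (sg '' {a, b}) := Ideal.subset_span ⟨b, by simp, rfl⟩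
    rintro _ ⟨y, hy, rfl⟩
    simp only [Set.mem_insert_iff, Set.mem_singleton_iff] at hy
    rcases hy with rfl | rfl | rfl
    · rw [e1]; exact Ideal.mul_mem_mul m1 m3
    · rw [e2]; exact Ideal.mul_mem_mul m2 m4
    · rw [e3, mul_comm (sg a)]
      exact add_mem (Ideal.mul_mem_mul m1 m4) (Ideal.mul_mem_mul m2 m3)
  · rw [Ideal.span_mul_span', Ideal.span_le]
    rintro _ ⟨y, hy, z, ⟨w, hw, rfl⟩, rfl⟩
    simp only [Set.mem_insert_iff, Set.mem_singleton_iff] at hy hw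
    rcases hy with rfl | rfl <;> rcases hw with rfl | rfl
    · exact Ideal.subset_span ⟨n1, by simp, e1⟩
    · exact key
    · change y * sg w ∈ _
      rw [mul_comm]
      exact key2
    · exact Ideal.subset_span ⟨n2, by simp, e2⟩

theorem QuadInv.exists_norm (h : QuadInv φ σ) (I : FI K) :
    ∃ C : FI X, extI φ C = I * extI σ I := by
  obtain ⟨n, u, J, hJ, hu, e⟩ := exists_scale I
  obtain ⟨C, hC⟩ := h.exists_norm_integral J hJ
  have hn : (n : X) ≠ 0 := by
    have := u.ne_zero
    rw [hu] at this
    exact_mod_cast this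
  set v : Xˣ := Units.mk0 (n : X) hn
  have hv : Units.map φ.toMonoidHom v = u := Units.ext (by simp [v, hu])
  have hs : Units.map σ.toMonoidHom u = u := Units.ext (by simp [hu])
  refine ⟨(prin X (v * v))⁻¹ * C, ?_⟩
  rw [map_mul (extI φ), map_inv (extI φ), extI_prin, map_mul (Units.map _), hv, hC, ← e,
    map_mul (extI σ), extI_prin, hs, map_mul (prin K)]
  rw [inv_mul_eq_iff_eq_mul]
  ac_rfl

/-- The relative norm of fractional ideals. -/
noncomputable def nmI (h : QuadInv φ σ) : FI K →* FI X where
  toFun I := (h.exists_norm I).choose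
  map_one' := extI_injective φ <| by rw [(h.exists_norm 1).choose_spec]; simp
  map_mul' I J := extI_injective φ <| by
    rw [(h.exists_norm _).choose_spec, map_mul, map_mul, (h.exists_norm I).choose_spec,
      (h.exists_norm J).choose_spec]
    ac_rfl

theorem extI_nmI (h : QuadInv φ σ) (I : FI K) : extI φ (nmI h I) = I * extI σ I :=
  (h.exists_norm I).choose_spec

theorem QuadInv.comp (h : QuadInv φ σ) : σ.comp φ = φ := RingHom.ext h.fix

theorem extI_fix (h : QuadInv φ σ) (I : FI X) : extI σ (extI φ I) = extI φ I := by
  rw [extI_comp, h.comp]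

theorem extI_invol (h : QuadInv φ σ) (I : FI K) : extI σ (extI σ I) = I := by
  rw [extI_comp, show σ.comp σ = RingHom.id K from RingHom.ext h.invol, extI_id]

theorem nmI_extI (h : QuadInv φ σ) (I : FI X) : nmI h (extI φ I) = I ^ 2 :=
  extI_injective φ <| by rw [extI_nmI, extI_fix h, map_pow, sq]

theorem nmI_prin (h : QuadInv φ σ) (x : Kˣ) : ∃ y : Xˣ, φ y = x * σ x ∧ nmI h (prin K x) = prin X y := by
  obtain ⟨y, hy⟩ := h.mem (x * σ x) (by rw [map_mul, h.invol, mul_comm])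
  have hy0 : y ≠ 0 := by
    rintro rfl
    rw [map_zero] at hy
    exact mul_ne_zero x.ne_zero ((map_ne_zero σ).2 x.ne_zero) hy.symm
  refine ⟨Units.mk0 y hy0, hy, extI_injective φ ?_⟩
  rw [extI_nmI, extI_prin, extI_prin, ← map_mul]
  congr 1
  exact Units.ext hy.symm

/-- The action of an endomorphism on units. -/
abbrev um (f : X →+* K) : Xˣ →* Kˣ := Units.map f.toMonoidHom

theorem QuadInv.hilbert90 (h : QuadInv φ σ) (x : Kˣ) (hx : x * um σ x = 1) :
    ∃ y, x = y / um σ y := by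
  have hx' : (x : K) * σ x = 1 := congrArg Units.val hx
  by_cases h1 : (1 : K) + x = 0
  · obtain ⟨θ, h2, h3⟩ := h.skew
    refine ⟨Units.mk0 θ h3, ?_⟩
    rw [eq_div_iff_mul_eq']
    apply Units.ext
    change (x : K) * σ θ = θ
    rw [h2, eq_neg_of_add_eq_zero_right h1]; ring
  · refine ⟨Units.mk0 _ h1, ?_⟩
    rw [eq_div_iff_mul_eq']
    apply Units.ext
    change (x : K) * σ (1 + x) = 1 + x
    rw [map_add, map_one, mul_add, hx']; ring

end

section
variable {X K : Type*} [Field X] [NumberField X] [Field K] [NumberField K]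
  {φ : X →+* K} {σ : K →+* K}

theorem um_injective (f : X →+* K) : Function.Injective (um f) :=
  Units.map_injective f.injective

/-- Units of the ring of integers as units of the field. -/
noncomputable def unitsHom (K : Type*) [Field K] : (𝓞 K)ˣ →* Kˣ :=
  Units.map (algebraMap (𝓞 K) K).toMonoidHom

theorem unitsHom_injective : Function.Injective (unitsHom K) :=
  Units.map_injective (RingOfIntegers.coe_injective)

theorem unitsHom_range : (unitsHom K).range = (prin K).ker := by
  ext x
  rw [mem_prin_ker]
  constructor
  · rintro ⟨u, rfl⟩
    refine ⟨(u : 𝓞 K).isIntegral_coe, ?_⟩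
    rw [← map_inv]
    exact ((u⁻¹ : (𝓞 K)ˣ) : 𝓞 K).isIntegral_coe
  · rintro ⟨h1, h2⟩
    refine ⟨⟨⟨x, h1⟩, ⟨_, h2⟩, ?_, ?_⟩, ?_⟩
    · exact RingOfIntegers.ext (x.mul_inv)
    · exact RingOfIntegers.ext (x.inv_mul)
    · exact Units.ext rfl

theorem rk_range {G H : Type*} [CommGroup G] [CommGroup H] (f : G →* H)
    (hf : Function.Injective f) : rk f.range = rk G :=
  (rk_congr (MonoidHom.ofInjective hf)).symm

instance fg_prin_ker : Group.FG (prin K).ker := by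
  rw [← unitsHom_range]
  have : Group.FG (𝓞 K)ˣ := Group.fg_iff_monoid_fg.2 inferInstance
  exact Group.fg_range _

theorem rk_prin_ker : rk (prin K).ker = Units.rank K := by
  rw [← unitsHom_range, rk_range _ unitsHom_injective]
  exact Units.finrank_eq K

theorem mem_fixed_units (h : QuadInv φ σ) {x : Kˣ} :
    x ∈ (df (um σ)).ker ⊓ (prin K).ker ↔ ∃ y ∈ (prin X).ker, um φ y = x := by
  rw [Subgroup.mem_inf, mem_ker_df]
  constructor
  · rintro ⟨h1, h2⟩
    obtain ⟨y, hy⟩ := h.mem x (congrArg Units.val h1)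
    have hy0 : y ≠ 0 := by
      rintro rfl
      rw [map_zero] at hy
      exact x.ne_zero hy.symm
    have e : um φ (Units.mk0 y hy0) = x := Units.ext hy
    refine ⟨_, ?_, e⟩
    rw [MonoidHom.mem_ker, ← (injective_iff_map_eq_one' (extI φ)).1 (extI_injective φ), extI_prin, e]
    exact h2
  · rintro ⟨y, hy, rfl⟩
    refine ⟨Units.ext (h.fix _), ?_⟩
    rw [MonoidHom.mem_ker, ← extI_prin, MonoidHom.mem_ker.1 hy, map_one]

theorem rk_fixed (h : QuadInv φ σ) :
    rk ((df (um σ)).ker ⊓ (prin K).ker : Subgroup Kˣ) = Units.rank X := by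
  have : (df (um σ)).ker ⊓ (prin K).ker = ((um φ).comp (unitsHom X)).range := by
    ext x
    rw [mem_fixed_units h, MonoidHom.range_comp, unitsHom_range]
    rfl
  rw [this, rk_range ((um φ).comp (unitsHom X)) (fun a b e => unitsHom_injective (um_injective φ e))]
  exact Units.finrank_eq X

theorem pow_card_class (I : FI X) : ∃ x, prin X x = I ^ Nat.card (ClassGroup (𝓞 X)) := by
  rw [← cl_eq_one_iff, map_pow, pow_card_eq_one']

theorem ambiguous_field (h : QuadInv φ σ) (hodd : Odd (Nat.card (ClassGroup (𝓞 X)))) {t : ℕ}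
    (ht : (extI φ).range.relIndex (df (extI σ)).ker ∣ 2 ^ t) :
    ((prin K).ker.map (nm (um σ))).relIndex ((df (um σ)).ker ⊓ (prin K).ker) ≠ 0 ∧
    ((prin K).ker.map (nm (um σ))).relIndex ((df (um σ)).ker ⊓ (prin K).ker) *
      2 ^ Units.rank K ∣ 2 ^ (t + 2 * Units.rank X) ∧
    Nat.card (powMonoidHom (α := ClassGroup (𝓞 K)) 2).ker *
      ((df (um σ)).ker ⊓ (prin K).ker ⊓ (nm (um σ)).range).relIndex
        ((df (um σ)).ker ⊓ (prin K).ker) * 2 ^ Units.rank K ∣ 2 ^ (t + 2 * Units.rank X) := by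
  have := ambiguous_bound (d := prin K) (s := um σ) (S := extI σ) (J := (extI φ).range)
    (fun x => Units.ext (h.invol x)) (extI_invol h) (fun x => (extI_prin σ x).symm)
    h.hilbert90 (fun a => ⟨_, extI_nmI h a⟩)
    ⟨_, hodd, by
      rintro _ ⟨b, rfl⟩
      obtain ⟨x, hx⟩ := pow_card_class b
      refine ⟨um φ x, ?_, ?_⟩
      · rw [SetLike.mem_coe, mem_ker_df]; exact Units.ext (h.fix _)
      · rw [← extI_prin, hx, map_pow]⟩ ht
  rw [card_ker_pow_two_of_surjective (cl K) cl_surjective, cl_ker]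
  rwa [rk_fixed h, rk_prin_ker] at this

theorem unit_norm_of_rank (h : QuadInv φ σ) (hodd : Odd (Nat.card (ClassGroup (𝓞 X)))) {t : ℕ}
    (ht : (extI φ).range.relIndex (df (extI σ)).ker ∣ 2 ^ t)
    (hr : t + 2 * Units.rank X = Units.rank K) {u : Xˣ} (hu : u ∈ (prin X).ker) :
    ∃ y ∈ (prin K).ker, (y : K) * σ y = φ u := by
  obtain ⟨h1, h2, -⟩ := ambiguous_field h hodd ht
  rw [hr] at h2
  have h3 : ((prin K).ker.map (nm (um σ))).relIndex ((df (um σ)).ker ⊓ (prin K).ker) = 1 :=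
    Nat.dvd_one.1 (Nat.dvd_of_mul_dvd_mul_right (k := 2 ^ Units.rank K) (by positivity)
      (by rwa [one_mul]))
  obtain ⟨y, hy, e⟩ := Subgroup.relIndex_eq_one.1 h3 ((mem_fixed_units h).2 ⟨u, hu, rfl⟩)
  exact ⟨y, hy, congrArg Units.val e⟩

theorem card_two_torsion_dvd (h : QuadInv φ σ) (hodd : Odd (Nat.card (ClassGroup (𝓞 X)))) {t : ℕ}
    (ht : (extI φ).range.relIndex (df (extI σ)).ker ∣ 2 ^ t) :
    Nat.card (powMonoidHom (α := ClassGroup (𝓞 K)) 2).ker * 2 ^ Units.rank K ∣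
      2 ^ (t + 2 * Units.rank X) := by
  obtain ⟨-, -, h3⟩ := ambiguous_field h hodd ht
  rw [mul_right_comm] at h3
  exact dvd_of_mul_right_dvd h3

/-- An element of the base field which is a norm. -/
def IsNm (φ : X →+* K) (σ : K →+* K) (u : X) : Prop := ∃ z : K, z * σ z = φ u

theorem um_mem_range_nm (h : QuadInv φ σ) {u : Xˣ} (hu : u ∈ (prin X).ker) :
    um φ u ∈ (df (um σ)).ker ⊓ (prin K).ker ⊓ (nm (um σ)).range ↔ IsNm φ σ u := by
  rw [Subgroup.mem_inf, and_iff_right ((mem_fixed_units h).2 ⟨u, hu, rfl⟩)]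
  constructor
  · rintro ⟨z, hz⟩
    exact ⟨z, congrArg Units.val hz⟩
  · rintro ⟨z, hz⟩
    have hz0 : z ≠ 0 := by
      rintro rfl
      rw [zero_mul] at hz
      exact (map_ne_zero φ).2 u.ne_zero hz.symm
    exact ⟨Units.mk0 z hz0, Units.ext hz⟩

theorem card_two_torsion_of_two (h : QuadInv φ σ) (hodd : Odd (Nat.card (ClassGroup (𝓞 X)))) {t : ℕ}
    (ht : (extI φ).range.relIndex (df (extI σ)).ker ∣ 2 ^ t)
    {u : Xˣ} (hu : u ∈ (prin X).ker) (hn : ¬ IsNm φ σ u) :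
    Nat.card (powMonoidHom (α := ClassGroup (𝓞 K)) 2).ker * 2 * 2 ^ Units.rank K ≤
      2 ^ (t + 2 * Units.rank X) := by
  obtain ⟨-, -, h3⟩ := ambiguous_field h hodd ht
  have h0 : ((df (um σ)).ker ⊓ (prin K).ker ⊓ (nm (um σ)).range).relIndex
        ((df (um σ)).ker ⊓ (prin K).ker) ≠ 0 := by
    intro h0
    rw [h0, mul_zero, zero_mul, zero_dvd_iff] at h3
    exact absurd h3 (by positivity)
  refine le_trans ?_ (Nat.le_of_dvd (by positivity) h3)
  gcongr
  exact two_le_relIndex _ _ h0 ((mem_fixed_units h).2 ⟨u, hu, rfl⟩) (by rwa [um_mem_range_nm h hu])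

theorem card_two_torsion_of_four (h : QuadInv φ σ) (hodd : Odd (Nat.card (ClassGroup (𝓞 X)))) {t : ℕ}
    (ht : (extI φ).range.relIndex (df (extI σ)).ker ∣ 2 ^ t)
    {u v : Xˣ} (hu : u ∈ (prin X).ker) (hv : v ∈ (prin X).ker)
    (hnu : ¬ IsNm φ σ u) (hnv : ¬ IsNm φ σ v) (hnuv : ¬ IsNm φ σ (u * v)) :
    Nat.card (powMonoidHom (α := ClassGroup (𝓞 K)) 2).ker * 4 * 2 ^ Units.rank K ≤
      2 ^ (t + 2 * Units.rank X) := by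
  obtain ⟨-, -, h3⟩ := ambiguous_field h hodd ht
  have h0 : ((df (um σ)).ker ⊓ (prin K).ker ⊓ (nm (um σ)).range).relIndex
        ((df (um σ)).ker ⊓ (prin K).ker) ≠ 0 := by
    intro h0
    rw [h0, mul_zero, zero_mul, zero_dvd_iff] at h3
    exact absurd h3 (by positivity)
  refine le_trans ?_ (Nat.le_of_dvd (by positivity) h3)
  gcongr
  refine four_le_relIndex _ _ h0 (a := um φ u) (b := um φ v) ((mem_fixed_units h).2 ⟨u, hu, rfl⟩)
    ((mem_fixed_units h).2 ⟨v, hv, rfl⟩) (by rwa [um_mem_range_nm h hu])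
    (by rwa [um_mem_range_nm h hv]) ?_ ?_
  · rw [← map_mul, um_mem_range_nm h (mul_mem hu hv)]
    exact hnuv
  · rw [← map_pow, um_mem_range_nm h (pow_mem hu 2)]
    exact ⟨φ u, by rw [h.fix]; simp [sq]⟩

theorem odd_class_of_card_le (hc : Nat.card (powMonoidHom (α := ClassGroup (𝓞 K)) 2).ker ≤ 1) :
    Odd (Nat.card (ClassGroup (𝓞 K))) := by
  apply odd_card_of_sq_injective
  intro x hx
  have : Subsingleton (powMonoidHom (α := ClassGroup (𝓞 K)) 2).ker :=
    Finite.card_le_one_iff_subsingleton.1 hc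
  exact congrArg Subtype.val 
    (Subsingleton.elim (⟨x, MonoidHom.mem_ker.2 hx⟩ : (powMonoidHom (α := ClassGroup (𝓞 K)) 2).ker) 1)

end

section
variable {X K : Type*} [Field X] [NumberField X] [Field K] [NumberField K]
  {φ : X →+* K} {σ : K →+* K}

theorem QuadInv.map_invol (h : QuadInv φ σ) (x : 𝓞 K) :
    RingOfIntegers.mapRingHom σ (RingOfIntegers.mapRingHom σ x) = x :=
  RingOfIntegers.ext (h.invol x)

theorem QuadInv.mem_map_iff (h : QuadInv φ σ) (I : Ideal (𝓞 K)) (x : 𝓞 K) :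
    x ∈ I.map (RingOfIntegers.mapRingHom σ) ↔ RingOfIntegers.mapRingHom σ x ∈ I := by
  rw [Ideal.mem_map_iff_of_surjective _ (fun y => ⟨_, h.map_invol y⟩)]
  constructor
  · rintro ⟨y, hy, rfl⟩
    rwa [h.map_invol]
  · exact fun hx => ⟨_, hx, h.map_invol x⟩

theorem QuadInv.map_isPrime (h : QuadInv φ σ) (P : Ideal (𝓞 K)) [P.IsPrime] :
    (P.map (RingOfIntegers.mapRingHom σ)).IsPrime := by
  have : P.map (RingOfIntegers.mapRingHom σ) = P.comap (RingOfIntegers.mapRingHom σ) :=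
    Ideal.ext (h.mem_map_iff P)
  rw [this]
  infer_instance

/-- An invariant prime with nontrivial-on-residues complement comes from the base field. -/
theorem unramified_mem (h : QuadInv φ σ) (P : Ideal (𝓞 K)) [hP : P.IsPrime] (h0 : P ≠ ⊥)
    (hs : P.map (RingOfIntegers.mapRingHom σ) = P)
    {α : 𝓞 K} (hα : RingOfIntegers.mapRingHom σ α - α ∉ P) : mkI P h0 ∈ (extI φ).range := by
  set sg := RingOfIntegers.mapRingHom σ with hsg
  set ph := RingOfIntegers.mapRingHom φ with hph
  set D := P.comap ph with hD
  have hsP : ∀ x ∈ P, sg x ∈ P := fun x hx => (h.mem_map_iff P x).1 (hs.symm ▸ hx)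
  have lift : ∀ x ∈ P, sg x = x → x ∈ D.map ph := fun x hx hsx => by
    obtain ⟨y, hy⟩ := h.memInt x.isIntegral_coe (congrArg (algebraMap (𝓞 K) K) hsx)
    have hy' : ph y = x := RingOfIntegers.ext hy
    rw [← hy']
    exact Ideal.mem_map_of_mem ph (show ph y ∈ P from hy'.symm ▸ hx)
  have htr : ∀ x ∈ P, x + sg x ∈ D.map ph := fun x hx =>
    lift _ (add_mem hx (hsP x hx)) (by rw [map_add, h.map_invol, add_comm])
  have h1 : ∀ x ∈ P, (sg α - α) * x ∈ D.map ph := fun x hx => by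
    have e : (sg α - α) * x = sg α * (x + sg x) - (α * x + sg (α * x)) := by
      rw [map_mul]; ring
    rw [e]
    exact sub_mem (Ideal.mul_mem_left _ _ (htr x hx)) (htr _ (Ideal.mul_mem_left _ _ hx))
  have h2 : ∀ x ∈ P, x ^ 2 ∈ D.map ph := fun x hx => by
    have e : x ^ 2 = x * (x + sg x) - x * sg x := by ring
    rw [e]
    exact sub_mem (Ideal.mul_mem_left _ _ (htr x hx))
      (lift _ (Ideal.mul_mem_right _ _ hx) (by rw [map_mul, h.map_invol, mul_comm]))
  have hmax : P.IsMaximal := hP.isMaximal h0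
  obtain ⟨v, hv⟩ := hmax.exists_inv hα
  obtain ⟨π, hπ, hv⟩ := hv
  have hDP : D.map ph = P := by
    apply le_antisymm Ideal.map_comap_le
    intro x hx
    have e : x = π ^ 2 * x + (v * (1 + π)) * ((sg α - α) * x) := by
      have : v * (sg α - α) = 1 - π := by rw [← hv]; ring
      linear_combination (-(1 + π) * x) * this
    rw [e]
    exact add_mem (Ideal.mul_mem_right _ _ (h2 π hπ)) (Ideal.mul_mem_left _ _ (h1 x hx))
  have hD0 : D ≠ ⊥ := by
    intro hb
    rw [hb, Ideal.map_bot] at hDP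
    exact h0 hDP.symm
  refine ⟨mkI D hD0, ?_⟩
  rw [extI_mkI]
  congr 1

theorem invariant_le (h : QuadInv φ σ) (W : Subgroup (FI K)) (hW : (extI φ).range ≤ W)
    (hP : ∀ (P : Ideal (𝓞 K)) (h0 : P ≠ ⊥), P.IsPrime →
      P.map (RingOfIntegers.mapRingHom σ) = P → mkI P h0 ∈ W) :
    (df (extI σ)).ker ≤ W := by
  have key : ∀ (n : ℕ) (J : Ideal (𝓞 K)) (hJ : J ≠ ⊥), Ideal.absNorm J = n →
      extI σ (mkI J hJ) = mkI J hJ → mkI J hJ ∈ W := by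
    intro n
    induction n using Nat.strong_induction_on with
    | _ n ih =>
    intro J hJ hn hinv
    by_cases htop : J = ⊤
    · have : mkI J hJ = 1 := Units.ext (by rw [coe_mkI, htop]; simp)
      rw [this]; exact one_mem W
    obtain ⟨P, hPm, hJP⟩ := Ideal.exists_le_maximal J htop
    have hPp : P.IsPrime := hPm.isPrime
    obtain ⟨J', rfl⟩ := Ideal.dvd_iff_le.2 hJP
    have hP0 : P ≠ ⊥ := fun e => hJ (by rw [e, Ideal.bot_mul])
    have hJ'0 : J' ≠ ⊥ := fun e => hJ (by rw [e, Ideal.mul_bot])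
    have norm_lt : ∀ Q A : Ideal (𝓞 K), Q.IsPrime → A ≠ ⊥ → Q ≠ ⊥ →
        Ideal.absNorm A < Ideal.absNorm (Q * A) := fun Q A hQ hA hQ0 => by
      rw [map_mul]
      have h1 : Ideal.absNorm Q ≠ 1 := fun e => hQ.ne_top (Ideal.absNorm_eq_one_iff.1 e)
      have h2 : Ideal.absNorm Q ≠ 0 := fun e => hQ0 (Ideal.absNorm_eq_zero_iff.1 e)
      have h3 : Ideal.absNorm A ≠ 0 := fun e => hA (Ideal.absNorm_eq_zero_iff.1 e)
      have : 2 ≤ Ideal.absNorm Q := by omega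
      nlinarith [Nat.pos_of_ne_zero h3]
    rw [mkI_mul P J' hP0 hJ'0] at hinv ⊢
    by_cases hsP : P.map (RingOfIntegers.mapRingHom σ) = P
    · have hPe : extI σ (mkI P hP0) = mkI P hP0 := by rw [extI_mkI]; congr 1
      refine mul_mem (hP P hP0 hPp hsP) (ih _ ?_ J' hJ'0 rfl ?_)
      · rw [← hn]; exact norm_lt P J' hPp hJ'0 hP0
      · rw [map_mul, hPe] at hinv
        exact mul_left_cancel hinv
    · have hQp := h.map_isPrime P
      set Q := P.map (RingOfIntegers.mapRingHom σ) with hQ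
      have hQ0 : Q ≠ ⊥ := map_ne_bot σ hP0
      have hQe : extI σ (mkI P hP0) = mkI Q hQ0 := extI_mkI σ P hP0
      have hdvd : Q ∣ P * J' := by
        rw [← mkI_mul P J' hP0 hJ'0 hJ, extI_mkI] at hinv
        have := mkI_inj hinv
        rw [← this, Ideal.map_mul]
        exact dvd_mul_right _ _
      have hQprime : Prime Q := Ideal.prime_of_isPrime hQ0 hQp
      rcases hQprime.dvd_or_dvd hdvd with hd | hd
      · exact absurd (hPm.eq_of_le hQp.ne_top (Ideal.dvd_iff_le.1 hd)).symm hsP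
      obtain ⟨A, rfl⟩ := hd
      have hA0 : A ≠ ⊥ := fun e => hJ'0 (by rw [e, Ideal.mul_bot])
      rw [mkI_mul Q A hQ0 hA0] at hinv ⊢
      rw [← mul_assoc]
      refine mul_mem (hW ⟨nmI h (mkI P hP0), ?_⟩) (ih _ ?_ A hA0 rfl ?_)
      · rw [extI_nmI, hQe]
      · rw [← hn]
        exact (norm_lt Q A hQp hA0 hQ0).trans (norm_lt P _ hPp hJ'0 hP0)
      · rw [map_mul, map_mul, hQe] at hinv
        have e2 : extI σ (mkI Q hQ0) = mkI P hP0 := by rw [← hQe, extI_invol h]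
        rw [e2, mul_left_comm] at hinv
        exact mul_left_cancel (mul_left_cancel hinv)
  intro I hI
  rw [mem_ker_df] at hI
  obtain ⟨n, u, J, hJ, hu, e⟩ := exists_scale I
  have hn : (n : X) ≠ 0 := by
    have := u.ne_zero
    rw [hu] at this
    exact_mod_cast this
  have hv : um φ (Units.mk0 (n : X) hn) = u := Units.ext (by simp [hu])
  have hs : um σ u = u := Units.ext (by simp [hu])
  have h1 := key _ J hJ rfl (by rw [← e, map_mul, hI, extI_prin, hs])
  rw [← e] at h1
  refine (Subgroup.mul_mem_cancel_left W (hW ⟨prin X (Units.mk0 (n : X) hn), ?_⟩)).1 h1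
  rw [extI_prin, hv]

theorem relIndex_sup_zpowers_dvd {G : Type*} [CommGroup G] (H : Subgroup G) {g : G}
    (hg : g ^ 2 ∈ H) : H.relIndex (H ⊔ Subgroup.zpowers g) ∣ 2 := by
  rw [Subgroup.relIndex_sup_left, Subgroup.relIndex, Subgroup.index]
  set z : Subgroup.zpowers g := ⟨g, Subgroup.mem_zpowers g⟩
  set q := QuotientGroup.mk' (H.subgroupOf (Subgroup.zpowers g)) z
  have h1 : orderOf q = Nat.card (Subgroup.zpowers g ⧸ H.subgroupOf (Subgroup.zpowers g)) := by
    apply orderOf_eq_card_of_forall_mem_zpowers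
    intro x
    obtain ⟨⟨y, n, rfl⟩, rfl⟩ := QuotientGroup.mk'_surjective _ x
    exact ⟨n, rfl⟩
  rw [← h1]
  apply orderOf_dvd_of_pow_eq_one
  exact (QuotientGroup.eq_one_iff (z ^ 2)).2 hg

theorem relIndex_sup_closure_dvd {G : Type*} [CommGroup G] (J : Subgroup G) (T : Finset G)
    (hT : ∀ g ∈ T, g ^ 2 ∈ J) : J.relIndex (J ⊔ Subgroup.closure (T : Set G)) ∣ 2 ^ T.card := by
  classical
  induction T using Finset.induction_on with
  | empty => simp
  | insert g T hg ih =>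
    rw [Finset.coe_insert, Set.insert_eq, Subgroup.closure_union, sup_comm (Subgroup.closure {g}),
      ← sup_assoc, ← Subgroup.zpowers_eq_closure, Finset.card_insert_of_notMem hg, pow_succ,
      ← Subgroup.relIndex_mul_relIndex J (J ⊔ Subgroup.closure (T : Set G)) _ le_sup_left le_sup_left]
    exact mul_dvd_mul (ih fun x hx => hT x (Finset.mem_insert_of_mem hx))
      (relIndex_sup_zpowers_dvd _ ((le_sup_left : J ≤ _) (hT g (Finset.mem_insert_self _ _))))

theorem index_dvd_two_pow (h : QuadInv φ σ) (S : Finset (Ideal (𝓞 K)))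
    (hS : ∀ P : Ideal (𝓞 K), P ≠ ⊥ → P.IsPrime →
      (∀ α, RingOfIntegers.mapRingHom σ α - α ∈ P) → P ∈ S) {t : ℕ} (ht : S.card ≤ t) :
    (extI φ).range.relIndex (df (extI σ)).ker ∣ 2 ^ t := by
  classical
  set T : Finset (FI K) := S.image fun P => if h : P ≠ ⊥ ∧ P.map (RingOfIntegers.mapRingHom σ) = P
    then mkI P h.1 else 1 with hT
  have h1 : (df (extI σ)).ker ≤ (extI φ).range ⊔ Subgroup.closure (T : Set (FI K)) := by
    apply invariant_le h _ le_sup_left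
    intro P h0 hPp hPs
    by_cases hα : ∀ α, RingOfIntegers.mapRingHom σ α - α ∈ P
    · apply (le_sup_right : Subgroup.closure (T : Set (FI K)) ≤ _)
      apply Subgroup.subset_closure
      rw [hT, Finset.coe_image]
      exact ⟨P, hS P h0 hPp hα, dif_pos ⟨h0, hPs⟩⟩
    · push Not at hα
      obtain ⟨α, hα⟩ := hα
      exact (le_sup_left : (extI φ).range ≤ _) (unramified_mem h P h0 hPs hα)
  refine (relIndex_dvd_of_le_right' _ h1).trans ((relIndex_sup_closure_dvd _ T ?_).trans
    (pow_dvd_pow 2 (Finset.card_image_le.trans ht)))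
  intro g hg
  rw [hT, Finset.mem_image] at hg
  obtain ⟨P, -, rfl⟩ := hg
  split_ifs with hP
  · refine ⟨nmI h (mkI P hP.1), ?_⟩
    have : extI σ (mkI P hP.1) = mkI P hP.1 := by rw [extI_mkI]; congr 1; exact hP.2
    rw [extI_nmI, this, sq]
  · rw [one_pow]; exact one_mem _

end

section
variable {K : Type*} [Field K] [NumberField K]

theorem intCast_mem_iff {P : Ideal (𝓞 K)} [hP : P.IsPrime] {l : ℕ} [hl : Fact l.Prime]
    (h : (l : 𝓞 K) ∈ P) (n : ℤ) : (n : 𝓞 K) ∈ P ↔ (l : ℤ) ∣ n := by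
  constructor
  · intro hn
    by_contra hd
    have hc : IsCoprime (l : ℤ) n :=
      (Nat.prime_iff_prime_int.1 hl.out).irreducible.coprime_iff_not_dvd.2 hd
    obtain ⟨a, b, e⟩ := hc
    apply hP.ne_top
    rw [Ideal.eq_top_iff_one]
    have : (1 : 𝓞 K) = a * l + b * n := by exact_mod_cast e.symm
    rw [this]
    exact add_mem (Ideal.mul_mem_left _ _ h) (Ideal.mul_mem_left _ _ hn)
  · rintro ⟨m, rfl⟩
    push_cast
    exact Ideal.mul_mem_right _ _ h

theorem span_natCast_ne_bot {n : ℕ} (hn : n ≠ 0) : Ideal.span {(n : 𝓞 K)} ≠ ⊥ := by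
  rw [Ne, Ideal.span_singleton_eq_bot]
  exact_mod_cast hn

variable (K) in
/-- The primes of `K` above `l`. -/
noncomputable def primesAbove (l : ℕ) : Finset (Ideal (𝓞 K)) :=
  open Classical in (UniqueFactorizationMonoid.normalizedFactors (Ideal.span {(l : 𝓞 K)})).toFinset

theorem mem_primesAbove {l : ℕ} (hl : l ≠ 0) {P : Ideal (𝓞 K)} :
    P ∈ primesAbove K l ↔ P.IsPrime ∧ (l : 𝓞 K) ∈ P := by
  classical
  rw [primesAbove, Multiset.mem_toFinset,
    UniqueFactorizationMonoid.mem_normalizedFactors_iff (span_natCast_ne_bot hl), 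
    Ideal.dvd_span_singleton]
  constructor
  · exact fun h => ⟨Ideal.isPrime_of_prime h.1, h.2⟩
  · rintro ⟨h1, h2⟩
    refine ⟨Ideal.prime_of_isPrime ?_ h1, h2⟩
    rintro rfl
    rw [Ideal.mem_bot] at h2
    exact hl (by exact_mod_cast h2)

theorem absNorm_span_nat (l : ℕ) :
    Ideal.absNorm (Ideal.span {(l : 𝓞 K)}) = l ^ Module.finrank ℚ K := by
  rw [Ideal.absNorm_span_singleton, ← RingOfIntegers.rank K]
  have : (l : 𝓞 K) = algebraMap ℤ (𝓞 K) l := by simp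
  rw [this, Algebra.norm_algebraMap]
  simp [Int.natAbs_pow]

theorem dvd_absNorm {P : Ideal (𝓞 K)} [hP : P.IsPrime] {l : ℕ} [hl : Fact l.Prime]
    (h : (l : 𝓞 K) ∈ P) : ∃ j, Ideal.absNorm P = l ^ j ∧ 1 ≤ j := by
  have h1 : Ideal.absNorm P ∣ l ^ Module.finrank ℚ K := by
    rw [← absNorm_span_nat]
    exact Ideal.absNorm_dvd_absNorm_of_le (by rwa [Ideal.span_singleton_le_iff_mem])
  obtain ⟨j, -, hj⟩ := (Nat.dvd_prime_pow hl.out).1 h1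
  refine ⟨j, hj, ?_⟩
  rcases Nat.eq_zero_or_pos j with rfl | h
  · rw [pow_zero, Ideal.absNorm_eq_one_iff] at hj
    exact absurd hj hP.ne_top
  · exact h

theorem sq_dvd_absNorm {P : Ideal (𝓞 K)} [hP : P.IsPrime] {l : ℕ} [hl : Fact l.Prime]
    (h : (l : 𝓞 K) ∈ P) {w : 𝓞 K} (hw : ∀ a : ℤ, w - a ∉ P) : l ^ 2 ∣ Ideal.absNorm P := by
  obtain ⟨j, hj, hj1⟩ := dvd_absNorm h
  rw [hj]
  apply pow_dvd_pow
  by_contra hlt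
  have hj1 : j = 1 := by omega
  subst hj1
  rw [pow_one, Ideal.absNorm_apply, Submodule.cardQuot_apply] at hj
  have hf : Finite (𝓞 K ⧸ P) := Nat.finite_of_card_ne_zero (by rw [hj]; exact hl.out.ne_zero)
  set g : ZMod l → 𝓞 K ⧸ P := fun a => Ideal.Quotient.mk P (a.val : ℤ) with hg
  have hinj : Function.Injective g := by
    intro a b hab
    have := (Ideal.Quotient.eq).1 hab
    rw [← Int.cast_sub, intCast_mem_iff h] at this
    have h3 := (ZMod.intCast_eq_intCast_iff_dvd_sub (b.val : ℤ) (a.val : ℤ) l).2 this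
    simpa using h3.symm
  have hsurj : Function.Surjective g := by
    have hft : Fintype (𝓞 K ⧸ P) := Fintype.ofFinite _
    refine ((Fintype.bijective_iff_injective_and_card g).2 ⟨hinj, ?_⟩).2
    rw [ZMod.card, ← Nat.card_eq_fintype_card]
    exact hj.symm
  obtain ⟨a, ha⟩ := hsurj (Ideal.Quotient.mk P w)
  exact hw _ (Ideal.Quotient.eq.1 ha.symm)

theorem card_mul_le (S : Finset (Ideal (𝓞 K))) {l e f : ℕ} [hl : Fact l.Prime]
    (hS : ∀ P ∈ S, P.IsPrime ∧ (l : 𝓞 K) ∈ P ^ e ∧ l ^ f ∣ Ideal.absNorm P) (he : e ≠ 0) :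
    f * e * S.card ≤ Module.finrank ℚ K := by
  have h0 : ∀ P ∈ S, P ≠ ⊥ := fun P hP e0 => by
    have := (hS P hP).2.1
    rw [e0, Ideal.bot_pow he, Ideal.mem_bot] at this
    exact hl.out.ne_zero (by exact_mod_cast this)
  have h1 : ∏ P ∈ S, P ^ e ∣ Ideal.span {(l : 𝓞 K)} := by
    apply Finset.prod_dvd_of_coprime
    · intro P hP Q hQ hPQ
      apply IsCoprime.pow
      have hP' := (hS P hP).1.isMaximal (h0 P hP)
      have hQ' := (hS Q hQ).1.isMaximal (h0 Q hQ)
      rw [Ideal.isCoprime_iff_sup_eq]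
      exact hP'.coprime_of_ne hQ' hPQ
    · intro P hP
      rw [Ideal.dvd_span_singleton]
      exact (hS P hP).2.1
  have h2 := map_dvd Ideal.absNorm h1
  rw [absNorm_span_nat, map_prod] at h2
  have h3 : ∏ P ∈ S, l ^ (f * e) ∣ ∏ P ∈ S, Ideal.absNorm (P ^ e) := by
    apply Finset.prod_dvd_prod_of_dvd
    intro P hP
    rw [map_pow, pow_mul]
    exact pow_dvd_pow_of_dvd (hS P hP).2.2 _
  rw [Finset.prod_const, ← pow_mul] at h3
  exact (Nat.pow_dvd_pow_iff_le_right hl.out.one_lt).1 (h3.trans h2)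

theorem odd_of_two {P : Ideal (𝓞 K)} [hP : P.IsPrime] (h : (2 : 𝓞 K) ∈ P) {w : 𝓞 K} {m : ℤ}
    (hm : Odd m) (hw : w ^ 2 - w - m = 0) (a : ℤ) : w - a ∉ P := by
  intro ha
  have : Fact (Nat.Prime 2) := ⟨Nat.prime_two⟩
  have h1 : ((a ^ 2 - a - m : ℤ) : 𝓞 K) ∈ P := by
    have e : ((a ^ 2 - a - m : ℤ) : 𝓞 K) = (w - a) * (1 - w - a) := by
      push_cast
      linear_combination hw
    rw [e]
    exact Ideal.mul_mem_right _ _ ha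
  rw [intCast_mem_iff (l := 2) (by exact_mod_cast h)] at h1
  have h2 : Even (a ^ 2 - a) := by
    rw [show a ^ 2 - a = (a - 1) * (a - 1 + 1) by ring]
    exact Int.even_mul_succ_self _
  have h3 : Odd (a ^ 2 - a - m) := h2.sub_odd hm
  exact (Int.not_even_iff_odd.2 h3) (even_iff_two_dvd.2 (by exact_mod_cast h1))

theorem sub_notMem_of_sq_eq_neg_one {P : Ideal (𝓞 K)} [hP : P.IsPrime] {l : ℕ} [hl : Fact l.Prime]
    (hl3 : l % 4 = 3) (h : (l : 𝓞 K) ∈ P) {w : 𝓞 K} (hw : w ^ 2 = -1) (a : ℤ) : w - a ∉ P := by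
  intro ha
  have h1 : ((a ^ 2 + 1 : ℤ) : 𝓞 K) ∈ P := by
    have e : ((a ^ 2 + 1 : ℤ) : 𝓞 K) = (w - a) * (-w - a) := by
      push_cast
      linear_combination hw
    rw [e]
    exact Ideal.mul_mem_right _ _ ha
  rw [intCast_mem_iff h] at h1
  have h2 : (a : ZMod l) ^ 2 = -1 := by
    have := (ZMod.intCast_zmod_eq_zero_iff_dvd _ l).2 h1
    push_cast at this
    exact eq_neg_of_add_eq_zero_left this
  exact ZMod.mod_four_ne_three_of_sq_eq_neg_one h2 hl3

end

/-- `K = X(s)` is a quadratic extension of `X` with `s ^ 2 ∈ X`. -/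
structure IsQuad (X K : IntermediateField ℚ ℂ) (s : ℂ) : Prop where
  le : X ≤ K
  mem : s ∈ K
  sq_mem : s ^ 2 ∈ X
  notMem : s ∉ X
  repr : ∀ z ∈ K, ∃ a ∈ X, ∃ b ∈ X, z = a + b * s

section
variable {X K : IntermediateField ℚ ℂ} {s : ℂ}

/-- Inclusion of subfields as a ring homomorphism. -/
noncomputable abbrev incl (h : X ≤ K) : X →+* K := (IntermediateField.inclusion h).toRingHom

theorem coe_incl (h : X ≤ K) (x : X) : (incl h x : ℂ) = x := rfl

theorem IsQuad.uniq (h : IsQuad X K s) {a b c d : ℂ} (ha : a ∈ X) (hb : b ∈ X) (hc : c ∈ X)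
    (hd : d ∈ X) (e : a + b * s = c + d * s) : a = c ∧ b = d := by
  have hbd : b = d := by
    by_contra hne
    apply h.notMem
    have : s = (c - a) / (b - d) := by
      rw [eq_div_iff (sub_ne_zero.2 hne)]; linear_combination e
    rw [this]
    exact div_mem (sub_mem hc ha) (sub_mem hb hd)
  subst hbd
  exact ⟨add_right_cancel e, rfl⟩

theorem IsQuad.exists_coords (h : IsQuad X K s) (z : K) : ∃ x : X × X, (z : ℂ) = x.1 + x.2 * s := by
  obtain ⟨a, ha, b, hb, e⟩ := h.repr z z.2
  exact ⟨(⟨a, ha⟩, ⟨b, hb⟩), e⟩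

/-- The coordinates of an element of a quadratic extension. -/
noncomputable def IsQuad.co (h : IsQuad X K s) (z : K) : X × X := (h.exists_coords z).choose

theorem IsQuad.co_spec (h : IsQuad X K s) (z : K) : (z : ℂ) = (h.co z).1 + (h.co z).2 * s :=
  (h.exists_coords z).choose_spec

theorem IsQuad.co_eq (h : IsQuad X K s) {z : K} {a b : X} (e : (z : ℂ) = a + b * s) :
    h.co z = (a, b) := by
  have := h.uniq (h.co z).1.2 (h.co z).2.2 a.2 b.2 ((h.co_spec z).symm.trans e)
  exact Prod.ext (Subtype.ext this.1) (Subtype.ext this.2)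

/-- Extension of a ring homomorphism along a quadratic extension. -/
theorem IsQuad.exists_lift (h : IsQuad X K s) {F : Type*} [CommRing F] (ψ : X →+* F) (t : F)
    (ht : t ^ 2 = ψ ⟨s ^ 2, h.sq_mem⟩) :
    ∃ Ψ : K →+* F, (∀ x, Ψ (incl h.le x) = ψ x) ∧ Ψ ⟨s, h.mem⟩ = t := by
  have hX : ∀ x, h.co (incl h.le x) = (x, 0) := fun x => h.co_eq (by simp)
  have hs : h.co ⟨s, h.mem⟩ = (0, 1) := h.co_eq (by simp)
  have hadd : ∀ x y, h.co (x + y) = h.co x + h.co y := fun x y => by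
    refine h.co_eq (a := (h.co x).1 + (h.co y).1) (b := (h.co x).2 + (h.co y).2) ?_
    push_cast
    rw [h.co_spec x, h.co_spec y]
    ring
  have hmul : ∀ x y, h.co (x * y) = ((h.co x).1 * (h.co y).1 + (h.co x).2 * (h.co y).2 *
      ⟨s ^ 2, h.sq_mem⟩, (h.co x).1 * (h.co y).2 + (h.co x).2 * (h.co y).1) := fun x y => by
    apply h.co_eq
    push_cast
    rw [h.co_spec x, h.co_spec y]
    ring
  refine ⟨{ toFun := fun z => ψ (h.co z).1 + ψ (h.co z).2 * t, map_one' := ?_, map_zero' := ?_,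
            map_add' := ?_, map_mul' := ?_ }, ?_, ?_⟩
  · have := hX 1
    rw [map_one] at this
    rw [this]; simp
  · intro x y
    rw [hmul]
    simp only [map_add, map_mul]
    rw [← ht]; ring
  · have := hX 0
    rw [map_zero] at this
    rw [this]; simp
  · intro x y
    rw [hadd]
    simp only [Prod.fst_add, Prod.snd_add, map_add]
    ring
  · intro x
    change ψ (h.co (incl h.le x)).1 + ψ (h.co (incl h.le x)).2 * t = ψ x
    rw [hX]; simp
  · change ψ (h.co ⟨s, h.mem⟩).1 + ψ (h.co ⟨s, h.mem⟩).2 * t = t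
    rw [hs]; simp

theorem IsQuad.exists_conj (h : IsQuad X K s) : ∃ Ψ : K →+* K, (∀ x, Ψ (incl h.le x) = incl h.le x) ∧
    Ψ ⟨s, h.mem⟩ = - ⟨s, h.mem⟩ :=
  h.exists_lift (incl h.le) _ (Subtype.ext (by simp))

/-- The nontrivial automorphism of a quadratic extension. -/
noncomputable def IsQuad.conj (h : IsQuad X K s) : K →+* K := h.exists_conj.choose

theorem IsQuad.conj_incl (h : IsQuad X K s) (x : X) : h.conj (incl h.le x) = incl h.le x :=
  h.exists_conj.choose_spec.1 x

theorem IsQuad.conj_gen (h : IsQuad X K s) : h.conj ⟨s, h.mem⟩ = - ⟨s, h.mem⟩ :=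
  h.exists_conj.choose_spec.2

theorem IsQuad.eq_coords (h : IsQuad X K s) (z : K) :
    ∃ a b : X, z = incl h.le a + incl h.le b * ⟨s, h.mem⟩ ∧
      h.conj z = incl h.le a - incl h.le b * ⟨s, h.mem⟩ := by
  have e : z = incl h.le (h.co z).1 + incl h.le (h.co z).2 * ⟨s, h.mem⟩ :=
    Subtype.ext (h.co_spec z)
  refine ⟨_, _, e, ?_⟩
  conv_lhs => rw [e]
  rw [map_add, map_mul, h.conj_incl, h.conj_incl, h.conj_gen]
  ring

theorem IsQuad.gen_ne_zero (h : IsQuad X K s) : s ≠ 0 := fun e => h.notMem (e ▸ zero_mem X)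

theorem IsQuad.quadInv (h : IsQuad X K s) : QuadInv (incl h.le) h.conj where
  invol z := by
    obtain ⟨a, b, e1, e2⟩ := h.eq_coords z
    rw [e2, map_sub, map_mul, h.conj_incl, h.conj_incl, h.conj_gen, e1]
    ring
  fix := h.conj_incl
  mem z hz := by
    obtain ⟨a, b, e1, e2⟩ := h.eq_coords z
    refine ⟨a, ?_⟩
    rw [e2] at hz
    have h2 : (2 : K) * (z - incl h.le a) = 0 := by
      linear_combination e1 - hz
    rcases mul_eq_zero.1 h2 with h3 | h3
    · exact absurd h3 two_ne_zero
    · exact (sub_eq_zero.1 h3).symm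
  skew := ⟨⟨s, h.mem⟩, h.conj_gen, fun e => h.gen_ne_zero (congrArg Subtype.val e)⟩

theorem IsQuad.isNm_iff (h : IsQuad X K s) (u : X) : IsNm (incl h.le) h.conj u ↔
    ∃ a b : X, u = a ^ 2 - b ^ 2 * ⟨s ^ 2, h.sq_mem⟩ := by
  have key : ∀ a b : X, (incl h.le a + incl h.le b * ⟨s, h.mem⟩) *
      (incl h.le a - incl h.le b * ⟨s, h.mem⟩) = incl h.le (a ^ 2 - b ^ 2 * ⟨s ^ 2, h.sq_mem⟩) :=
    fun a b => Subtype.ext (by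
      push_cast
      simp only [coe_incl]
      push_cast
      ring)
  constructor
  · rintro ⟨z, hz⟩
    obtain ⟨a, b, e1, e2⟩ := h.eq_coords z
    refine ⟨a, b, (incl h.le).injective ?_⟩
    rw [← hz, ← key, e2]
    rw [← e1]
  · rintro ⟨a, b, rfl⟩
    refine ⟨incl h.le a + incl h.le b * ⟨s, h.mem⟩, ?_⟩
    rw [← key, map_add, map_mul, h.conj_incl, h.conj_incl, h.conj_gen]
    ring

theorem IsQuad.numberField (h : IsQuad X K s) [NumberField X] : NumberField K ∧
    Module.finrank ℚ K = 2 * Module.finrank ℚ X := by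
  let f : (X × X) →ₗ[ℚ] K :=
    { toFun := fun x => incl h.le x.1 + incl h.le x.2 * ⟨s, h.mem⟩
      map_add' := fun x y => by simp only [Prod.fst_add, Prod.snd_add, map_add]; ring
      map_smul' := fun c x => by
        apply Subtype.ext
        simp [Algebra.smul_def]
        ring }
  have hb : Function.Bijective f := by
    constructor
    · intro x y hxy
      have := h.uniq x.1.2 x.2.2 y.1.2 y.2.2 (congrArg Subtype.val hxy)
      exact Prod.ext (Subtype.ext this.1) (Subtype.ext this.2)
    · intro z
      obtain ⟨a, b, e1, -⟩ := h.eq_coords z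
      exact ⟨(a, b), e1.symm⟩
  have e := LinearEquiv.ofBijective f hb
  have hfd : FiniteDimensional ℚ K := Module.Finite.equiv e
  refine ⟨⟨⟩, ?_⟩
  rw [← e.finrank_eq, Module.finrank_prod, two_mul]

theorem IsQuad.mem_or (h : IsQuad X K s) {r : ℂ} (hr : r ∈ K) (hr2 : r ^ 2 ∈ X) :
    r ∈ X ∨ r * s ∈ X := by
  obtain ⟨a, ha, b, hb, rfl⟩ := h.repr r hr
  have e : a ^ 2 + b ^ 2 * s ^ 2 + (2 * a * b) * s = (a + b * s) ^ 2 + 0 * s := by ring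
  have := (h.uniq (add_mem (pow_mem ha 2) (mul_mem (pow_mem hb 2) h.sq_mem))
    (mul_mem (mul_mem (ofNat_mem X 2) ha) hb) hr2 (zero_mem X) e).2
  rcases mul_eq_zero.1 this with h0 | h0
  · have ha0 : a = 0 := (mul_eq_zero.1 h0).resolve_left two_ne_zero
    right
    rw [ha0, zero_add, mul_assoc, ← sq]
    exact mul_mem hb h.sq_mem
  · left
    rw [h0, zero_mul, add_zero]
    exact ha

theorem IsQuad.notMem_of (h : IsQuad X K s) {r : ℂ} (hr2 : r ^ 2 ∈ X) (h1 : r ∉ X)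
    (h2 : r * s ∉ X) : r ∉ K := fun hr => (h.mem_or hr hr2).elim h1 h2

theorem adjoin_insert_isQuad {S : Set ℂ} (h2 : s ^ 2 ∈ IntermediateField.adjoin ℚ S)
    (hs : s ∉ IntermediateField.adjoin ℚ S) :
    IsQuad (IntermediateField.adjoin ℚ S) (IntermediateField.adjoin ℚ (insert s S)) s := by
  set X := IntermediateField.adjoin ℚ S with hX
  let K : IntermediateField ℚ ℂ :=
    { carrier := {z | ∃ a ∈ X, ∃ b ∈ X, z = a + b * s}
      mul_mem' := by
        rintro _ _ ⟨a, ha, b, hb, rfl⟩ ⟨c, hc, d, hd, rfl⟩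
        exact ⟨a * c + b * d * s ^ 2, add_mem (mul_mem ha hc) (mul_mem (mul_mem hb hd) h2),
          a * d + b * c, add_mem (mul_mem ha hd) (mul_mem hb hc), by ring⟩
      add_mem' := by
        rintro _ _ ⟨a, ha, b, hb, rfl⟩ ⟨c, hc, d, hd, rfl⟩
        exact ⟨a + c, add_mem ha hc, b + d, add_mem hb hd, by ring⟩
      algebraMap_mem' := fun r => ⟨_, X.algebraMap_mem r, 0, zero_mem X, by ring⟩
      inv_mem' := by
        rintro _ ⟨a, ha, b, hb, rfl⟩
        by_cases hz : a + b * s = 0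
        · exact ⟨0, zero_mem X, 0, zero_mem X, by rw [hz]; simp⟩
        by_cases hc : a - b * s = 0
        · exact ⟨(2 * a)⁻¹, inv_mem (mul_mem (ofNat_mem X 2) ha), 0, zero_mem X, by
            rw [show a + b * s = 2 * a by linear_combination -hc]; ring⟩
        · have hne : a ^ 2 - b ^ 2 * s ^ 2 ≠ 0 := by
            rw [show a ^ 2 - b ^ 2 * s ^ 2 = (a + b * s) * (a - b * s) by ring]
            exact mul_ne_zero hz hc
          have hm : a ^ 2 - b ^ 2 * s ^ 2 ∈ X :=
            sub_mem (pow_mem ha 2) (mul_mem (pow_mem hb 2) h2)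
          refine ⟨a / (a ^ 2 - b ^ 2 * s ^ 2), div_mem ha hm, -b / (a ^ 2 - b ^ 2 * s ^ 2),
            div_mem (neg_mem hb) hm, ?_⟩
          rw [inv_eq_iff_eq_inv, ← sub_eq_zero]
          field_simp
          ring_nf
          field_simp
          ring }
  have hK : IntermediateField.adjoin ℚ (insert s S) ≤ K := by
    rw [IntermediateField.adjoin_le_iff]
    rintro x (rfl | hx)
    · exact ⟨0, zero_mem X, 1, one_mem X, by ring⟩
    · exact ⟨x, IntermediateField.subset_adjoin ℚ S hx, 0, zero_mem X, by ring⟩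
  exact ⟨IntermediateField.adjoin.mono ℚ _ _ (Set.subset_insert s S),
    IntermediateField.subset_adjoin ℚ _ (Set.mem_insert s S), h2, hs, fun z hz => hK hz⟩

end

section
variable {K : Type*} [Field K] [NumberField K]

theorem two_mul_rank_succ_of_sq_neg {z : K} {n : ℕ} (hn : 0 < n) (hz : z ^ 2 = -(n : K)) :
    2 * (Units.rank K + 1) = Module.finrank ℚ K := by
  have : IsTotallyComplex K := ⟨fun v => by
    rw [InfinitePlace.isComplex_iff, ComplexEmbedding.isReal_iff]
    intro hr
    have h1 : (starRingEnd ℂ) (v.embedding z) = v.embedding z := RingHom.congr_fun hr z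
    have h2 : (v.embedding z) ^ 2 = -(n : ℂ) := by rw [← map_pow, hz]; simp
    obtain ⟨r, hr'⟩ := Complex.conj_eq_iff_real.1 h1
    rw [hr'] at h2
    have h3 : r ^ 2 = -(n : ℝ) := by exact_mod_cast h2
    have : (0 : ℝ) < n := by exact_mod_cast hn
    nlinarith [sq_nonneg r]⟩
  have h1 := IsTotallyComplex.finrank K
  have h2 := InfinitePlace.card_eq_nrRealPlaces_add_nrComplexPlaces K
  have h3 := IsTotallyComplex.nrRealPlaces_eq_zero K
  have h4 : 0 < Fintype.card (InfinitePlace K) := Fintype.card_pos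
  rw [Units.rank]
  lia

/-- All complex embeddings of `K` are real. -/
def AllReal (K : Type*) [Field K] : Prop :=
  ∀ φ : K →+* ℂ, ∀ z, (starRingEnd ℂ) (φ z) = φ z

theorem AllReal.rank_succ (h : AllReal K) : Units.rank K + 1 = Module.finrank ℚ K := by
  have : IsTotallyReal K := ⟨fun v => by
    rw [InfinitePlace.isReal_iff, ComplexEmbedding.isReal_iff]
    exact RingHom.ext fun z => h _ z⟩
  have h1 := IsTotallyReal.finrank K
  have h2 := InfinitePlace.card_eq_nrRealPlaces_add_nrComplexPlaces K
  have h3 := IsTotallyReal.nrComplexPlaces_eq_zero K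
  have h4 : 0 < Fintype.card (InfinitePlace K) := Fintype.card_pos
  rw [Units.rank]
  lia

theorem AllReal.exists_real (h : AllReal K) : Nonempty (K →+* ℝ) := by
  have φ : K →+* ℂ := (Classical.arbitrary _ : K →+* ℂ)
  exact ⟨ComplexEmbedding.IsReal.embedding (φ := φ)
    (ComplexEmbedding.isReal_iff.2 (RingHom.ext fun z => h φ z))⟩

theorem odd_class_of_finrank_one (h : Module.finrank ℚ K = 1) :
    Nat.card (ClassGroup (𝓞 K)) = 1 := by
  have hb : Function.Bijective (algebraMap ℚ K) :=
    ⟨(algebraMap ℚ K).injective, fun x => by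
      obtain ⟨c, hc⟩ := (finrank_eq_one_iff_of_nonzero' (1 : K) one_ne_zero).1 h x
      exact ⟨c, by rw [← hc, Algebra.smul_def, mul_one]⟩⟩
  let e : 𝓞 ℚ ≃+* 𝓞 K := RingOfIntegers.mapRingEquiv (RingEquiv.ofBijective (algebraMap ℚ K) hb)
  have hpid : IsPrincipalIdealRing (𝓞 ℚ) :=
    IsPrincipalIdealRing.of_surjective Rat.ringOfIntegersEquiv.symm.toRingHom
      Rat.ringOfIntegersEquiv.symm.surjective
  have : IsPrincipalIdealRing (𝓞 K) := IsPrincipalIdealRing.of_surjective e.toRingHom e.surjective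
  rw [Nat.card_eq_fintype_card]
  exact card_classGroup_eq_one_iff.2 this
end

/-- The rational numbers as a subfield of `ℂ`. -/
noncomputable abbrev Q0 : IntermediateField ℚ ℂ := IntermediateField.adjoin ℚ ∅

theorem mem_Q0 {z : ℂ} : z ∈ Q0 ↔ ∃ r : ℚ, (r : ℂ) = z := by
  rw [Q0, IntermediateField.adjoin_empty, IntermediateField.mem_bot]
  rfl

instance : NumberField Q0 := by
  have h : FiniteDimensional ℚ Q0 := by
    rw [Q0, IntermediateField.adjoin_empty]
    infer_instance
  exact ⟨⟩

theorem finrank_Q0 : Module.finrank ℚ Q0 = 1 := by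
  rw [Q0, IntermediateField.adjoin_empty, IntermediateField.finrank_bot]

theorem hom_Q0 {F : Type*} [Field F] [CharZero F] (f : Q0 →+* F) (x : Q0) :
    ∃ r : ℚ, (x : ℂ) = r ∧ f x = r := by
  obtain ⟨r, hr⟩ := mem_Q0.1 x.2
  refine ⟨r, hr.symm, ?_⟩
  have : x = (r : Q0) := Subtype.ext (by rw [← hr]; simp)
  rw [this, map_ratCast]

theorem allReal_Q0 : AllReal Q0 := fun φ z => by
  obtain ⟨r, -, hr⟩ := hom_Q0 φ z
  rw [hr]; simp

theorem IsQuad.allReal {X K : IntermediateField ℚ ℂ} {s : ℂ} (h : IsQuad X K s) (hX : AllReal X)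
    (n : ℕ) (hs : s ^ 2 = n) : AllReal K := fun φ z => by
  obtain ⟨a, b, e, -⟩ := h.eq_coords z
  have h1 : φ ⟨s, h.mem⟩ ^ 2 = (n : ℂ) := by
    rw [← map_pow, ← map_natCast φ]
    congr 1
    exact Subtype.ext (by simpa using hs)
  have h2 : (φ ⟨s, h.mem⟩) = ((Real.sqrt n : ℝ) : ℂ) ∨ φ ⟨s, h.mem⟩ = -((Real.sqrt n : ℝ) : ℂ) := by
    apply sq_eq_sq_iff_eq_or_eq_neg.1
    rw [h1, ← Complex.ofReal_pow, Real.sq_sqrt (Nat.cast_nonneg n), Complex.ofReal_natCast]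
  have h3 : (starRingEnd ℂ) (φ ⟨s, h.mem⟩) = φ ⟨s, h.mem⟩ := by
    rcases h2 with h2 | h2 <;> rw [h2] <;> simp
  have h4 := hX (φ.comp (incl h.le))
  simp only [RingHom.comp_apply] at h4
  rw [e, map_add, map_mul, map_add, map_mul, h4, h4, h3]

theorem notMem_Q0_of_sq_neg {r : ℂ} (n : ℤ) (h : r ^ 2 = n) (hn : n < 0) : r ∉ Q0 := fun hr => by
  obtain ⟨t, rfl⟩ := mem_Q0.1 hr
  have h1 : t ^ 2 = n := by exact_mod_cast h
  have : (n : ℚ) < 0 := by exact_mod_cast hn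
  nlinarith [sq_nonneg t]

section

/-- Complex numbers with rational square. -/
noncomputable def sqs : Submonoid ℂ := Q0.toSubalgebra.toSubsemiring.toSubmonoid.comap (powMonoidHom 2)

theorem mem_sqs {z : ℂ} : z ∈ sqs ↔ z ^ 2 ∈ Q0 := Iff.rfl

theorem mem_sqs_of_int {z : ℂ} (n : ℤ) (h : z ^ 2 = n) : z ∈ sqs :=
  mem_sqs.2 (mem_Q0.2 ⟨n, by rw [h]; simp⟩)

theorem sqs_sq {z : ℂ} {S : Set ℂ} (h : z ∈ sqs) : z ^ 2 ∈ adjoin ℚ S :=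
  IntermediateField.adjoin.mono ℚ ∅ S (Set.empty_subset S) h

/-- `r` has rational square and lies outside `X`. -/
def Out (X : IntermediateField ℚ ℂ) (r : ℂ) : Prop := r ∈ sqs ∧ r ∉ X

theorem IsQuad.step {S : Set ℂ} {K : IntermediateField ℚ ℂ} {s r : ℂ}
    (h : IsQuad (adjoin ℚ S) K s) (h1 : Out (adjoin ℚ S) r) (h2 : Out (adjoin ℚ S) (r * s)) :
    Out K r := ⟨h1.1, h.notMem_of (sqs_sq h1.1) h1.2 h2.2⟩

theorem Out.isQuad {S : Set ℂ} {s : ℂ} (h : Out (adjoin ℚ S) s) :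
    IsQuad (adjoin ℚ S) (adjoin ℚ (insert s S)) s :=
  adjoin_insert_isQuad (sqs_sq h.1) h.2

/-- The data of the theorem: square roots `a`, `b`, `c` of `p`, `2`, `q`. -/
structure Setup (p q : ℕ) (a b c : ℂ) : Prop where
  pp : p.Prime
  qp : q.Prime
  p8 : p % 8 = 5
  q8 : q % 8 = 3
  leg : ∃ t : ℤ, (q : ℤ) ∣ t ^ 2 - p
  a2 : a ^ 2 = p
  b2 : b ^ 2 = 2
  c2 : c ^ 2 = q

variable {p q : ℕ} {a b c : ℂ} (h : Setup p q a b c)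
include h

theorem Setup.ne : p ≠ q := fun e => by have := h.p8; have := h.q8; lia

theorem Setup.mono (i j k l : ℕ) {r : ℂ} (hr : r = a ^ i * b ^ j * c ^ k * I ^ l)
    (ho : Odd l ∨ Odd i ∨ Odd j ∨ Odd k) : Out Q0 r := by
  have h2 : r ^ 2 = ((-1) ^ l * (p ^ i * 2 ^ j * q ^ k : ℕ) : ℤ) := by
    rw [hr]
    have : (a ^ i * b ^ j * c ^ k * I ^ l) ^ 2 = (a ^ 2) ^ i * (b ^ 2) ^ j * (c ^ 2) ^ k *
      (I ^ 2) ^ l := by ring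
    rw [this, h.a2, h.b2, h.c2, I_sq]
    push_cast
    ring
  refine ⟨mem_sqs_of_int _ h2, ?_⟩
  have hp0 := h.pp.ne_zero
  have hq0 := h.qp.ne_zero
  have hpos : 0 < p ^ i * 2 ^ j * q ^ k := by positivity
  rcases Nat.even_or_odd l with hl | hl
  · rw [hl.neg_one_pow, one_mul] at h2
    intro hm
    obtain ⟨t, rfl⟩ := mem_Q0.1 hm
    have h1 : t ^ 2 = (p ^ i * 2 ^ j * q ^ k : ℕ) := by exact_mod_cast h2
    obtain ⟨y, hy⟩ := Rat.isSquare_natCast_iff.1 ⟨t, by rw [← h1]; ring⟩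
    have hy0 : y ≠ 0 := by rintro rfl; lia
    have hf := congrArg Nat.factorization hy
    rw [Nat.factorization_mul hy0 hy0, Nat.factorization_mul (by positivity) (by positivity),
      Nat.factorization_mul (by positivity) (by positivity), h.pp.factorization_pow,
      h.qp.factorization_pow, Nat.prime_two.factorization_pow] at hf
    have hpq := h.ne
    have hp2 : p ≠ 2 := fun e => by have := h.p8; lia
    have hq2 : q ≠ 2 := fun e => by have := h.q8; lia
    have e1 := DFunLike.congr_fun hf p
    have e2 := DFunLike.congr_fun hf 2
    have e3 := DFunLike.congr_fun hf q
    simp [hpq, hpq.symm, hp2, hp2.symm, hq2, hq2.symm] at e1 e2 e3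
    rcases ho with ho | ho | ho | ho <;> grind
  · exact notMem_Q0_of_sq_neg _ h2 (by rw [hl.neg_one_pow]; lia)

omit h
/-- `ℚ(√p)` -/
noncomputable def Setup.R (_ : Setup p q a b c) : IntermediateField ℚ ℂ := adjoin ℚ (insert a ∅)
/-- `ℚ(√p, √-2)` -/
noncomputable def Setup.Y (_ : Setup p q a b c) : IntermediateField ℚ ℂ := adjoin ℚ (insert (b * I) (insert a ∅))
/-- `ℚ(√p, √-2, i)` -/
noncomputable def Setup.A (_ : Setup p q a b c) : IntermediateField ℚ ℂ :=
  adjoin ℚ (insert I (insert (b * I) (insert a ∅)))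
/-- `ℚ(√p, √-2, i, √-q)` -/
noncomputable def Setup.K (_ : Setup p q a b c) : IntermediateField ℚ ℂ :=
  adjoin ℚ (insert (c * I) (insert I (insert (b * I) (insert a ∅))))
/-- `ℚ(√p, √q)` -/
noncomputable def Setup.S (_ : Setup p q a b c) : IntermediateField ℚ ℂ := adjoin ℚ (insert c (insert a ∅))
/-- `ℚ(√p, √-q)` -/
noncomputable def Setup.L (_ : Setup p q a b c) : IntermediateField ℚ ℂ := adjoin ℚ (insert (c * I) (insert a ∅))
/-- `ℚ(√p, √-q, √-2)` -/
noncomputable def Setup.L2 (_ : Setup p q a b c) : IntermediateField ℚ ℂ :=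
  adjoin ℚ (insert (b * I) (insert (c * I) (insert a ∅)))
/-- `ℚ(√-pq)` -/
noncomputable def Setup.k (_ : Setup p q a b c) : IntermediateField ℚ ℂ := adjoin ℚ (insert (a * c * I) ∅)
/-- `ℚ(√-pq, √2)` -/
noncomputable def Setup.F (_ : Setup p q a b c) : IntermediateField ℚ ℂ := adjoin ℚ (insert b (insert (a * c * I) ∅))
/-- `ℚ(√-pq, √2, √p)` -/
noncomputable def Setup.M (_ : Setup p q a b c) : IntermediateField ℚ ℂ :=
  adjoin ℚ (insert a (insert b (insert (a * c * I) ∅)))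

include h
theorem Setup.K_eq_L2 : h.K =
    adjoin ℚ (insert I (insert (b * I) (insert (c * I) (insert a ∅)))) := by
  rw [Setup.K, Set.insert_comm (c * I), Set.insert_comm (c * I)]

theorem Setup.K_eq_M : h.K =
    adjoin ℚ (insert I (insert a (insert b (insert (a * c * I) ∅)))) := by
  have hI := I_sq
  have ha0 : a ≠ 0 := fun e => h.pp.ne_zero (by have := h.a2; rw [e] at this; simpa using this.symm)
  rw [Setup.K]
  apply le_antisymm <;> rw [IntermediateField.adjoin_le_iff]
  · set K' := adjoin ℚ (insert I (insert a (insert b (insert (a * c * I) ∅))))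
    have h1 : I ∈ K' := subset_adjoin _ _ (by simp)
    have h2 : a ∈ K' := subset_adjoin _ _ (by simp)
    have h3 : b ∈ K' := subset_adjoin _ _ (by simp)
    have h4 : a * c * I ∈ K' := subset_adjoin _ _ (by simp)
    rintro x (rfl | rfl | rfl | rfl | hx)
    · have := mul_mem (inv_mem h2) h4
      rwa [show a⁻¹ * (a * c * I) = c * I by field_simp] at this
    · exact h1
    · exact mul_mem h3 h1
    · exact h2
    · exact absurd hx (Set.notMem_empty x)
  · set K' := adjoin ℚ (insert (c * I) (insert I (insert (b * I) (insert a ∅))))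
    have h1 : I ∈ K' := subset_adjoin _ _ (by simp)
    have h2 : a ∈ K' := subset_adjoin _ _ (by simp)
    have h3 : b * I ∈ K' := subset_adjoin _ _ (by simp)
    have h4 : c * I ∈ K' := subset_adjoin _ _ (by simp)
    rintro x (rfl | rfl | rfl | rfl | hx)
    · exact h1
    · exact h2
    · have := neg_mem (mul_mem h3 h1)
      rwa [show -(x * I * I) = x by linear_combination -x * hI] at this
    · rw [SetLike.mem_coe, mul_assoc]; exact mul_mem h2 h4
    · exact absurd hx (Set.notMem_empty x)

theorem Setup.isQuadR : IsQuad Q0 h.R a :=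
  Out.isQuad (h.mono 1 0 0 0 (by ring) (by decide))

theorem Setup.isQuadY : IsQuad h.R h.Y (b * I) :=
  Out.isQuad
    (h.isQuadR.step
          (h.mono 0 1 0 1 (by ring) (by decide))
          (h.mono 1 1 0 1 (by ring) (by decide)))

theorem Setup.isQuadA : IsQuad h.Y h.A I :=
  Out.isQuad
    (h.isQuadY.step
        (h.isQuadR.step
          (h.mono 0 0 0 1 (by ring) (by decide))
          (h.mono 1 0 0 1 (by ring) (by decide)))
        (h.isQuadR.step
          (h.mono 0 1 0 2 (by ring) (by decide))
          (h.mono 1 1 0 2 (by ring) (by decide))))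

theorem Setup.isQuadK : IsQuad h.A h.K (c * I) :=
  Out.isQuad
    (h.isQuadA.step
      (h.isQuadY.step
        (h.isQuadR.step
          (h.mono 0 0 1 1 (by ring) (by decide))
          (h.mono 1 0 1 1 (by ring) (by decide)))
        (h.isQuadR.step
          (h.mono 0 1 1 2 (by ring) (by decide))
          (h.mono 1 1 1 2 (by ring) (by decide))))
      (h.isQuadY.step
        (h.isQuadR.step
          (h.mono 0 0 1 2 (by ring) (by decide))
          (h.mono 1 0 1 2 (by ring) (by decide)))
        (h.isQuadR.step
          (h.mono 0 1 1 3 (by ring) (by decide))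
          (h.mono 1 1 1 3 (by ring) (by decide)))))

theorem Setup.isQuadS : IsQuad h.R h.S c :=
  Out.isQuad
    (h.isQuadR.step
          (h.mono 0 0 1 0 (by ring) (by decide))
          (h.mono 1 0 1 0 (by ring) (by decide)))

theorem Setup.isQuadL : IsQuad h.R h.L (c * I) :=
  Out.isQuad
    (h.isQuadR.step
          (h.mono 0 0 1 1 (by ring) (by decide))
          (h.mono 1 0 1 1 (by ring) (by decide)))

theorem Setup.isQuadL2 : IsQuad h.L h.L2 (b * I) :=
  Out.isQuad
    (h.isQuadL.step
        (h.isQuadR.step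
          (h.mono 0 1 0 1 (by ring) (by decide))
          (h.mono 1 1 0 1 (by ring) (by decide)))
        (h.isQuadR.step
          (h.mono 0 1 1 2 (by ring) (by decide))
          (h.mono 1 1 1 2 (by ring) (by decide))))

theorem Setup.isQuadk : IsQuad Q0 h.k (a * c * I) :=
  Out.isQuad (h.mono 1 0 1 1 (by ring) (by decide))

theorem Setup.isQuadF : IsQuad h.k h.F b :=
  Out.isQuad
    (h.isQuadk.step
          (h.mono 0 1 0 0 (by ring) (by decide))
          (h.mono 1 1 1 1 (by ring) (by decide)))

theorem Setup.isQuadM : IsQuad h.F h.M a :=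
  Out.isQuad
    (h.isQuadF.step
        (h.isQuadk.step
          (h.mono 1 0 0 0 (by ring) (by decide))
          (h.mono 2 0 1 1 (by ring) (by decide)))
        (h.isQuadk.step
          (h.mono 1 1 0 0 (by ring) (by decide))
          (h.mono 2 1 1 1 (by ring) (by decide))))

theorem Setup.isQuadKL : IsQuad h.L2 h.K I := by
  rw [h.K_eq_L2]
  exact Out.isQuad
    (h.isQuadL2.step
      (h.isQuadL.step
        (h.isQuadR.step
          (h.mono 0 0 0 1 (by ring) (by decide))
          (h.mono 1 0 0 1 (by ring) (by decide)))
        (h.isQuadR.step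
          (h.mono 0 0 1 2 (by ring) (by decide))
          (h.mono 1 0 1 2 (by ring) (by decide))))
      (h.isQuadL.step
        (h.isQuadR.step
          (h.mono 0 1 0 2 (by ring) (by decide))
          (h.mono 1 1 0 2 (by ring) (by decide)))
        (h.isQuadR.step
          (h.mono 0 1 1 3 (by ring) (by decide))
          (h.mono 1 1 1 3 (by ring) (by decide)))))

theorem Setup.isQuadKM : IsQuad h.M h.K I := by
  rw [h.K_eq_M]
  exact Out.isQuad
    (h.isQuadM.step
      (h.isQuadF.step
        (h.isQuadk.step
          (h.mono 0 0 0 1 (by ring) (by decide))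
          (h.mono 1 0 1 2 (by ring) (by decide)))
        (h.isQuadk.step
          (h.mono 0 1 0 1 (by ring) (by decide))
          (h.mono 1 1 1 2 (by ring) (by decide))))
      (h.isQuadF.step
        (h.isQuadk.step
          (h.mono 1 0 0 1 (by ring) (by decide))
          (h.mono 2 0 1 2 (by ring) (by decide)))
        (h.isQuadk.step
          (h.mono 1 1 0 1 (by ring) (by decide))
          (h.mono 2 1 1 2 (by ring) (by decide)))))

end

section

variable {p q : ℕ} {a b c : ℂ} (h : Setup p q a b c)

instance : NumberField h.R := h.isQuadR.numberField.1
instance : NumberField h.Y := h.isQuadY.numberField.1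
instance : NumberField h.A := h.isQuadA.numberField.1
instance : NumberField h.K := h.isQuadK.numberField.1
instance : NumberField h.S := h.isQuadS.numberField.1
instance : NumberField h.L := h.isQuadL.numberField.1
instance : NumberField h.L2 := h.isQuadL2.numberField.1
instance : NumberField h.k := h.isQuadk.numberField.1
instance : NumberField h.F := h.isQuadF.numberField.1
instance : NumberField h.M := h.isQuadM.numberField.1

theorem Setup.finrank_R : finrank ℚ h.R = 2 := by rw [h.isQuadR.numberField.2, finrank_Q0]
theorem Setup.finrank_Y : finrank ℚ h.Y = 4 := by rw [h.isQuadY.numberField.2, h.finrank_R]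
theorem Setup.finrank_A : finrank ℚ h.A = 8 := by rw [h.isQuadA.numberField.2, h.finrank_Y]
theorem Setup.finrank_K : finrank ℚ h.K = 16 := by rw [h.isQuadK.numberField.2, h.finrank_A]
theorem Setup.finrank_S : finrank ℚ h.S = 4 := by rw [h.isQuadS.numberField.2, h.finrank_R]
theorem Setup.finrank_L : finrank ℚ h.L = 4 := by rw [h.isQuadL.numberField.2, h.finrank_R]
theorem Setup.finrank_k : finrank ℚ h.k = 2 := by rw [h.isQuadk.numberField.2, finrank_Q0]
theorem Setup.finrank_F : finrank ℚ h.F = 4 := by rw [h.isQuadF.numberField.2, h.finrank_k]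

theorem Setup.a_mem_R : a ∈ h.R := h.isQuadR.mem
theorem Setup.a_mem_Y : a ∈ h.Y := h.isQuadY.le h.a_mem_R
theorem Setup.a_mem_A : a ∈ h.A := h.isQuadA.le h.a_mem_Y
theorem Setup.a_mem_K : a ∈ h.K := h.isQuadK.le h.a_mem_A
theorem Setup.a_mem_S : a ∈ h.S := h.isQuadS.le h.a_mem_R
theorem Setup.a_mem_L : a ∈ h.L := h.isQuadL.le h.a_mem_R
theorem Setup.bI_mem_Y : b * I ∈ h.Y := h.isQuadY.mem
theorem Setup.bI_mem_A : b * I ∈ h.A := h.isQuadA.le h.bI_mem_Y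
theorem Setup.I_mem_A : I ∈ h.A := h.isQuadA.mem
theorem Setup.I_mem_K : I ∈ h.K := h.isQuadK.le h.I_mem_A
theorem Setup.cI_mem_K : c * I ∈ h.K := h.isQuadK.mem
theorem Setup.cI_mem_L : c * I ∈ h.L := h.isQuadL.mem
theorem Setup.c_mem_S : c ∈ h.S := h.isQuadS.mem
theorem Setup.b_mem_A : b ∈ h.A := by
  have := neg_mem (mul_mem h.bI_mem_A h.I_mem_A)
  rwa [show -(b * I * I) = b by linear_combination -b * I_sq] at this
theorem Setup.b_mem_K : b ∈ h.K := h.isQuadK.le h.b_mem_A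
theorem Setup.c_mem_K : c ∈ h.K := by
  have := neg_mem (mul_mem h.cI_mem_K h.I_mem_K)
  rwa [show -(c * I * I) = c by linear_combination -c * I_sq] at this
theorem Setup.acI_mem_k : a * c * I ∈ h.k := h.isQuadk.mem
theorem Setup.acI_mem_F : a * c * I ∈ h.F := h.isQuadF.le h.acI_mem_k
theorem Setup.b_mem_F : b ∈ h.F := h.isQuadF.mem

theorem rank_of_sq_neg {X : IntermediateField ℚ ℂ} [NumberField X] {z : ℂ} (hz : z ∈ X) {n : ℕ}
    (hn : 0 < n) (h : z ^ 2 = -(n : ℂ)) : 2 * (Units.rank X + 1) = finrank ℚ X :=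
  two_mul_rank_succ_of_sq_neg (z := (⟨z, hz⟩ : X)) hn (Subtype.ext (by simpa using h))

theorem rank_Q0 : Units.rank Q0 = 0 := by
  have := allReal_Q0.rank_succ
  rw [finrank_Q0] at this
  lia

include h in
theorem Setup.bI2 : (b * I) ^ 2 = -(2 : ℕ) := by rw [mul_pow, h.b2, I_sq]; simp
include h in
theorem Setup.cI2 : (c * I) ^ 2 = -(q : ℂ) := by rw [mul_pow, h.c2, I_sq]; simp
include h in
theorem Setup.acI2 : (a * c * I) ^ 2 = -((p * q : ℕ) : ℂ) := by
  rw [mul_pow, mul_pow, h.a2, h.c2, I_sq]; push_cast; ring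

theorem Setup.allReal_R : AllReal h.R := h.isQuadR.allReal allReal_Q0 p h.a2
theorem Setup.allReal_S : AllReal h.S := h.isQuadS.allReal h.allReal_R q h.c2

theorem Setup.rank_R : Units.rank h.R = 1 := by
  have := h.allReal_R.rank_succ
  rw [h.finrank_R] at this
  lia
theorem Setup.rank_S : Units.rank h.S = 3 := by
  have := h.allReal_S.rank_succ
  rw [h.finrank_S] at this
  lia
theorem Setup.rank_Y : Units.rank h.Y = 1 := by
  have := rank_of_sq_neg h.bI_mem_Y two_pos h.bI2
  rw [h.finrank_Y] at this
  lia
theorem Setup.rank_A : Units.rank h.A = 3 := by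
  have := rank_of_sq_neg h.bI_mem_A two_pos h.bI2
  rw [h.finrank_A] at this
  lia
theorem Setup.rank_K : Units.rank h.K = 7 := by
  have := rank_of_sq_neg h.cI_mem_K h.qp.pos h.cI2
  rw [h.finrank_K] at this
  lia
theorem Setup.rank_k : Units.rank h.k = 0 := by
  have := rank_of_sq_neg h.acI_mem_k (Nat.mul_pos h.pp.pos h.qp.pos) h.acI2
  rw [h.finrank_k] at this
  lia
theorem Setup.rank_F : Units.rank h.F = 1 := by
  have := rank_of_sq_neg h.acI_mem_F (Nat.mul_pos h.pp.pos h.qp.pos) h.acI2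
  rw [h.finrank_F] at this
  lia

end

section

theorem zpow_parity {l : ℕ} (hl : 1 < l) (m n : ℤ) : ((l : ℝ) ^ m) ^ 2 ≠ (l : ℝ)⁻¹ * ((l : ℝ) ^ n) ^ 2 := by
  have h1 : (1 : ℝ) < l := by exact_mod_cast hl
  have h0 : (l : ℝ) ≠ 0 := by positivity
  rw [← zpow_neg_one, ← zpow_natCast, ← zpow_natCast, ← zpow_mul, ← zpow_mul, ← zpow_add₀ h0]
  intro h
  have := zpow_right_injective₀ (by positivity) h1.ne' h
  push_cast at this
  lia

theorem padic_form_anisotropic {l : ℕ} [Fact l.Prime] {r s : ℤ} (hr : ¬∃ t : ℤ, (l : ℤ) ∣ t ^ 2 - r)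
    (hs : ¬ (l : ℤ) ∣ s) {w x y : ℚ_[l]} (h : r * w ^ 2 = x ^ 2 + s * l * y ^ 2) : w = 0 := by
  have hl : 1 < l := (Fact.out : l.Prime).one_lt
  by_contra hw
  have nint : ∀ {k : ℤ}, ¬ (l : ℤ) ∣ k → ‖(k : ℚ_[l])‖ = 1 := fun {k} hk =>
    le_antisymm (Padic.norm_int_le_one k) (not_lt.1 fun hlt => hk (Padic.norm_intCast_lt_one_iff.1 hlt))
  have hr1 : ‖(r : ℚ_[l])‖ = 1 := nint fun hd => hr ⟨0, by simpa using hd⟩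
  have nsy : ‖(s : ℚ_[l]) * l * y ^ 2‖ = (l : ℝ)⁻¹ * ‖y‖ ^ 2 := by
    rw [norm_mul, norm_mul, nint hs, Padic.norm_p, norm_pow, one_mul]
  have nz : ∀ z : ℚ_[l], z ≠ 0 → ∃ n : ℤ, ‖z‖ = (l : ℝ) ^ n := fun z hz =>
    ⟨_, Padic.norm_eq_zpow_neg_valuation hz⟩
  have par : ∀ z y : ℚ_[l], z ≠ 0 → ‖z‖ ^ 2 ≠ (l : ℝ)⁻¹ * ‖y‖ ^ 2 := by
    intro z y hz
    by_cases hy : y = 0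
    · rw [hy, norm_zero]
      have := norm_pos_iff.2 hz
      have : ‖z‖ ^ 2 ≠ 0 := by positivity
      simpa using this
    · obtain ⟨m, hm⟩ := nz z hz
      obtain ⟨n, hn⟩ := nz y hy
      rw [hm, hn]
      exact zpow_parity hl m n
  have hn : ‖w‖ ^ 2 = ‖x ^ 2 + s * l * y ^ 2‖ := by rw [← h, norm_mul, hr1, norm_pow, one_mul]
  have hx : x ≠ 0 := by
    rintro rfl
    rw [zero_pow two_ne_zero, zero_add, nsy] at hn
    exact par w y hw hn
  have hlt : (l : ℝ)⁻¹ * ‖y‖ ^ 2 < ‖w‖ ^ 2 ∧ ‖x‖ = ‖w‖ := by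
    rw [Padic.add_eq_max_of_ne (by rw [nsy, norm_pow]; exact par x y hx), nsy, norm_pow] at hn
    rcases le_total ((l : ℝ)⁻¹ * ‖y‖ ^ 2) (‖x‖ ^ 2) with hle | hle
    · rw [max_eq_left hle] at hn
      exact ⟨hn ▸ lt_of_le_of_ne hle (par x y hx).symm,
        ((sq_eq_sq₀ (norm_nonneg _) (norm_nonneg _)).1 hn).symm⟩
    · rw [max_eq_right hle] at hn
      exact absurd hn (par w y hw)
  have hw0 : 0 < ‖w‖ := norm_pos_iff.2 hw
  have hu : ‖x / w‖ ≤ 1 := by rw [norm_div, hlt.2, div_self hw0.ne']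
  obtain ⟨u, hu'⟩ : ∃ u : ℤ_[l], (u : ℚ_[l]) = x / w := ⟨⟨x / w, hu⟩, rfl⟩
  obtain ⟨n, -, hn'⟩ := PadicInt.exists_mem_range u
  rw [IsLocalRing.mem_maximalIdeal, PadicInt.mem_nonunits, PadicInt.norm_def] at hn'
  rw [PadicInt.coe_sub, PadicInt.coe_natCast, hu'] at hn'
  apply hr
  refine ⟨n, ?_⟩
  rw [← Padic.norm_intCast_lt_one_iff (p := l)]
  have e : (((n : ℤ) ^ 2 - r : ℤ) : ℚ_[l]) =
      -((x / w - n) * (x / w + n)) + -(s * l * y ^ 2 / w ^ 2) := by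
    push_cast
    field_simp
    linear_combination -h
  rw [e]
  refine lt_of_le_of_lt (Padic.nonarchimedean _ _) (max_lt ?_ ?_)
  · rw [norm_neg, norm_mul]
    refine mul_lt_one_of_nonneg_of_lt_one_left (norm_nonneg _) hn' ?_
    exact (Padic.nonarchimedean _ _).trans (max_le hu (by exact_mod_cast Padic.norm_int_le_one n))
  · rw [norm_neg, norm_div, nsy, norm_pow, div_lt_one (by positivity)]
    exact hlt.1

open Polynomial in
theorem padic_exists_sqrt {l : ℕ} [Fact l.Prime] (hl : l ≠ 2) {n : ℤ} (hn : ¬ (l : ℤ) ∣ n)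
    (h : ∃ t : ℤ, (l : ℤ) ∣ t ^ 2 - n) : ∃ z : ℚ_[l], z ^ 2 = n := by
  obtain ⟨t, ht⟩ := h
  have hp := Nat.prime_iff_prime_int.1 (Fact.out : l.Prime)
  have h2 : ¬ (l : ℤ) ∣ 2 * t := fun hd => by
    rcases hp.dvd_or_dvd hd with hd | hd
    · exact hl ((Nat.prime_dvd_prime_iff_eq Fact.out Nat.prime_two).1 (by exact_mod_cast hd))
    · exact hn (by simpa using dvd_sub (dvd_pow hd two_ne_zero) ht)
  have h3 : ‖((2 * t : ℤ) : ℤ_[l])‖ = 1 := le_antisymm (PadicInt.norm_le_one _)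
    (not_lt.1 fun hlt => h2 ((PadicInt.norm_int_lt_one_iff_dvd _).1 hlt))
  have h4 := (PadicInt.norm_int_lt_one_iff_dvd _).2 ht
  push_cast at h3 h4
  obtain ⟨z, hz, -⟩ := hensels_lemma (p := l) (R := ℤ_[l]) (F := X ^ 2 - C (n : ℤ_[l])) (a := (t : ℤ_[l]))
    (by simpa [one_add_one_eq_two, ← norm_mul, h3] using h4)
  refine ⟨z, ?_⟩
  have : z ^ 2 = n := by simpa [sub_eq_zero] using hz
  exact_mod_cast congrArg Subtype.val this

theorem not_sq_of_legendre {l : ℕ} [Fact l.Prime] {r : ℤ} (h : legendreSym l r = -1) :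
    ¬∃ t : ℤ, (l : ℤ) ∣ t ^ 2 - r := by
  rintro ⟨t, ht⟩
  rw [legendreSym.eq_neg_one_iff] at h
  apply h
  refine ⟨t, ?_⟩
  have := (ZMod.intCast_zmod_eq_zero_iff_dvd _ l).2 ht
  push_cast at this
  linear_combination -this

theorem sq_of_legendre {l : ℕ} [Fact l.Prime] {r : ℤ} (h : legendreSym l r = 1) :
    ∃ t : ℤ, (l : ℤ) ∣ t ^ 2 - r := by
  have h0 : (r : ZMod l) ≠ 0 := fun h0 => by
    rw [(legendreSym.eq_zero_iff l r).2 h0] at h; norm_num at h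
  obtain ⟨t, ht⟩ := (legendreSym.eq_one_iff l h0).1 h
  obtain ⟨t, rfl⟩ := ZMod.intCast_surjective t
  refine ⟨t, (ZMod.intCast_zmod_eq_zero_iff_dvd _ l).1 ?_⟩
  push_cast
  rw [ht]; ring

theorem legendre_of_sq {l : ℕ} [Fact l.Prime] {r : ℤ} (hr : ¬ (l : ℤ) ∣ r)
    (h : ∃ t : ℤ, (l : ℤ) ∣ t ^ 2 - r) : legendreSym l r = 1 := by
  obtain ⟨t, ht⟩ := h
  have h0 : (r : ZMod l) ≠ 0 := fun h0 => hr ((ZMod.intCast_zmod_eq_zero_iff_dvd _ l).1 h0)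
  refine (legendreSym.eq_one_iff l h0).2 ⟨t, ?_⟩
  have := (ZMod.intCast_zmod_eq_zero_iff_dvd _ l).2 ht
  push_cast at this
  linear_combination -this

variable {p q : ℕ} {a b c : ℂ} (h : Setup p q a b c)
include h

theorem Setup.p_ne_two : p ≠ 2 := fun e => by have := h.p8; lia
theorem Setup.q_ne_two : q ≠ 2 := fun e => by have := h.q8; lia
theorem Setup.q_not_dvd_p : ¬ (q : ℤ) ∣ p := fun hd =>
  h.ne ((Nat.prime_dvd_prime_iff_eq h.qp h.pp).1 (by exact_mod_cast hd)).symm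
theorem Setup.p_not_dvd_q : ¬ (p : ℤ) ∣ q := fun hd =>
  h.ne ((Nat.prime_dvd_prime_iff_eq h.pp h.qp).1 (by exact_mod_cast hd))

theorem Setup.neg_one_q : ¬∃ t : ℤ, (q : ℤ) ∣ t ^ 2 - (-1 : ℤ) := by
  have := Fact.mk h.qp
  apply not_sq_of_legendre
  rw [legendreSym.at_neg_one h.q_ne_two, ZMod.χ₄_nat_three_mod_four (by have := h.q8; lia)]

theorem Setup.two_q : ¬∃ t : ℤ, (q : ℤ) ∣ t ^ 2 - (2 : ℤ) := by
  have := Fact.mk h.qp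
  apply not_sq_of_legendre
  rw [legendreSym.at_two h.q_ne_two, ZMod.χ₈_nat_eq_if_mod_eight]
  have := h.q8
  simp [this]; lia

theorem Setup.neg_two_q : ∃ t : ℤ, (q : ℤ) ∣ t ^ 2 - (-2 : ℤ) := by
  have := Fact.mk h.qp
  apply sq_of_legendre
  rw [legendreSym.at_neg_two h.q_ne_two, ZMod.χ₈'_nat_eq_if_mod_eight]
  have := h.q8
  simp [this]; lia

theorem Setup.legendre_two_p : haveI := Fact.mk h.pp; legendreSym p 2 = -1 := by
  have := Fact.mk h.pp
  rw [legendreSym.at_two h.p_ne_two, ZMod.χ₈_nat_eq_if_mod_eight]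
  have := h.p8
  simp [this]; lia

theorem Setup.two_p : ¬∃ t : ℤ, (p : ℤ) ∣ t ^ 2 - (2 : ℤ) := by
  have := Fact.mk h.pp
  exact not_sq_of_legendre h.legendre_two_p

theorem Setup.two_q_p : ¬∃ t : ℤ, (p : ℤ) ∣ t ^ 2 - (2 * q : ℤ) := by
  have := Fact.mk h.pp
  have := Fact.mk h.qp
  apply not_sq_of_legendre
  rw [legendreSym.mul, h.legendre_two_p, ← legendreSym.quadratic_reciprocity_one_mod_four
    (by have := h.p8; lia) h.q_ne_two, legendre_of_sq h.q_not_dvd_p h.leg]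
  rfl

end

section
variable {X K : Type*} [Field X] [NumberField X] [Field K] [NumberField K] {φ : X →+* K} {σ : K →+* K}

theorem card_le_of_lt {S : Finset (Ideal (𝓞 K))} {l e f t : ℕ} (hl : l.Prime)
    (hS : ∀ P ∈ S, P.IsPrime ∧ (l : 𝓞 K) ∈ P ^ e ∧ l ^ f ∣ Ideal.absNorm P) (he : e ≠ 0)
    (h : finrank ℚ K < f * e * (t + 1)) : S.card ≤ t := by
  have : Fact l.Prime := ⟨hl⟩
  have h1 := (card_mul_le S hS he).trans_lt h
  exact Nat.lt_succ_iff.1 (Nat.lt_of_mul_lt_mul_left h1)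

theorem index_dvd_of_prime (h : QuadInv φ σ) {l e f t : ℕ} (hl : l.Prime) (he : e ≠ 0)
    (ht : finrank ℚ K < f * e * (t + 1))
    (hP : ∀ P : Ideal (𝓞 K), P.IsPrime → (∀ α, RingOfIntegers.mapRingHom σ α - α ∈ P) →
      (l : 𝓞 K) ∈ P ^ e ∧ l ^ f ∣ Ideal.absNorm P) :
    (extI φ).range.relIndex (df (extI σ)).ker ∣ 2 ^ t := by
  classical
  set S := (primesAbove K l).filter fun P => ∀ α, RingOfIntegers.mapRingHom σ α - α ∈ P
  refine index_dvd_two_pow h S ?_ (card_le_of_lt hl (e := e) (f := f) ?_ he ht)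
  · intro P _ hp hα
    refine Finset.mem_filter.2 ⟨(mem_primesAbove hl.ne_zero).2 ⟨hp, ?_⟩, hα⟩
    exact Ideal.pow_le_self he (hP P hp hα).1
  · intro P hPS
    obtain ⟨h1, h2⟩ := Finset.mem_filter.1 hPS
    have := ((mem_primesAbove hl.ne_zero).1 h1).1
    exact ⟨this, hP P this h2⟩

theorem index_dvd_of_two_primes (h : QuadInv φ σ) {l e f t m e' f' t' : ℕ} (hl : l.Prime)
    (hm : m.Prime) (he : e ≠ 0) (he' : e' ≠ 0)
    (ht : finrank ℚ K < f * e * (t + 1)) (ht' : finrank ℚ K < f' * e' * (t' + 1))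
    (hP : ∀ P : Ideal (𝓞 K), P.IsPrime → (∀ α, RingOfIntegers.mapRingHom σ α - α ∈ P) →
      ((l : 𝓞 K) ∈ P ^ e ∧ l ^ f ∣ Ideal.absNorm P) ∨
      ((m : 𝓞 K) ∈ P ^ e' ∧ m ^ f' ∣ Ideal.absNorm P)) :
    (extI φ).range.relIndex (df (extI σ)).ker ∣ 2 ^ (t + t') := by
  classical
  set S := (primesAbove K l).filter fun P => (l : 𝓞 K) ∈ P ^ e ∧ l ^ f ∣ Ideal.absNorm P
  set S' := (primesAbove K m).filter fun P => (m : 𝓞 K) ∈ P ^ e' ∧ m ^ f' ∣ Ideal.absNorm P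
  refine index_dvd_two_pow h (S ∪ S') ?_ ((Finset.card_union_le _ _).trans
    (Nat.add_le_add (card_le_of_lt hl (e := e) (f := f) ?_ he ht)
      (card_le_of_lt hm (e := e') (f := f') ?_ he' ht')))
  · intro P _ hp hα
    rcases hP P hp hα with h1 | h1
    · exact Finset.mem_union_left _ (Finset.mem_filter.2 ⟨(mem_primesAbove hl.ne_zero).2
        ⟨hp, Ideal.pow_le_self he h1.1⟩, h1⟩)
    · exact Finset.mem_union_right _ (Finset.mem_filter.2 ⟨(mem_primesAbove hm.ne_zero).2
        ⟨hp, Ideal.pow_le_self he' h1.1⟩, h1⟩)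
  · intro P hPS
    obtain ⟨h1, h2⟩ := Finset.mem_filter.1 hPS
    exact ⟨((mem_primesAbove hl.ne_zero).1 h1).1, h2⟩
  · intro P hPS
    obtain ⟨h1, h2⟩ := Finset.mem_filter.1 hPS
    exact ⟨((mem_primesAbove hm.ne_zero).1 h1).1, h2⟩

end

section
variable {X K : IntermediateField ℚ ℂ} {s : ℂ}

theorem isIntegral_of_quad {z : ℂ} (t n : ℤ) (h : z ^ 2 = t * z + n) : IsIntegral ℤ z := by
  refine ⟨Polynomial.X ^ 2 - Polynomial.C t * Polynomial.X - Polynomial.C n, by monicity!, ?_⟩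
  simp only [Polynomial.eval₂_sub, Polynomial.eval₂_mul, Polynomial.eval₂_pow, Polynomial.eval₂_X,
    Polynomial.eval₂_C, h]
  simp

theorem exists_int {z : ℂ} (hz : z ∈ K) (hi : IsIntegral ℤ z) : ∃ x : 𝓞 K, ((x : K) : ℂ) = z := by
  have h1 : IsIntegral ℤ (⟨z, hz⟩ : K) :=
    (isIntegral_algHom_iff (K.val.restrictScalars ℤ) Subtype.val_injective).1 hi
  exact ⟨⟨_, h1⟩, rfl⟩

theorem oext {x y : 𝓞 K} (h : ((x : K) : ℂ) = ((y : K) : ℂ)) : x = y :=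
  RingOfIntegers.ext (Subtype.ext h)

theorem IsQuad.coe_conj (h : IsQuad X K s) {x : K} {a b : ℂ} (ha : a ∈ X) (hb : b ∈ X)
    (e : (x : ℂ) = a + b * s) : (h.conj x : ℂ) = a - b * s := by
  obtain ⟨a', b', e1, e2⟩ := h.eq_coords x
  obtain ⟨rfl, rfl⟩ := h.uniq a'.2 b'.2 ha hb
    ((congrArg Subtype.val e1).symm.trans e)
  exact congrArg Subtype.val e2

theorem coe_mapRingHom (σ : K →+* K) (x : 𝓞 K) :
    ((RingOfIntegers.mapRingHom σ x : 𝓞 K) : K) = σ x := rfl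

@[push_cast] theorem coe_ofNat_int (n : ℕ) [n.AtLeastTwo] :
    ((ofNat(n) : 𝓞 K) : K) = ofNat(n) := rfl

@[push_cast] theorem coe_intCast_int (n : ℤ) : ((n : 𝓞 K) : K) = n := rfl

@[push_cast] theorem coe_ofNat_field (n : ℕ) [n.AtLeastTwo] :
    ((ofNat(n) : K) : ℂ) = ofNat(n) := rfl

/-- Elements `x = a + b s` of `𝓞 K` have `2 b s` in every ramified prime. -/
theorem IsQuad.ramified_mem (h : IsQuad X K s) {P : Ideal (𝓞 K)}
    (hα : ∀ α, RingOfIntegers.mapRingHom h.conj α - α ∈ P) {x y : 𝓞 K} {a b : ℂ} (ha : a ∈ X)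
    (hb : b ∈ X) (e : ((x : K) : ℂ) = a + b * s) (hy : ((y : K) : ℂ) = 2 * b * s) : y ∈ P := by
  have : y = -(RingOfIntegers.mapRingHom h.conj x - x) := oext (by
    have := h.coe_conj ha hb e
    rw [← coe_mapRingHom] at this
    push_cast
    rw [hy, this, e]
    ring)
  rw [this]
  exact P.neg_mem (hα x)

theorem sq_mem_of_mem {P : Ideal (𝓞 K)} {x : 𝓞 K} (hx : x ∈ P) {n : ℕ} 
    (e : ((x : K) : ℂ) ^ 2 = n ∨ ((x : K) : ℂ) ^ 2 = -n) : (n : 𝓞 K) ∈ P ^ 2 := by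
  have h1 : x ^ 2 ∈ P ^ 2 := Ideal.pow_mem_pow hx 2
  rcases e with e | e
  · have : (n : 𝓞 K) = x ^ 2 := oext (by push_cast; simpa using e.symm)
    rwa [this]
  · have : (n : 𝓞 K) = -x ^ 2 := oext (by simp [e])
    rw [this]
    exact (P ^ 2).neg_mem h1

end

section

variable {p q : ℕ} {a b c : ℂ} (h : Setup p q a b c) {X : IntermediateField ℚ ℂ} [NumberField X]
include h

theorem Setup.exists_half_a (ha : a ∈ X) : ∃ w : 𝓞 X, ((w : X) : ℂ) = (1 + a) / 2 ∧
    ∃ m : ℤ, Odd m ∧ w ^ 2 - w - m = 0 := by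
  obtain ⟨m, hm⟩ : ∃ m : ℤ, (p : ℤ) = 8 * m + 5 := ⟨p / 8, by have := h.p8; lia⟩
  have e : ((1 + a) / 2) ^ 2 = ((1 : ℤ) : ℂ) * ((1 + a) / 2) + ((2 * m + 1 : ℤ) : ℂ) := by
    have : (p : ℂ) = 8 * m + 5 := by exact_mod_cast hm
    push_cast
    linear_combination (1 / 4 : ℂ) * h.a2 + (1 / 4 : ℂ) * this
  obtain ⟨w, hw⟩ := exists_int (div_mem (add_mem (one_mem X) ha) (ofNat_mem X 2))
    (isIntegral_of_quad _ _ e)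
  refine ⟨w, hw, _, odd_two_mul_add_one m, oext ?_⟩
  push_cast
  rw [hw]
  push_cast at e
  linear_combination e

theorem Setup.exists_half_cI (hc : c * I ∈ X) : ∃ w : 𝓞 X, ((w : X) : ℂ) = (1 + c * I) / 2 := by
  obtain ⟨m, hm⟩ : ∃ m : ℤ, (q : ℤ) = 4 * m - 1 := ⟨(q + 1) / 4, by have := h.q8; lia⟩
  have e : ((1 + c * I) / 2) ^ 2 = ((1 : ℤ) : ℂ) * ((1 + c * I) / 2) + ((-m : ℤ) : ℂ) := by
    have : (q : ℂ) = 4 * m - 1 := by exact_mod_cast hm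
    push_cast
    linear_combination (1 / 4 : ℂ) * h.cI2 - (1 / 4 : ℂ) * this
  exact exists_int (div_mem (add_mem (one_mem X) hc) (ofNat_mem X 2))
    (isIntegral_of_quad _ _ e)

theorem Setup.exists_half_acI (hk : a * c * I ∈ X) :
    ∃ w : 𝓞 X, ((w : X) : ℂ) = (1 + a * c * I) / 2 ∧
    ∃ m : ℤ, w ^ 2 - w + 2 * m = 0 ∧ (p * q : ℤ) + 1 = 8 * m := by
  obtain ⟨m, hm⟩ : ∃ m : ℤ, (p * q : ℤ) + 1 = 8 * m := by
    have h1 : (p * q) % 8 = 7 := by rw [Nat.mul_mod, h.p8, h.q8]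
    exact ⟨(p * q + 1) / 8, by lia⟩
  have e : ((1 + a * c * I) / 2) ^ 2 = ((1 : ℤ) : ℂ) * ((1 + a * c * I) / 2)
      + ((-(2 * m) : ℤ) : ℂ) := by
    have : (p * q : ℂ) + 1 = 8 * m := by exact_mod_cast hm
    have e2 := h.acI2
    push_cast at e2 ⊢
    linear_combination (1 / 4 : ℂ) * e2 - (1 / 4 : ℂ) * this
  obtain ⟨w, hw⟩ := exists_int (div_mem (add_mem (one_mem X) hk) (ofNat_mem X 2))
    (isIntegral_of_quad _ _ e)
  refine ⟨w, hw, m, oext ?_, hm⟩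
  push_cast
  rw [hw]
  push_cast at e
  linear_combination e

theorem Setup.four_dvd (ha : a ∈ X) {P : Ideal (𝓞 X)} [P.IsPrime] (h2 : ((2 : ℕ) : 𝓞 X) ∈ P) :
    2 ^ 2 ∣ Ideal.absNorm P := by
  obtain ⟨w, -, m, hm, e⟩ := h.exists_half_a ha
  have : Fact (Nat.Prime 2) := ⟨Nat.prime_two⟩
  exact sq_dvd_absNorm h2 (odd_of_two (by exact_mod_cast h2) hm e)

omit h in
theorem exists_sqrt_int {z : ℂ} (hz : z ∈ X) (n : ℤ) (e : z ^ 2 = n) :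
    ∃ x : 𝓞 X, ((x : X) : ℂ) = z :=
  exists_int hz (isIntegral_of_quad 0 n (by simpa using e))

omit h in
theorem dvd_absNorm_pow {P : Ideal (𝓞 X)} [P.IsPrime] {l : ℕ} (hl : l.Prime)
    (h : (l : 𝓞 X) ∈ P ^ 2) : l ^ 1 ∣ Ideal.absNorm P := by
  have : Fact l.Prime := ⟨hl⟩
  obtain ⟨j, hj, hj1⟩ := dvd_absNorm (Ideal.pow_le_self two_ne_zero h)
  rw [hj]
  exact pow_dvd_pow _ hj1

theorem Setup.index_R :
    (extI (incl h.isQuadR.le)).range.relIndex (df (extI h.isQuadR.conj)).ker ∣ 2 ^ 1 := by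
  refine index_dvd_of_prime h.isQuadR.quadInv h.pp (e := 2) (f := 1) (by decide)
    (by rw [h.finrank_R]; decide) fun P hP hα => ?_
  obtain ⟨w, hw, -⟩ := h.exists_half_a h.a_mem_R
  obtain ⟨x, hx⟩ := exists_sqrt_int h.a_mem_R p (by rw [h.a2]; simp)
  have h1 := h.isQuadR.ramified_mem hα (x := w) (y := x) (a := 1 / 2) (b := 1 / 2)
    (div_mem (one_mem _) (ofNat_mem _ 2)) (div_mem (one_mem _) (ofNat_mem _ 2))
    (by rw [hw]; ring) (by rw [hx]; ring)
  have h2 := sq_mem_of_mem h1 (n := p) (Or.inl (by rw [hx, h.a2]))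
  exact ⟨h2, dvd_absNorm_pow h.pp h2⟩

theorem Setup.index_k :
    (extI (incl h.isQuadk.le)).range.relIndex (df (extI h.isQuadk.conj)).ker ∣ 2 ^ (1 + 1) := by
  refine index_dvd_of_two_primes h.isQuadk.quadInv h.pp h.qp (e := 2) (f := 1) (e' := 2) (f' := 1)
    (by decide) (by decide)
    (by rw [h.finrank_k]; decide) (by rw [h.finrank_k]; decide) fun P hP hα => ?_
  obtain ⟨w, hw, -⟩ := h.exists_half_acI h.acI_mem_k
  obtain ⟨x, hx⟩ := exists_sqrt_int h.acI_mem_k (-(p * q : ℕ)) (by rw [h.acI2]; simp)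
  have h1 := h.isQuadk.ramified_mem hα (x := w) (y := x) (a := 1 / 2) (b := 1 / 2)
    (div_mem (one_mem _) (ofNat_mem _ 2)) (div_mem (one_mem _) (ofNat_mem _ 2))
    (by rw [hw]; ring) (by rw [hx]; ring)
  have h2 := sq_mem_of_mem h1 (n := p * q) (Or.inr (by rw [hx, h.acI2]))
  have hco : IsCoprime ((p : 𝓞 h.k) ^ 2) ((q : 𝓞 h.k) ^ 2) := by
    have := (Nat.isCoprime_iff_coprime.2 ((Nat.coprime_primes h.pp h.qp).2 h.ne)).map
      (Int.castRingHom (𝓞 h.k))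
    simpa using this.pow (m := 2) (n := 2)
  have h3 : (p : 𝓞 h.k) * q ∈ P := by exact_mod_cast Ideal.pow_le_self two_ne_zero h2

  have key : ∀ l m : ℕ, IsCoprime ((l : 𝓞 h.k) ^ 2) ((m : 𝓞 h.k) ^ 2) → (l : 𝓞 h.k) ∈ P →
      (l * m : 𝓞 h.k) ∈ P ^ 2 → (l : 𝓞 h.k) ∈ P ^ 2 := by
    rintro l m ⟨u, v, e⟩ hl hlm
    have : (l : 𝓞 h.k) = (u * l) * l ^ 2 + (v * m) * (l * m) := by
      linear_combination (-(l : 𝓞 h.k)) * e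
    rw [this]
    exact (P ^ 2).add_mem ((P ^ 2).mul_mem_left _ (Ideal.pow_mem_pow hl 2))
      ((P ^ 2).mul_mem_left _ hlm)
  push_cast at h2
  rcases hP.mem_or_mem h3 with h4 | h4
  · have := key p q hco h4 h2
    exact Or.inl ⟨this, dvd_absNorm_pow h.pp this⟩
  · have := key q p hco.symm h4 (by rwa [mul_comm])
    exact Or.inr ⟨this, dvd_absNorm_pow h.qp this⟩

theorem Setup.index_Y :
    (extI (incl h.isQuadY.le)).range.relIndex (df (extI h.isQuadY.conj)).ker ∣ 2 ^ 1 := by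
  refine index_dvd_of_prime h.isQuadY.quadInv Nat.prime_two (e := 2) (f := 2) (by decide)
    (by rw [h.finrank_Y]; decide) fun P hP hα => ?_
  obtain ⟨x, hx⟩ := exists_sqrt_int h.bI_mem_Y (-2) (by rw [h.bI2]; simp)
  have h1 := h.isQuadY.ramified_mem hα (x := x) (y := 2 * x) (a := 0) (b := 1)
    (zero_mem _) (one_mem _) (by rw [hx]; ring) (by push_cast; rw [hx]; ring)
  have h0 : x ∈ P := by
    have h5 : (2 : 𝓞 h.Y) = - x ^ 2 := oext (by push_cast; rw [hx, h.bI2]; simp)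
    rcases hP.mem_or_mem h1 with h4 | h4
    · rw [h5] at h4
      exact hP.mem_of_pow_mem 2 (by simpa using h4)
    · exact h4
  have h2 := sq_mem_of_mem h0 (n := 2) (Or.inr (by rw [hx, h.bI2]))
  exact ⟨h2, h.four_dvd h.a_mem_Y (Ideal.pow_le_self two_ne_zero h2)⟩

theorem Setup.index_K :
    (extI (incl h.isQuadK.le)).range.relIndex (df (extI h.isQuadK.conj)).ker ∣ 2 ^ 4 := by
  refine index_dvd_of_prime h.isQuadK.quadInv h.qp (e := 2) (f := 2) (by decide)
    (by rw [h.finrank_K]; decide) fun P hP hα => ?_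
  obtain ⟨w, hw⟩ := h.exists_half_cI h.cI_mem_K
  obtain ⟨x, hx⟩ := exists_sqrt_int h.cI_mem_K (-q) (by rw [h.cI2]; simp)
  obtain ⟨i, hi⟩ := exists_sqrt_int h.I_mem_K (-1) (by simp)
  have h1 := h.isQuadK.ramified_mem hα (x := w) (y := x) (a := 1 / 2) (b := 1 / 2)
    (div_mem (one_mem _) (ofNat_mem _ 2)) (div_mem (one_mem _) (ofNat_mem _ 2))
    (by rw [hw]; ring) (by rw [hx]; ring)
  have h2 := sq_mem_of_mem h1 (n := q) (Or.inr (by rw [hx, h.cI2]))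
  have : Fact q.Prime := ⟨h.qp⟩
  have h3 := Ideal.pow_le_self two_ne_zero h2
  exact ⟨h2, sq_dvd_absNorm h3 (sub_notMem_of_sq_eq_neg_one (by have := h.q8; lia) h3
    (w := i) (oext (by push_cast; rw [hi]; simp)))⟩

theorem Setup.index_A :
    (extI (incl h.isQuadA.le)).range.relIndex (df (extI h.isQuadA.conj)).ker ∣ 2 ^ 1 := by
  refine index_dvd_of_prime h.isQuadA.quadInv Nat.prime_two (e := 4) (f := 2) (by decide)
    (by rw [h.finrank_A]; decide) fun P hP hα => ?_
  obtain ⟨x, hx⟩ := exists_sqrt_int h.I_mem_A (-1) (by simp)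
  obtain ⟨s, hs⟩ := exists_sqrt_int h.b_mem_A 2 (by rw [h.b2]; simp)
  have h1 := h.isQuadA.ramified_mem hα (x := x) (y := 2 * x) (a := 0) (b := 1)
    (zero_mem _) (one_mem _) (by rw [hx]; ring) (by push_cast; rw [hx]; ring)
  have hx2 : x ^ 2 = -1 := oext (by push_cast; rw [hx]; simp)
  have hs2 : s ^ 2 = 2 := oext (by push_cast; rw [hs, h.b2])
  have h2 : (2 : 𝓞 h.A) ∈ P := by
    have : (2 : 𝓞 h.A) = -x * (2 * x) := by linear_combination 2 * hx2
    rw [this]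
    exact P.mul_mem_left _ h1
  obtain ⟨z, hz⟩ : ∃ z : 𝓞 h.A, ((z : h.A) : ℂ) = 1 - (1 + I) * b / 2 := by
    have hm : (1 + I) * b / 2 ∈ h.A := div_mem (mul_mem (add_mem (one_mem _) h.I_mem_A) h.b_mem_A)
      (ofNat_mem _ 2)
    refine exists_int (sub_mem (one_mem _) hm) (isIntegral_one.sub ?_)
    refine IsIntegral.of_pow (n := 2) two_pos (IsIntegral.of_pow (n := 2) two_pos ?_)
    have : (((1 + I) * b / 2) ^ 2) ^ 2 = -1 := by
      have h1 : ((1 + I) * b / 2) ^ 2 = I := by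
        linear_combination ((1 + I) ^ 2 / 4) * h.b2 + (1 / 2 : ℂ) * I_sq
      rw [h1, I_sq]
    rw [this]
    exact isIntegral_one.neg
  have hz4 : z ^ 4 = x * (6 - 4 * s) := oext (by
    push_cast
    rw [hz, hx, hs]
    have h1 : ((1 + I) * b / 2) ^ 2 = I := by
      linear_combination ((1 + I) ^ 2 / 4) * h.b2 + (1 / 2 : ℂ) * I_sq
    linear_combination (6 - 4 * ((1 + I) * b / 2) + ((1 + I) * b / 2) ^ 2 + I) * h1
      + (1 - 2 * b) * I_sq)
  have hzP : z ∈ P := hP.mem_of_pow_mem 4 (by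
    rw [hz4, show x * (6 - 4 * s) = x * (3 - 2 * s) * 2 by ring]
    exact P.mul_mem_left _ h2)
  have hz2 : (2 : 𝓞 h.A) = z ^ 4 * (-x * (3 + 2 * s)) := by
    rw [hz4]
    linear_combination (18 - 8 * s ^ 2) * hx2 + 8 * hs2
  have h24 : ((2 : ℕ) : 𝓞 h.A) ∈ P ^ 4 := by
    push_cast
    rw [hz2]
    exact Ideal.mul_mem_right _ _ (Ideal.pow_mem_pow hzP 4)
  exact ⟨h24, h.four_dvd h.a_mem_A (by exact_mod_cast h2)⟩

theorem Setup.index_S :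
    (extI (incl h.isQuadS.le)).range.relIndex (df (extI h.isQuadS.conj)).ker ∣ 2 ^ (1 + 2) := by
  refine index_dvd_of_two_primes h.isQuadS.quadInv Nat.prime_two h.qp
    (e := 2) (f := 2) (e' := 2) (f' := 1)
    (by decide) (by decide)
    (by rw [h.finrank_S]; decide) (by rw [h.finrank_S]; decide) fun P hP hα => ?_
  obtain ⟨x, hx⟩ := exists_sqrt_int h.c_mem_S q (by rw [h.c2]; simp)
  have h1 := h.isQuadS.ramified_mem hα (x := x) (y := 2 * x) (a := 0) (b := 1)
    (zero_mem _) (one_mem _) (by rw [hx]; ring) (by push_cast; rw [hx]; ring)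
  have hx2 : x ^ 2 = q := oext (by push_cast; rw [hx, h.c2])
  rcases hP.mem_or_mem h1 with h4 | h4
  · left
    obtain ⟨m, hm⟩ : ∃ m : ℕ, q = 8 * m + 3 := ⟨q / 8, by have := h.q8; lia⟩
    have hx2 : x ^ 2 = 8 * m + 3 := by rw [hx2]; exact_mod_cast congrArg (Nat.cast (R := 𝓞 h.S)) hm
    have e3 : (1 + x) ^ 2 = 2 * (4 * m + 2 + x) := by
      linear_combination hx2
    have h1x : 1 + x ∈ P := hP.mem_of_pow_mem 2 (by rw [e3]; exact P.mul_mem_right _ h4)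
    have h5 : 2 * (4 * m + 2 + x) ∈ P ^ 2 := by rw [← e3]; exact Ideal.pow_mem_pow h1x 2
    have h22 : (4 : 𝓞 h.S) ∈ P ^ 2 := by
      have := Ideal.pow_mem_pow h4 2
      rwa [show (2 : 𝓞 h.S) ^ 2 = 4 by norm_num] at this
    have h6 : ((2 : ℕ) : 𝓞 h.S) ∈ P ^ 2 := by
      have e : ((2 : ℕ) : 𝓞 h.S) = 2 * (4 * m + 2 + x) * (4 * m + 2 - x)
          + 4 * (-8 * m ^ 2 - 4 * m) := by
        push_cast
        linear_combination 2 * hx2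
      rw [e]
      exact (P ^ 2).add_mem (Ideal.mul_mem_right _ _ h5) (Ideal.mul_mem_right _ _ h22)
    exact ⟨h6, h.four_dvd h.a_mem_S (by exact_mod_cast h4)⟩
  · right
    have h2 := sq_mem_of_mem h4 (n := q) (Or.inl (by rw [hx, h.c2]))
    exact ⟨h2, dvd_absNorm_pow h.qp h2⟩

end

section

theorem neg_one_mem_ker (X : Type*) [Field X] [NumberField X] : (-1 : Xˣ) ∈ (prin X).ker :=
  mem_prin_ker.2 ⟨by simpa using isIntegral_one.neg, by simpa using isIntegral_one.neg⟩

/-- The embedding of `ℚ` into a field of characteristic zero. -/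
noncomputable def homQ0 (F : Type*) [Field F] [CharZero F] : Q0 →+* F :=
  ((algebraMap ℚ F).comp (IntermediateField.botEquiv ℚ ℂ).toRingEquiv.toRingHom).comp
    (IntermediateField.equivOfEq (IntermediateField.adjoin_empty ℚ ℂ)).toRingEquiv.toRingHom

theorem no_form {Y F : Type*} [CommRing Y] [Field F] (f g : Y →+* F) {n : ℤ}
    (hF : ∀ x y : F, -1 ≠ x ^ 2 + n * y ^ 2) {u : Y} (hu : f u * g u = -1) :
    ¬∃ a b : Y, u = a ^ 2 + n * b ^ 2 := by
  rintro ⟨a, b, rfl⟩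
  apply hF (f a * g a - n * f b * g b) (f a * g b + f b * g a)
  rw [← hu]
  simp only [map_add, map_mul, map_pow, map_intCast]
  ring

theorem no_form_neg_one {Y F : Type*} [CommRing Y] [Field F] (f : Y →+* F) {n : ℤ}
    (hF : ∀ x y : F, -1 ≠ x ^ 2 + n * y ^ 2) : ¬∃ a b : Y, -1 = a ^ 2 + n * b ^ 2 := by
  rintro ⟨a, b, e⟩
  apply hF (f a) (f b)
  simpa using congrArg f e

theorem real_form (n : ℕ) (x y : ℝ) : -1 ≠ x ^ 2 + ((n : ℤ) : ℝ) * y ^ 2 := by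
  intro e
  push_cast at e
  have : 0 ≤ (n : ℝ) * y ^ 2 := by positivity
  nlinarith [sq_nonneg x]

section
variable {X K : IntermediateField ℚ ℂ} {s : ℂ}

theorem IsQuad.isNm_iff_form (h : IsQuad X K s) {n : ℤ} (hn : s ^ 2 = -n) (u : X) :
    IsNm (incl h.le) h.conj u ↔ ∃ a b : X, u = a ^ 2 + n * b ^ 2 := by
  rw [h.isNm_iff]
  have : (⟨s ^ 2, h.sq_mem⟩ : X) = -n := Subtype.ext (by simp [hn])
  rw [this]
  simp only [neg_mul, sub_neg_eq_add, mul_comm]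

end

variable {p q : ℕ} {a b c : ℂ} (h : Setup p q a b c)
include h

theorem Setup.odd_R : Odd (Nat.card (ClassGroup (𝓞 h.R))) := by
  apply odd_class_of_card_le
  have := card_two_torsion_dvd h.isQuadR.quadInv
    (by rw [odd_class_of_finrank_one finrank_Q0]; exact odd_one) h.index_R
  rw [h.rank_R, rank_Q0] at this
  have := Nat.le_of_dvd (by positivity) this
  lia

theorem Setup.exists_eps : ∃ e ∈ (prin h.R).ker, (e : h.R) * h.isQuadR.conj e = -1 := by
  obtain ⟨y, hy, e⟩ := unit_norm_of_rank h.isQuadR.quadInv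
    (by rw [odd_class_of_finrank_one finrank_Q0]; exact odd_one) h.index_R
    (by rw [h.rank_R, rank_Q0]) (neg_one_mem_ker _)
  exact ⟨y, hy, by rw [e]; simp⟩

theorem Setup.exists_hom_R [Fact q.Prime] : Nonempty (h.R →+* ℚ_[q]) := by
  obtain ⟨z, hz⟩ := padic_exists_sqrt h.q_ne_two h.q_not_dvd_p h.leg
  obtain ⟨f, -⟩ := h.isQuadR.exists_lift (homQ0 ℚ_[q]) z (by
    have : (⟨a ^ 2, h.isQuadR.sq_mem⟩ : Q0) = (p : ℤ) := Subtype.ext (by simp [h.a2])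
    rw [hz, this, map_intCast])
  exact ⟨f⟩

theorem Setup.exists_hom_Y [Fact q.Prime] (f : h.R →+* ℚ_[q]) :
    ∃ g : h.Y →+* ℚ_[q], ∀ x, g (incl h.isQuadY.le x) = f x := by
  obtain ⟨z, hz⟩ := padic_exists_sqrt h.q_ne_two (n := -2) (fun hd => by
    have := (Nat.prime_dvd_prime_iff_eq h.qp Nat.prime_two).1
      (by exact_mod_cast (Int.dvd_neg.1 hd))
    exact h.q_ne_two this) h.neg_two_q
  obtain ⟨g, hg, -⟩ := h.isQuadY.exists_lift f z (by
    have : (⟨(b * I) ^ 2, h.isQuadY.sq_mem⟩ : h.R) = (-2 : ℤ) := Subtype.ext (h.bI2.trans (by push_cast; rfl))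
    rw [hz, this, map_intCast])
  exact ⟨g, hg⟩

theorem Setup.padic_form [Fact q.Prime] (x y : ℚ_[q]) : -1 ≠ x ^ 2 + ((q : ℤ) : ℚ_[q]) * y ^ 2 := by
  intro e
  refine one_ne_zero (padic_form_anisotropic (l := q) h.neg_one_q (s := 1) (w := 1) (x := x)
    (y := y) ?_ ?_)
  · exact fun hd => h.qp.one_lt.ne' (by exact_mod_cast Int.eq_one_of_dvd_one (by positivity) hd)
  · push_cast at e ⊢
    linear_combination e

theorem Setup.padic_form' [Fact q.Prime] (x y : ℚ_[q]) :
    -1 ≠ x ^ 2 + ((-q : ℤ) : ℚ_[q]) * y ^ 2 := by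
  intro e
  refine one_ne_zero (padic_form_anisotropic (l := q) h.neg_one_q (s := -1) (w := 1) (x := x)
    (y := y) ?_ ?_)
  · exact fun hd => h.qp.one_lt.ne' (by
      exact_mod_cast Int.eq_one_of_dvd_one (by positivity) (Int.dvd_neg.1 hd))
  · push_cast at e ⊢
    linear_combination e

/-- The units `-1`, `ε`, `-ε` are not norms from a quadratic extension of `ℚ(√p)` when `-1` is not
represented by the norm form over some completion. -/
theorem Setup.card_of_form {K : IntermediateField ℚ ℂ} [NumberField K] {s : ℂ}
    (hK : IsQuad h.R K s) {n : ℤ} (hn : s ^ 2 = -n) {F : Type*} [Field F] (f : h.R →+* F)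
    (hF : ∀ x y : F, -1 ≠ x ^ 2 + n * y ^ 2) {t : ℕ} 
    (ht : (extI (incl hK.le)).range.relIndex (df (extI hK.conj)).ker ∣ 2 ^ t)
    (hr : t = Units.rank K) : Odd (Nat.card (ClassGroup (𝓞 K))) := by
  apply odd_class_of_card_le
  obtain ⟨e, he, he1⟩ := h.exists_eps
  have h1 := card_two_torsion_of_four hK.quadInv h.odd_R ht (neg_one_mem_ker _) he
    (by rw [hK.isNm_iff_form hn, Units.val_neg, Units.val_one]; exact no_form_neg_one f hF)
    (by
      rw [hK.isNm_iff_form hn]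
      exact no_form f (f.comp h.isQuadR.conj) hF (by rw [RingHom.comp_apply, ← map_mul, he1]; simp))
    (by
      rw [hK.isNm_iff_form hn]
      exact no_form f (f.comp h.isQuadR.conj) hF (by
        rw [RingHom.comp_apply, ← map_mul, Units.val_neg, Units.val_one, neg_one_mul, map_neg,
          neg_mul_neg, he1]
        simp))
  rw [h.rank_R, ← hr, pow_add, mul_comm (2 ^ t)] at h1
  have := Nat.le_of_mul_le_mul_right h1 (by positivity)
  lia

theorem Setup.odd_Y : Odd (Nat.card (ClassGroup (𝓞 h.Y))) := by
  obtain ⟨f⟩ := h.allReal_R.exists_real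
  exact h.card_of_form h.isQuadY (n := (2 : ℕ)) (by rw [h.bI2]; simp) f (real_form 2) h.index_Y
    h.rank_Y.symm

theorem Setup.odd_S : Odd (Nat.card (ClassGroup (𝓞 h.S))) := by
  have := Fact.mk h.qp
  obtain ⟨f⟩ := h.exists_hom_R
  exact h.card_of_form h.isQuadS (n := -q) (by rw [h.c2]; simp) f h.padic_form' h.index_S
    h.rank_S.symm

theorem Setup.odd_A : Odd (Nat.card (ClassGroup (𝓞 h.A))) := by
  apply odd_class_of_card_le
  have := card_two_torsion_dvd h.isQuadA.quadInv h.odd_Y h.index_A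
  rw [h.rank_A, h.rank_Y] at this
  have := Nat.le_of_dvd (by positivity) this
  lia

theorem Setup.card_k : Nat.card (powMonoidHom (α := ClassGroup (𝓞 h.k)) 2).ker ≤ 2 := by
  have h1 := card_two_torsion_of_two h.isQuadk.quadInv
    (by rw [odd_class_of_finrank_one finrank_Q0]; exact odd_one) h.index_k (neg_one_mem_ker _)
    (by
      rw [h.isQuadk.isNm_iff_form (n := (p * q : ℕ)) (by rw [h.acI2]; simp), Units.val_neg,
        Units.val_one]
      exact no_form_neg_one (homQ0 ℝ) (real_form (p * q)))
  rw [h.rank_k, rank_Q0] at h1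
  lia

/-- A unit which is a norm from `K` to `A` has a norm to `Y` of the form `x ^ 2 + q y ^ 2`. -/
theorem Setup.form_of_isNm {u : h.A} {v : h.Y} (hu : IsNm (incl h.isQuadK.le) h.isQuadK.conj u)
    (huv : u * h.isQuadA.conj u = incl h.isQuadA.le v) : ∃ x y : h.Y, v = x ^ 2 + (q : ℤ) * y ^ 2 := by
  obtain ⟨x, y, e⟩ := (h.isQuadK.isNm_iff_form (n := q) (by rw [h.cI2]; simp) u).1 hu
  set σ := h.isQuadA.conj with hσ
  have inv : ∀ x, σ (σ x) = x := h.isQuadA.quadInv.invol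
  obtain ⟨x', hx'⟩ := h.isQuadA.quadInv.mem (x * σ x - (q : ℤ) * y * σ y) (by
    simp only [← hσ, map_sub, map_mul, map_intCast, inv]; ring)
  obtain ⟨y', hy'⟩ := h.isQuadA.quadInv.mem (x * σ y + y * σ x) (by
    simp only [← hσ, map_add, map_mul, inv]; ring)
  refine ⟨x', y', (incl h.isQuadA.le).injective ?_⟩
  rw [map_add, map_mul, map_pow, map_pow, map_intCast, hx', hy', ← huv, e]
  simp only [map_add, map_mul, map_pow, map_intCast]
  ring

theorem Setup.card_K : Nat.card (powMonoidHom (α := ClassGroup (𝓞 h.K)) 2).ker ≤ 2 := by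
  have := Fact.mk h.qp
  obtain ⟨f⟩ := h.exists_hom_R
  obtain ⟨e, he, he1⟩ := h.exists_eps
  obtain ⟨g, hg⟩ := h.exists_hom_Y f
  obtain ⟨g', hg'⟩ := h.exists_hom_Y (f.comp h.isQuadR.conj)
  have hF := h.padic_form
  have hr : 1 + 2 * Units.rank h.Y = Units.rank h.A := by rw [h.rank_Y, h.rank_A]
  obtain ⟨u, hu, hu1⟩ := unit_norm_of_rank h.isQuadA.quadInv h.odd_Y h.index_A hr
    (neg_one_mem_ker _)
  have he' : um (incl h.isQuadY.le) e ∈ (prin h.Y).ker := by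
    rw [mem_prin_ker] at he ⊢
    exact ⟨he.1.map (incl h.isQuadY.le).toIntAlgHom, by
      rw [← map_inv]; exact he.2.map (incl h.isQuadY.le).toIntAlgHom⟩
  obtain ⟨v, hv, hv1⟩ := unit_norm_of_rank h.isQuadA.quadInv h.odd_Y h.index_A hr he'
  have hfe : g (incl h.isQuadY.le e) * g' (incl h.isQuadY.le e) = -1 := by
    rw [hg, hg', RingHom.comp_apply, ← map_mul, he1]; simp
  have h1 := card_two_torsion_of_four h.isQuadK.quadInv h.odd_A h.index_K hu hv
    (fun hn => no_form_neg_one g hF (by simpa using h.form_of_isNm hn hu1))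
    (fun hn => no_form g g' hF hfe (h.form_of_isNm hn hv1))
    (fun hn => no_form g g' hF (u := - (incl h.isQuadY.le e)) (by simpa using hfe)
      (h.form_of_isNm hn (by rw [map_mul, mul_mul_mul_comm, hu1, hv1]; simp)))
  rw [h.rank_K, h.rank_A] at h1
  lia

end

section

section
variable {X K : Type*} [Field X] [NumberField X] [Field K] [NumberField K]
  {φ : X →+* K} {σ : K →+* K}

theorem exists_of_cl_eq_sq {B : FI K} (hB : ∃ x, cl K B = x ^ 2) :
    ∃ y J, B = prin K y * J ^ 2 := by
  obtain ⟨x, hx⟩ := hB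
  obtain ⟨J, rfl⟩ := cl_surjective x
  obtain ⟨y, hy⟩ := cl_eq_one_iff.1 (show cl K (B * (J ^ 2)⁻¹) = 1 by
    rw [map_mul, map_inv, map_pow, hx, mul_inv_cancel])
  exact ⟨y, J, by rw [hy, inv_mul_cancel_right]⟩

theorem exists_prin_of_sq (hodd : Odd (Nat.card (ClassGroup (𝓞 X)))) {I : FI X} {e : Xˣ}
    (he : prin X e = I ^ 2) : ∃ t, prin X t = I := by
  obtain ⟨k, hk⟩ := hodd
  obtain ⟨x, hx⟩ := pow_card_class I
  rw [hk, pow_succ, pow_mul, ← he] at hx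
  exact ⟨x * (e ^ k)⁻¹, by rw [map_mul, hx, map_inv, map_pow, mul_comm, inv_mul_cancel_left]⟩

/-- If an ideal with principal norm is a square up to principal ideals, then the generator of its
norm is a norm up to units and squares. -/
theorem QuadInv.norm_descent (h : QuadInv φ σ) (hodd : Odd (Nat.card (ClassGroup (𝓞 X))))
    {B J : FI K} {y : Kˣ} {d : Xˣ} (hd : nmI h B = prin X d) (hB : B = prin K y * J ^ 2) :
    ∃ u ∈ (prin X).ker, ∃ z : K, ∃ v : X, φ v = z * σ z ∧ (d : X) = u * v := by
  obtain ⟨N, hN, hN'⟩ := nmI_prin h y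
  have h1 : prin X (d * N⁻¹) = (nmI h J) ^ 2 := by
    rw [map_mul, ← hd, hB, map_mul, map_pow, hN', map_inv, mul_comm, inv_mul_cancel_left]
  obtain ⟨t, ht⟩ := exists_prin_of_sq hodd h1
  refine ⟨d * N⁻¹ * (t ^ 2)⁻¹, ?_, y * φ t, N * t ^ 2, ?_, ?_⟩
  · rw [MonoidHom.mem_ker, map_mul, h1, map_inv, map_pow, ht, mul_inv_cancel]
  · simp only [map_mul, map_pow, hN, h.fix]; ring
  · push_cast; field_simp

end

theorem IsQuad.norm_descent {X K : IntermediateField ℚ ℂ} [NumberField X] [NumberField K] {s : ℂ}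
    (h : IsQuad X K s) (hodd : Odd (Nat.card (ClassGroup (𝓞 X)))) {n : ℤ} (hn : s ^ 2 = -n)
    {B J : FI K} {y : Kˣ} {d : Xˣ} (hd : nmI h.quadInv B = prin X d) (hB : B = prin K y * J ^ 2) :
    ∃ u ∈ (prin X).ker, ∃ x y : X, (d : X) = u * (x ^ 2 + n * y ^ 2) := by
  obtain ⟨u, hu, z, v, hv, e⟩ := h.quadInv.norm_descent hodd hd hB
  obtain ⟨x, y, e'⟩ := (h.isNm_iff_form hn v).1 ⟨z, hv.symm⟩
  exact ⟨u, hu, x, y, by rw [e, e']⟩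

theorem integral_Q0 {x : Q0} (hx : IsIntegral ℤ x) : ∃ n : ℤ, x = n := by
  obtain ⟨r, hr, -⟩ := hom_Q0 (RingHom.id Q0) x
  have h1 : IsIntegral ℤ (r : ℂ) := hr ▸ (hx.map (Q0.val.toRingHom.toIntAlgHom) : IsIntegral ℤ (x : ℂ))
  have h2 : IsIntegral ℤ r := (isIntegral_algHom_iff (algebraMap ℚ ℂ).toIntAlgHom
    (algebraMap ℚ ℂ).injective).1 (by simpa using h1)
  obtain ⟨n, rfl⟩ := IsIntegrallyClosed.isIntegral_iff.1 h2
  exact ⟨n, Subtype.ext (hr.trans (by simp))⟩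

theorem unit_Q0 {u : Q0ˣ} (hu : u ∈ (prin Q0).ker) : (u : Q0) = 1 ∨ (u : Q0) = -1 := by
  obtain ⟨h1, h2⟩ := mem_prin_ker.1 hu
  obtain ⟨m, hm⟩ := integral_Q0 h1
  obtain ⟨n, hn⟩ := integral_Q0 h2
  have : ((m * n : ℤ) : Q0) = 1 := by push_cast; rw [← hm, ← hn, Units.mul_inv]
  have h3 : m * n = 1 := by exact_mod_cast this
  rcases Int.eq_one_or_neg_one_of_mul_eq_one h3 with rfl | rfl
  · left; simpa using hm
  · right; simpa using hm

variable {p q : ℕ} {a b c : ℂ} (h : Setup p q a b c)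
include h

/-- An ideal of `ℚ(√-pq)` of norm `d` is not a square class if `d` is not represented. -/
theorem Setup.not_sq_k {B : FI h.k} {d : Q0ˣ} {r : ℕ} (hr : (d : Q0) = (r : ℤ)) (hr0 : 0 < r)
    (hd : nmI h.isQuadk.quadInv B = prin Q0 d)
    (hF : ∀ [Fact p.Prime] (x y : ℚ_[p]), (r : ℚ_[p]) ≠ x ^ 2 + (p * q) * y ^ 2) :
    ¬∃ x, cl h.k B = x ^ 2 := by
  intro hB
  have := Fact.mk h.pp
  obtain ⟨y, J, hB⟩ := exists_of_cl_eq_sq hB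
  obtain ⟨u, hu, x, y, e⟩ := h.isQuadk.norm_descent
    (by rw [odd_class_of_finrank_one finrank_Q0]; exact odd_one) (n := (p * q : ℕ))
    (by rw [h.acI2]; simp) hd hB
  rw [hr] at e
  rcases unit_Q0 hu with h1 | h1
  · rw [h1, one_mul] at e
    apply hF (homQ0 _ x) (homQ0 _ y)
    simpa using congrArg (homQ0 ℚ_[p]) e
  · have e2 := congrArg (homQ0 ℝ) e
    rw [h1] at e2
    simp only [map_mul, map_add, map_neg, map_one, map_pow, map_intCast] at e2
    have h3 : (0 : ℝ) < r := by exact_mod_cast hr0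
    push_cast at e2
    nlinarith [sq_nonneg (homQ0 ℝ x), mul_nonneg (mul_nonneg (Nat.cast_nonneg (α := ℝ) p) (Nat.cast_nonneg q)) (sq_nonneg (homQ0 ℝ y))]

theorem Setup.exists_pi : ∃ θ : 𝓞 h.K, Ideal.span {θ} ^ 4 = Ideal.span {(2 : 𝓞 h.K)} := by
  have hI : I ^ 2 = -1 := I_sq
  obtain ⟨i, hi⟩ := exists_int h.I_mem_K (isIntegral_of_quad 0 (-1) (by simp))
  obtain ⟨β, hβ⟩ := exists_int h.b_mem_K (isIntegral_of_quad 0 2 (by simp [h.b2]))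
  have hz : (1 + I) * b / 2 ∈ h.K := div_mem (mul_mem (add_mem (one_mem _) h.I_mem_K) h.b_mem_K)
    (by exact_mod_cast (h.K).natCast_mem 2)
  have hzi : IsIntegral ℤ ((1 + I) * b / 2) := by
    apply IsIntegral.of_pow (n := 4) (by norm_num)
    have : ((1 + I) * b / 2) ^ 4 = -1 := by linear_combination (exp := 1) (1 + I) ^ 4 * (b ^ 2 + 2) / 16 * h.b2 + (I ^ 2 + 4 * I + 5) / 4 * hI
    rw [this]
    exact isIntegral_one.neg
  obtain ⟨ζ, hζ⟩ := exists_int hz hzi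
  have e1 : ((1 + I) * b / 2) ^ 2 = I := by
    linear_combination (1 + I) ^ 2 / 4 * h.b2 + 1 / 2 * hI
  have e2 : 1 + I = b * ((1 + I) * b / 2) := by linear_combination -(1 + I) / 2 * h.b2
  have e3 : (1 - (1 + I) * b / 2) ^ 4 = 2 * (I * (1 - b) ^ 2) := by
    generalize (1 + I) * b / 2 = z at e1 e2
    have e4 : (1 - z) ^ 2 = b * z * (1 - b) := by linear_combination e1 + e2 + z * h.b2
    linear_combination ((1 - z) ^ 2 + b * z * (1 - b)) * e4 + b ^ 2 * (1 - b) ^ 2 * e1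
      + I * (1 - b) ^ 2 * h.b2
  refine ⟨1 - ζ, ?_⟩
  rw [Ideal.span_singleton_pow]
  apply le_antisymm <;> rw [Ideal.span_singleton_le_span_singleton]
  · refine ⟨i * (1 - β) ^ 2, oext ?_⟩
    push_cast
    rw [hi, hβ, hζ, e3]
  · refine ⟨- i * (1 + β) ^ 2, oext ?_⟩
    push_cast
    rw [hi, hβ, hζ, e3]
    linear_combination 2 * (b ^ 2 - 1) ^ 2 * hI - 2 * b ^ 2 * h.b2

end

section

section
variable {X K : Type*} [Field X] [NumberField X] [Field K] [NumberField K]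
  {φ : X →+* K} {σ : K →+* K}

theorem um_mem_prin_ker (f : X →+* K) {x : Xˣ} (hx : x ∈ (prin X).ker) : um f x ∈ (prin K).ker := by
  rw [mem_prin_ker] at hx ⊢
  exact ⟨hx.1.map f.toIntAlgHom, by rw [← map_inv]; exact hx.2.map f.toIntAlgHom⟩

/-- Units of relative norm one in a quadratic extension `K / X` with `X` having only the units `±1`
and `K` having unit rank one. -/
theorem QuadInv.unit_of_norm_one (h : QuadInv φ σ) (hX : Units.rank X = 0) (hK : Units.rank K = 1)
    (hE : ∀ u ∈ (prin X).ker, (u : X) = 1 ∨ (u : X) = -1)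
    (he : ∃ e ∈ (prin K).ker, (e : K) * σ e = -1) (hn : ∀ w ∈ (prin K).ker, σ w ≠ -w)
    {v : Kˣ} (hv : v ∈ (prin K).ker) (hv1 : (v : K) * σ v = 1) :
    ∃ w ∈ (prin K).ker, (v : K) * σ w = w ∨ (v : K) * σ w = - w := by
  obtain ⟨q1, q2, q3⟩ := herbrand_subgroup (s := um σ) (fun x => Units.ext (h.invol x))
    (prin K).ker fun x hx => um_mem_prin_ker σ hx
  have h1 : ((prin K).ker.map (nm (um σ))).relIndex ((df (um σ)).ker ⊓ (prin K).ker) = 1 := by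
    rw [Subgroup.relIndex_eq_one]
    intro x hx
    obtain ⟨y, hy, rfl⟩ := (mem_fixed_units h).1 hx
    rcases hE y hy with hy1 | hy1
    · rw [Units.val_eq_one.1 hy1, map_one]
      exact one_mem _
    · obtain ⟨e, he, he1⟩ := he
      exact ⟨e, he, Units.ext (by simpa [hy1] using he1)⟩
  rw [h1, rk_fixed h, hX, rk_prin_ker, hK, mul_zero, pow_zero, mul_one, one_mul, pow_one] at q1
  by_contra hcon
  push Not at hcon
  have h4 := four_le_relIndex ((prin K).ker.map (df (um σ))) ((nm (um σ)).ker ⊓ (prin K).ker)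
    (by rw [q1]; norm_num) (a := -1) (b := v) ?_ ?_ ?_ ?_ ?_ ?_
  · rw [q1] at h4
    lia
  · exact ⟨(mem_ker_nm _).2 (Units.ext (by simp)), neg_one_mem_ker K⟩
  · exact ⟨(mem_ker_nm _).2 (Units.ext hv1), hv⟩
  · rintro ⟨w, hw, e⟩
    rw [df_apply, div_eq_iff_eq_mul] at e
    apply hn w hw
    have : (w : K) = -1 * σ w := congrArg Units.val e
    linear_combination this
  · rintro ⟨w, hw, e⟩
    rw [df_apply, div_eq_iff_eq_mul] at e
    exact (hcon w hw).1 (congrArg Units.val e).symm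
  · rintro ⟨w, hw, e⟩
    rw [df_apply, div_eq_iff_eq_mul] at e
    apply (hcon w hw).2
    have : (w : K) = -1 * v * σ w := congrArg Units.val e
    linear_combination this
  · simp

end

theorem IsQuad.eq_mul_gen {X K : IntermediateField ℚ ℂ} {s : ℂ} (h : IsQuad X K s) {z : K}
    (hz : h.conj z = -z) : ∃ b : X, (z : ℂ) = b * s := by
  obtain ⟨a, b, e1, e2⟩ := h.eq_coords z
  rw [e2, e1] at hz
  have h0 : incl h.le a = 0 := by linear_combination hz / 2
  rw [h0, zero_add] at e1
  exact ⟨b, congrArg Subtype.val e1⟩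

theorem IsQuad.eq_incl {X K : IntermediateField ℚ ℂ} {s : ℂ} (h : IsQuad X K s) {z : K}
    (hz : h.conj z = z) : ∃ b : X, (z : ℂ) = b := by
  obtain ⟨x, rfl⟩ := h.quadInv.mem z hz
  exact ⟨x, rfl⟩

theorem intCast_ne_mul_sq {l : ℕ} [Fact l.Prime] {r m n : ℤ} (hr : ¬∃ t : ℤ, (l : ℤ) ∣ t ^ 2 - r)
    (hm : ¬ (l : ℤ) ∣ m) (hn : ¬ (l : ℤ) ∣ n) (t : Q0) : (n : Q0) ≠ m * l * t ^ 2 := by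
  intro e
  have e' := congrArg (homQ0 ℚ_[l]) e
  simp only [map_mul, map_pow, map_natCast, map_intCast] at e'
  have hl : Prime (l : ℤ) := Nat.prime_iff_prime_int.1 Fact.out
  have := padic_form_anisotropic (l := l) hr (s := r * n * m) (w := n) (x := 0)
    (y := homQ0 ℚ_[l] t)
    (fun hd => by
      rcases hl.dvd_or_dvd hd with hd | hd
      · rcases hl.dvd_or_dvd hd with hd | hd
        exacts [hr ⟨0, by simpa using hd⟩, hn hd]
      · exact hm hd)
    (by push_cast; linear_combination (r * n : ℚ_[l]) * e')
  rw [Int.cast_eq_zero] at this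
  exact hn (this ▸ dvd_zero _)

theorem QuadInv.exists_norm_unit {X K : Type*} [Field X] [NumberField X] [Field K] [NumberField K]
    {φ : X →+* K} {σ : K →+* K} (h : QuadInv φ σ) {u : Kˣ} (hu : u ∈ (prin K).ker) :
    ∃ v ∈ (prin X).ker, φ v = u * σ u := by
  obtain ⟨v, hv, e⟩ := nmI_prin h u
  refine ⟨v, ?_, hv⟩
  rw [MonoidHom.mem_ker, ← e, hu, map_one]

variable {p q : ℕ} {a b c : ℂ} (h : Setup p q a b c)
include h

theorem Setup.not_dvd_of_pos {n : ℤ} (h0 : 0 < n) (hn : n < p) : ¬ (p : ℤ) ∣ n := fun hd =>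
  (Int.le_of_dvd h0 hd).not_gt hn

theorem Setup.unit_k {u : (h.k)ˣ} (hu : u ∈ (prin h.k).ker) : (u : h.k) = 1 ∨ (u : h.k) = -1 := by
  have := Fact.mk h.pp
  set σ := h.isQuadk.conj with hσ
  obtain ⟨x, y, e1, e2⟩ := h.isQuadk.eq_coords (u : h.k)
  obtain ⟨v, hv, ev⟩ := h.isQuadk.quadInv.exists_norm_unit hu
  set φ := incl h.isQuadk.le with hφ
  have hg : (⟨a * c * I, h.isQuadk.mem⟩ : h.k) ^ 2 = φ (-(p * q)) :=
    Subtype.ext (by simpa using h.acI2)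
  obtain ⟨h1, -⟩ := mem_prin_ker.1 hu
  have ht : φ (2 * x) = u + σ u := by
    rw [e2, e1, map_mul, map_ofNat]; ring
  obtain ⟨n, hn⟩ := integral_Q0 (integral_of_map φ (ht ▸ h1.add (h1.map σ.toIntAlgHom)))
  have hN : x ^ 2 + p * q * y ^ 2 = v := by
    apply φ.injective
    rw [ev, e2, e1]
    simp only [map_neg, map_mul, map_add, map_pow, map_natCast] at hg ⊢
    linear_combination (φ y) ^ 2 * hg
  have hN1 : x ^ 2 + p * q * y ^ 2 = 1 := by
    rcases unit_Q0 hv with h3 | h3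
    · rw [hN, h3]
    · have h4 := congrArg (homQ0 ℝ) (hN.trans h3)
      simp only [map_add, map_mul, map_pow, map_natCast, map_one, map_neg] at h4
      have : 0 ≤ (p : ℝ) * q * (homQ0 ℝ y) ^ 2 := by positivity
      nlinarith [sq_nonneg (homQ0 ℝ x)]
  have hform : (n : Q0) ^ 2 + p * q * (2 * y) ^ 2 = 4 := by
    rw [← hn]; linear_combination 4 * hN1
  have hn2 : n ^ 2 ≤ 4 := by
    have h4 := congrArg (homQ0 ℝ) hform
    simp only [map_add, map_mul, map_pow, map_natCast, map_intCast, map_ofNat] at h4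
    have : 0 ≤ (p : ℝ) * q * (2 * homQ0 ℝ y) ^ 2 := by positivity
    have h5 : (n : ℝ) ^ 2 ≤ 4 := by linarith
    exact_mod_cast h5
  have hp5 : 5 ≤ p := h.p8 ▸ Nat.mod_le p 8
  have hpq : ¬ (p : ℤ) ∣ q := fun hd => h.p_not_dvd_q (by exact_mod_cast hd)
  have hl : -2 ≤ n := by nlinarith
  have hr : n ≤ 2 := by nlinarith
  have c3 : ¬ ((p : Q0) * q * (2 * y) ^ 2 = 3) := fun h6 =>
    intCast_ne_mul_sq (l := p) h.two_p hpq (h.not_dvd_of_pos (n := 3) (by lia) (by lia)) (2 * y)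
      (by push_cast; linear_combination -h6)
  have c4 : ¬ ((p : Q0) * q * (2 * y) ^ 2 = 4) := fun h6 =>
    intCast_ne_mul_sq (l := p) h.two_p hpq (h.not_dvd_of_pos (n := 4) (by lia) (by lia)) (2 * y)
      (by push_cast; linear_combination -h6)
  have hp0 : (p : Q0) ≠ 0 := Nat.cast_ne_zero.2 h.pp.ne_zero
  have hq0 : (q : Q0) ≠ 0 := Nat.cast_ne_zero.2 h.qp.ne_zero
  have fin : n ^ 2 = 4 → y = 0 := fun hn4 => by
    have : (n : Q0) ^ 2 = 4 := by exact_mod_cast hn4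
    rw [this] at hform
    simpa [hp0, hq0] using hform
  interval_cases n
  · have hx : x = -1 := by push_cast at hn; linear_combination hn / 2
    right
    rw [e1, fin (by norm_num), hx]
    simp
  · exact absurd (by push_cast at hform; linear_combination hform) c3
  · exact absurd (by push_cast at hform; linear_combination hform) c4
  · exact absurd (by push_cast at hform; linear_combination hform) c3
  · have hx : x = 1 := by push_cast at hn; linear_combination hn / 2
    left
    rw [e1, fin (by norm_num), hx]
    simp

end

section

theorem mem_of_sq_eq {X : IntermediateField ℚ ℂ} {x y : ℂ} (hx : x ∈ X) (e : x ^ 2 = y ^ 2) :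
    y ∈ X := by
  rcases sq_eq_sq_iff_eq_or_eq_neg.1 e with rfl | rfl
  · exact hx
  · simpa using neg_mem hx

variable {p q : ℕ} {a b c : ℂ} (h : Setup p q a b c)
include h

/-- Totally positive units of `ℚ(√p)` are squares. -/
theorem Setup.sq_of_pos {u : (h.R)ˣ} (hu : u ∈ (prin h.R).ker) (f : h.R →+* ℝ) (h1 : 0 < f u)
    (h2 : 0 < f (h.isQuadR.conj u)) : ∃ w : h.R, (u : h.R) = w ^ 2 := by
  have := Fact.mk h.pp
  set σ := h.isQuadR.conj with hσ
  set φ := incl h.isQuadR.le with hφ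
  have hQ : ∀ w : (h.R)ˣ, w ∈ (prin h.R).ker → (w : h.R) * σ w = 1 ∨ (w : h.R) * σ w = -1 :=
    fun w hw => by
      obtain ⟨v, hv, ev⟩ := h.isQuadR.quadInv.exists_norm_unit hw
      rcases unit_Q0 hv with h3 | h3
      · left; rw [← ev, h3, map_one]
      · right; rw [← ev, h3, map_neg, map_one]
  have hu1 : (u : h.R) * σ u = 1 := by
    rcases hQ u hu with h3 | h3
    · exact h3
    · have h4 := congrArg f h3
      rw [map_mul, map_neg, map_one] at h4
      nlinarith [mul_pos h1 h2]
  have hp1 : 1 < p := h.pp.one_lt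
  have hneg : ∀ w ∈ (prin h.R).ker, σ w ≠ -w := fun w hw hw1 => by
    obtain ⟨t, ht⟩ := h.isQuadR.eq_mul_gen hw1
    have ht2 : (w : h.R) ^ 2 = φ (p * t ^ 2) := Subtype.ext (by
      push_cast
      rw [ht, coe_incl]
      push_cast
      linear_combination (t : ℂ) ^ 2 * h.a2)
    have hp1' := h.not_dvd_of_pos (n := 1) (by lia) (by lia)
    rcases hQ w hw with h3 | h3
    · refine intCast_ne_mul_sq (l := p) (n := -1) h.two_p hp1'
        (by rwa [Int.dvd_neg]) t (φ.injective ?_)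
      push_cast
      rw [one_mul, ← ht2, map_neg, map_one, ← h3, hw1]; ring
    · refine intCast_ne_mul_sq (l := p) (n := 1) h.two_p hp1'
        hp1' t (φ.injective ?_)
      push_cast
      rw [one_mul, ← ht2, map_one]
      rw [hw1] at h3
      linear_combination h3
  obtain ⟨w, hw, e⟩ := h.isQuadR.quadInv.unit_of_norm_one rank_Q0 h.rank_R (fun _ => unit_Q0)
    h.exists_eps hneg hu hu1
  have key : (u : h.R) = w ^ 2 ∨ (u : h.R) = - w ^ 2 := by
    rcases e with e | e <;> rcases hQ w hw with h3 | h3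
    · left; linear_combination w * e - u * h3
    · right; linear_combination -w * e + u * h3
    · right; linear_combination w * e - u * h3
    · left; linear_combination -w * e + u * h3
  rcases key with h3 | h3
  · exact ⟨w, h3⟩
  · have h4 := congrArg f h3
    rw [map_neg, map_pow] at h4
    nlinarith [sq_nonneg (f w)]

theorem Setup.k_le_L : h.k ≤ h.L := by
  refine IntermediateField.adjoin_le_iff.2 ?_
  rintro x (rfl | hx)
  · rw [mul_assoc]
    exact mul_mem h.a_mem_L h.cI_mem_L
  · exact hx.elim

/-- A unit of norm one in `F / k` is, up to sign, a quotient of conjugate units. -/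
theorem Setup.unit_F {v : (h.F)ˣ} (hv : v ∈ (prin h.F).ker) (hv1 : (v : h.F) * h.isQuadF.conj v = 1) :
    ∃ w ∈ (prin h.F).ker, (v : h.F) * h.isQuadF.conj w = w ∨ (v : h.F) * h.isQuadF.conj w = - w := by
  refine h.isQuadF.quadInv.unit_of_norm_one h.rank_k h.rank_F (fun _ => h.unit_k) ?_ ?_ hv hv1
  · have hb : IsIntegral ℤ (⟨b, h.b_mem_F⟩ : h.F) := by
      apply IsIntegral.of_pow (n := 2) (by norm_num)
      rw [show (⟨b, h.b_mem_F⟩ : h.F) ^ 2 = 2 from Subtype.ext h.b2]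
      exact_mod_cast isIntegral_natCast (a := 2)
    have e : (1 + (⟨b, h.b_mem_F⟩ : h.F)) * (⟨b, h.b_mem_F⟩ - 1) = 1 :=
      Subtype.ext (by push_cast; linear_combination h.b2)
    have e' : ((⟨b, h.b_mem_F⟩ : h.F) - 1) * (1 + ⟨b, h.b_mem_F⟩) = 1 := by rw [mul_comm, e]
    refine ⟨⟨_, _, e, e'⟩, mem_prin_ker.2 ⟨isIntegral_one.add hb, hb.sub isIntegral_one⟩, ?_⟩
    change (1 + (⟨b, h.b_mem_F⟩ : h.F)) * h.isQuadF.conj (1 + ⟨b, h.b_mem_F⟩) = -1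
    rw [map_add, map_one, h.isQuadF.conj_gen]
    linear_combination -e
  · intro w hw hw1
    obtain ⟨t, ht⟩ := h.isQuadF.eq_mul_gen hw1
    obtain ⟨v, hv, ev⟩ := h.isQuadF.quadInv.exists_norm_unit hw
    have e : (w : h.F) ^ 2 = 1 ∨ (w : h.F) ^ 2 = -1 := by
      rw [hw1] at ev
      rcases h.unit_k hv with h3 | h3 <;> rw [h3] at ev
      · right; rw [map_one] at ev; linear_combination ev
      · left; rw [map_neg, map_one] at ev; linear_combination ev
    have h2t : 2 * (t : ℂ) ∈ h.k := mul_mem (ofNat_mem h.k 2) t.2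
    have e' : (2 * (t : ℂ)) ^ 2 = b ^ 2 ∨ (2 * (t : ℂ)) ^ 2 = (b * I) ^ 2 := by
      rcases e with e | e <;> have e1 := congrArg (algebraMap h.F ℂ) e <;>
        simp only [IntermediateField.algebraMap_apply] at e1 <;> push_cast at e1 <;> rw [ht] at e1
      · left; linear_combination (b ^ 2) * e1 - t ^ 2 * (2 + b ^ 2) * h.b2
      · right; linear_combination (b ^ 2) * e1 - t ^ 2 * (2 + b ^ 2) * h.b2 - b ^ 2 * I_sq
    rcases e' with e' | e'
    · exact h.isQuadF.notMem (mem_of_sq_eq h2t e')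
    · exact h.isQuadL2.notMem (h.k_le_L (mem_of_sq_eq h2t e'))

end

section

theorem exists_eq_pow_of_isCoprime {K : Type*} [Field K] [NumberField K] {J J' T : Ideal (𝓞 K)}
    (hc : IsCoprime J J') {n : ℕ} (e : J * J' = T ^ n) : ∃ D, J = D ^ n := by
  classical
  refine exists_eq_pow_of_mul_eq_pow ?_ e
  rw [Ideal.gcd_eq_sup, ← Ideal.add_eq_sup, Ideal.isCoprime_iff_add.1 hc]
  exact isUnit_one

theorem extI_incl {X Y Z : IntermediateField ℚ ℂ} [NumberField X] [NumberField Y] [NumberField Z]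
    (h₁ : X ≤ Y) (h₂ : Y ≤ Z) (h₃ : X ≤ Z) (J : FI X) :
    extI (incl h₂) (extI (incl h₁) J) = extI (incl h₃) J :=
  extI_comp _ _ _

variable {p q : ℕ} {a b c : ℂ} (h : Setup p q a b c)
include h

theorem Setup.k_le_K : h.k ≤ h.K :=
  h.isQuadF.le.trans (h.isQuadM.le.trans h.isQuadKM.le)

/-- A prime of `ℚ(√(-pq))` above `2` has norm `2` and is a fourth power in the degree `16` field. -/
theorem Setup.exists_prime_two : ∃ (B : FI h.k) (D : FI h.K) (d : Q0ˣ), (d : Q0) = 2 ∧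
    nmI h.isQuadk.quadInv B = prin Q0 d ∧ D ^ 4 = extI (incl h.k_le_K) B := by
  obtain ⟨w, hw, m, hm, -⟩ := h.exists_half_acI h.acI_mem_k
  set σ := h.isQuadk.conj with hσ
  have hσw : RingOfIntegers.mapRingHom σ w = 1 - w := oext (by
    rw [coe_mapRingHom, h.isQuadk.coe_conj (a := 1 / 2) (b := 1 / 2)
      (div_mem (one_mem _) (ofNat_mem _ 2)) (div_mem (one_mem _) (ofNat_mem _ 2))
      (by rw [hw]; ring)]
    push_cast
    rw [hw]; ring)
  have h20 : (2 : 𝓞 h.k) ≠ 0 := two_ne_zero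
  set J : Ideal (𝓞 h.k) := Ideal.span {2, w} with hJ
  set J' : Ideal (𝓞 h.k) := Ideal.span {2, 1 - w} with hJ'
  have h2J : (2 : 𝓞 h.k) ∈ J := Ideal.subset_span (by simp)
  have h2J' : (2 : 𝓞 h.k) ∈ J' := Ideal.subset_span (by simp)
  have hwJ : w ∈ J := Ideal.subset_span (by simp)
  have hwJ' : 1 - w ∈ J' := Ideal.subset_span (by simp)
  have hJ0 : J ≠ ⊥ := fun e => h20 (by rw [e] at h2J; simp at h2J)
  have hJ0' : J' ≠ ⊥ := fun e => h20 (by rw [e] at h2J'; simp at h2J')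
  have hco : IsCoprime J J' := Ideal.isCoprime_iff_exists.2 ⟨w, hwJ, 1 - w, hwJ', by ring⟩
  have hmul : J * J' = Ideal.span {2} := by
    apply le_antisymm
    · rw [hJ, hJ', Ideal.span_pair_mul_span_pair, Ideal.span_le]
      rintro x hx
      simp only [Set.mem_insert_iff, Set.mem_singleton_iff] at hx
      rw [SetLike.mem_coe, Ideal.mem_span_singleton]
      rcases hx with rfl | rfl | rfl | rfl
      · exact dvd_mul_right _ _
      · exact dvd_mul_right _ _
      · exact dvd_mul_left _ _
      · exact ⟨m, by linear_combination -hm⟩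
    · rw [Ideal.span_singleton_le_iff_mem]
      have h1 := add_mem (Ideal.mul_mem_mul h2J hwJ') (Ideal.mul_mem_mul hwJ h2J')
      convert h1 using 1
      ring
  have h2bot : Ideal.span {(2 : 𝓞 h.k)} ≠ ⊥ := by simp
  have hmap : J.map (RingOfIntegers.mapRingHom σ) = J' := by
    rw [hJ, Ideal.map_span, Set.image_pair, hσw, map_ofNat]
  set u : Q0ˣ := Units.mk0 2 two_ne_zero with hu
  refine ⟨mkI J hJ0, ?_⟩
  have hN : nmI h.isQuadk.quadInv (mkI J hJ0) = prin Q0 u := by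
    apply extI_injective (incl h.isQuadk.le)
    rw [extI_nmI, extI_prin, extI_mkI]
    have : mkI (J.map (RingOfIntegers.mapRingHom h.isQuadk.conj)) (map_ne_bot _ hJ0)
      = mkI J' hJ0' := by congr 1
    rw [this, ← mkI_mul J J' hJ0 hJ0' (by rw [hmul]; exact h2bot)]
    simp only [hmul]
    exact mkI_span 2 _ (show ((2 : 𝓞 h.k) : h.k) = incl h.isQuadk.le 2 by rw [map_ofNat]; rfl) _
  obtain ⟨θ, hθ⟩ := h.exists_pi
  set g := RingOfIntegers.mapRingHom (incl h.k_le_K) with hg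
  have hmul' : J.map g * J'.map g = Ideal.span {θ} ^ 4 := by
    rw [hθ, ← Ideal.map_mul, hmul, Ideal.map_span, Set.image_singleton, map_ofNat]
  have hco' : IsCoprime (J.map g) (J'.map g) :=
    Ideal.isCoprime_iff_exists.2 ⟨g w, Ideal.mem_map_of_mem g hwJ, g (1 - w),
      Ideal.mem_map_of_mem g hwJ', by rw [← map_add]; simp⟩
  obtain ⟨D, hD⟩ := exists_eq_pow_of_isCoprime hco' hmul'
  have hJg := map_ne_bot (incl h.k_le_K) hJ0
  have hD0 : D ≠ ⊥ := by
    rintro rfl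
    exact hJg (by rw [← hg, hD, ← Ideal.zero_eq_bot, zero_pow (by norm_num)])
  refine ⟨mkI D hD0, u, rfl, hN, ?_⟩
  rw [extI_mkI, ← mkI_pow D 4 hD0 (by rw [← hD]; exact hJg)]
  simp only [← hg, hD]

end

section

theorem eq_of_two_torsion {G : Type*} [CommGroup G] [Finite G]
    (h2 : Nat.card (powMonoidHom (α := G) 2).ker ≤ 2) {s t : G} (hs : s ^ 2 = 1) (ht : t ^ 2 = 1)
    (hs1 : s ≠ 1) (ht1 : t ≠ 1) : s = t := by
  by_contra hst
  have h3 : ({1, s, t} : Set G) ⊆ (powMonoidHom (α := G) 2).ker := by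
    rintro x (rfl | rfl | rfl) <;> simp [*]
  have h4 := Set.ncard_le_ncard h3 (Set.toFinite _)
  rw [Set.ncard_eq_three.2 ⟨1, s, t, hs1.symm, ht1.symm, hst, rfl⟩] at h4
  have h5 : ((powMonoidHom (α := G) 2).ker : Set G).ncard = Nat.card (powMonoidHom (α := G) 2).ker :=
    Nat.card_coe_set_eq _
  lia

/-- In a finite abelian group with cyclic Sylow 2-subgroup generated up to squares by `g`, an
element of order two that is a square is a power of `g`, with exponent half the order of `g`. -/
theorem exists_orderOf_eq_four_mul {G : Type*} [CommGroup G] [Finite G]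
    (h2 : Nat.card (powMonoidHom (α := G) 2).ker ≤ 2) {g t : G} (hg : ¬∃ y, g = y ^ 2)
    (ht : t ^ 2 = 1) (ht1 : t ≠ 1) (hsq : ∃ y, t = y ^ 2) :
    ∃ n, 0 < n ∧ orderOf g = 4 * n ∧ g ^ (2 * n) = t := by
  have hpos := orderOf_pos g
  rcases Nat.even_or_odd (orderOf g) with ⟨m, hm⟩ | ⟨m, hm⟩
  · have h3 : g ^ m = t := eq_of_two_torsion h2
      (by rw [← pow_mul, mul_two, ← hm, pow_orderOf_eq_one]) ht
      (fun e => by have := orderOf_le_of_pow_eq_one (by lia) e; lia) ht1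
    rcases Nat.even_or_odd m with ⟨n, hn⟩ | ⟨n, hn⟩
    · exact ⟨n, by lia, by lia, by rw [two_mul, ← hn, h3]⟩
    · obtain ⟨y, hy⟩ := hsq
      refine absurd ⟨y * (g ^ n)⁻¹, ?_⟩ hg
      rw [mul_pow, ← hy, ← h3, hn, pow_succ', inv_pow, ← pow_mul, mul_comm n 2,
        mul_inv_cancel_right]
  · refine absurd ⟨g ^ (m + 1), ?_⟩ hg
    rw [← pow_mul, show (m + 1) * 2 = orderOf g + 1 by lia, pow_succ, pow_orderOf_eq_one, one_mul]

theorem QuadInv.nmI_pow_eq {X K : Type*} [Field X] [NumberField X] [Field K] [NumberField K]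
    {φ : X →+* K} {σ : K →+* K} (h : QuadInv φ σ) {A : FI K} {C : FI X} {n : ℕ}
    (e : A ^ (2 * n) = extI φ C) : nmI h A ^ n = C := by
  apply FI_pow_left_injective two_ne_zero
  show (nmI h A ^ n) ^ 2 = C ^ 2
  rw [← nmI_extI h C, ← e, map_pow, ← pow_mul, mul_comm]

theorem QuadInv.nmI_eq_of_sq {X K : Type*} [Field X] [NumberField X] [Field K] [NumberField K]
    {φ : X →+* K} {σ : K →+* K} (h : QuadInv φ σ) {A : FI K} {C : FI X} (e : A ^ 2 = extI φ C) :
    nmI h A = C := by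
  rw [← pow_one (nmI h A)]
  exact h.nmI_pow_eq e

theorem QuadInv.nmI_nmI_eq {X K L : Type*} [Field X] [NumberField X] [Field K] [NumberField K]
    [Field L] [NumberField L] {φ : X →+* K} {σ : K →+* K} {ψ : K →+* L} {τ : L →+* L}
    (h : QuadInv φ σ) (h' : QuadInv ψ τ) {A : FI L} {C : FI X} (e : A ^ 4 = extI ψ (extI φ C)) :
    nmI h (nmI h' A) = C :=
  h.nmI_eq_of_sq (h'.nmI_pow_eq (n := 2) e)

theorem span_pair_sq {R : Type*} [CommRing R] {x s r : R} (e : s ^ 2 = x * r) (hc : IsCoprime x r) :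
    Ideal.span {x, s} ^ 2 = Ideal.span {x} := by
  rw [sq, Ideal.span_pair_mul_span_pair]
  apply le_antisymm
  · rw [Ideal.span_le]
    rintro y hy
    simp only [Set.mem_insert_iff, Set.mem_singleton_iff] at hy
    rw [SetLike.mem_coe, Ideal.mem_span_singleton]
    rcases hy with rfl | rfl | rfl | rfl
    · exact dvd_mul_right _ _
    · exact dvd_mul_right _ _
    · exact dvd_mul_left _ _
    · exact ⟨r, by rw [← e, sq]⟩
  · rw [Ideal.span_singleton_le_iff_mem]
    obtain ⟨u, v, huv⟩ := hc
    have h1 : x * x ∈ Ideal.span {x * x, x * s, s * x, s * s} := Ideal.subset_span (by simp)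
    have h2 : s * s ∈ Ideal.span {x * x, x * s, s * x, s * s} := Ideal.subset_span (by simp)
    convert add_mem (Ideal.mul_mem_left _ u h1) (Ideal.mul_mem_left _ v h2) using 1
    linear_combination -x * huv - v * e

variable {p q : ℕ} {a b c : ℂ} (h : Setup p q a b c)
include h

/-- The ramified prime of `ℚ(√(-pq))` above `p`, whose class has order two. -/
theorem Setup.exists_prime_p : ∃ (P : FI h.k) (u : (h.k)ˣ) (d : Q0ˣ), (u : h.k) = p ∧
    (d : Q0) = p ∧ P ^ 2 = prin h.k u ∧ nmI h.isQuadk.quadInv P = prin Q0 d ∧ cl h.k P ≠ 1 := by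
  obtain ⟨s, hs⟩ := exists_sqrt_int h.acI_mem_k (-(p * q : ℕ)) (by rw [h.acI2]; simp)
  have hp0 : p ≠ 0 := h.pp.ne_zero
  have hs2 : s ^ 2 = (p : 𝓞 h.k) * (-q) := oext (by
    push_cast
    rw [hs, h.acI2]; push_cast; ring)
  have hco : IsCoprime (p : 𝓞 h.k) (-q) := by
    have := (Nat.isCoprime_iff_coprime.2 ((Nat.coprime_primes h.pp h.qp).2 h.ne)).map
      (Int.castRingHom (𝓞 h.k))
    simpa using this.neg_right
  have hp : Ideal.span {(p : 𝓞 h.k)} ≠ ⊥ := span_natCast_ne_bot hp0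
  have hsq := span_pair_sq hs2 hco
  have hP0 : Ideal.span {(p : 𝓞 h.k), s} ≠ ⊥ := fun e => hp (by rw [← hsq, e, sq, Ideal.bot_mul])
  set u : (h.k)ˣ := Units.mk0 p (by exact_mod_cast hp0) with hu
  set d : Q0ˣ := Units.mk0 p (by exact_mod_cast hp0) with hd
  have hP2 : mkI _ hP0 ^ 2 = prin h.k u := by
    rw [← mkI_pow _ 2 hP0 (by rwa [hsq])]
    simp only [hsq]
    exact mkI_span _ _ (by simp [hu]) _
  have hud : prin h.k u = extI (incl h.isQuadk.le) (prin Q0 d) := by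
    rw [extI_prin]
    congr 1
  refine ⟨mkI _ hP0, u, d, rfl, rfl, hP2, ?_, fun e => ?_⟩
  · exact h.isQuadk.quadInv.nmI_eq_of_sq (hP2.trans hud)
  · obtain ⟨z, hz⟩ := cl_eq_one_iff.1 e
    have := Fact.mk h.pp
    have := Fact.mk h.qp
    have h1 : z ^ 2 * u⁻¹ ∈ (prin h.k).ker := by
      rw [MonoidHom.mem_ker, map_mul, map_pow, hz, hP2, map_inv, mul_inv_cancel]
    obtain ⟨ε, hε, h2⟩ : ∃ ε : ℤ, (ε = 1 ∨ ε = -1) ∧ (z : h.k) ^ 2 = ε * p := by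
      have hu0 : (u : h.k) = p := rfl
      rcases h.unit_k h1 with h3 | h3 <;> push_cast at h3 <;>
        rw [mul_inv_eq_iff_eq_mul₀ u.ne_zero, hu0] at h3
      · exact ⟨1, Or.inl rfl, by simpa using h3⟩
      · exact ⟨-1, Or.inr rfl, by simpa using h3⟩
    have hz2 : h.isQuadk.conj z ^ 2 = (z : h.k) ^ 2 := by
      rw [← map_pow, h2, map_mul, map_intCast, map_natCast]
    have hl : ∀ l : ℕ, l.Prime → ¬(l : ℤ) ∣ 1 := fun l hl h3 =>
      hl.one_lt.ne' (by exact_mod_cast Int.eq_one_of_dvd_one (by lia) h3)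
    have hp0' : (p : Q0) ≠ 0 := by exact_mod_cast hp0
    rcases sq_eq_sq_iff_eq_or_eq_neg.1 hz2 with h3 | h3
    · obtain ⟨x, hx⟩ := h.isQuadk.eq_incl h3
      have hx' : x ^ 2 = ε * p := (incl h.isQuadk.le).injective (by
        rw [map_pow, show incl h.isQuadk.le x = z from Subtype.ext hx.symm, h2]
        simp)
      refine intCast_ne_mul_sq (l := p) (m := 1) (n := ε) h.two_p (hl p h.pp)
        (by rcases hε with rfl | rfl <;> simpa using hl p h.pp) (x / p) ?_
      rw [div_pow, hx']
      field_simp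
      simp
    · obtain ⟨y, hy⟩ := h.isQuadk.eq_mul_gen h3
      have hy' : p * (q * y ^ 2) = -ε * (p : Q0) := Subtype.ext (by
        have h4 := congrArg (Subtype.val : h.k → ℂ) h2
        have h5 := h.acI2
        push_cast at h4 h5 ⊢
        rw [hy] at h4
        linear_combination (y : ℂ) ^ 2 * h5 - h4)
      refine intCast_ne_mul_sq (l := q) (m := 1) (n := -ε) h.two_q (hl q h.qp)
        (by rcases hε with rfl | rfl <;> simpa using hl q h.qp) y ?_
      apply mul_left_cancel₀ hp0'
      push_cast
      linear_combination -hy'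

/-- Relation between the classes of the primes of `ℚ(√(-pq))` above `2` and `p`. -/
theorem Setup.class_group_k {B : FI h.k} {d : Q0ˣ} (hd : (d : Q0) = 2)
    (hB : nmI h.isQuadk.quadInv B = prin Q0 d) :
    (orderOf (cl h.k B)).factorization 2 = (Nat.card (ClassGroup (𝓞 h.k))).factorization 2 ∧
    (¬∃ (J : FI h.k) (z : (h.k)ˣ), (z : h.k) = 2 ∧ J ^ 2 = prin h.k z) ∧
    ∃ (n : ℕ) (P : FI h.k) (u z : (h.k)ˣ), 0 < n ∧ orderOf (cl h.k B) = 4 * n ∧ (u : h.k) = p ∧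
      P ^ 2 = prin h.k u ∧ B ^ (2 * n) = prin h.k z * P := by
  obtain ⟨P, u, d', hu, hd', hP2, hPN, hP1⟩ := h.exists_prime_p
  have hp0 : p ≠ 0 := h.pp.ne_zero
  have hN2 : ∀ {J : FI h.k}, nmI h.isQuadk.quadInv J = prin Q0 d → ¬∃ x, cl h.k J = x ^ 2 :=
    fun hJ => h.not_sq_k (r := 2) (by simp [hd]) two_pos hJ (by
      intro _ x y e
      refine one_ne_zero (padic_form_anisotropic (l := p) h.two_p h.p_not_dvd_q (w := 1) (x := x)
        (y := y) ?_)
      push_cast at e ⊢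
      rw [one_pow, mul_one, e]; ring)
  have hBs := hN2 hB
  have hPB : ¬∃ x, cl h.k (P * B) = x ^ 2 := h.not_sq_k (r := 2 * p) (d := d' * d)
    (by simp [hd, hd', mul_comm]) (by lia) (by rw [map_mul, hPN, hB, map_mul]) (by
      intro _ x y e
      refine one_ne_zero (padic_form_anisotropic (l := p) h.two_q_p h.p_not_dvd_q (w := 1)
        (x := q * y) (y := x / p) ?_)
      have hp0' : (p : ℚ_[p]) ≠ 0 := by exact_mod_cast hp0
      push_cast at e ⊢
      field_simp
      linear_combination (q : ℚ_[p]) * e)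
  have hPs : ∃ y, cl h.k P = y ^ 2 := by
    rcases exists_mul_sq h.card_k hBs (cl h.k P) with h1 | ⟨y, hy⟩
    · exact h1
    · exact absurd ⟨cl h.k B * y, by rw [map_mul, hy, mul_pow, sq (cl h.k B), mul_right_comm]⟩ hPB
  have hPt : cl h.k P ^ 2 = 1 := by rw [← map_pow, cl_eq_one_iff]; exact ⟨u, hP2.symm⟩
  refine ⟨factorization_two_orderOf h.card_k hBs, ?_, ?_⟩
  · rintro ⟨J, z, hz, hJ⟩
    have hJN : nmI h.isQuadk.quadInv J = prin Q0 d := by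
      have : J ^ (2 * 1) = extI (incl h.isQuadk.le) (prin Q0 d) := by
        rw [mul_one, hJ, extI_prin]
        congr 1
        exact Units.ext (by rw [hz]; exact (congrArg (incl h.isQuadk.le) hd |>.trans (map_ofNat _ 2)).symm)
      exact h.isQuadk.quadInv.nmI_eq_of_sq this
    apply hN2 hJN
    by_cases h1 : cl h.k J = 1
    · exact ⟨1, by rw [h1, one_pow]⟩
    · rwa [eq_of_two_torsion h.card_k (by rw [← map_pow, cl_eq_one_iff]; exact ⟨z, hJ.symm⟩) hPt
        h1 hP1]
  · obtain ⟨n, hn, ho, hBn⟩ := exists_orderOf_eq_four_mul h.card_k hBs hPt hP1 hPs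
    obtain ⟨z, hz⟩ := cl_eq_one_iff.1 (show cl h.k (B ^ (2 * n) * P⁻¹) = 1 by
      rw [map_mul, map_inv, map_pow, hBn, mul_inv_cancel])
    exact ⟨n, P, u, z, hn, ho, hu, hP2, by rw [hz, inv_mul_cancel_right]⟩

end

section

variable {p q : ℕ} {a b c : ℂ} (h : Setup p q a b c)
include h

theorem Setup.conj_comp_incl :
    h.isQuadL.conj.comp (incl h.k_le_L) = (incl h.k_le_L).comp h.isQuadk.conj := by
  ext x
  obtain ⟨u, v, e1, e2⟩ := h.isQuadk.eq_coords x
  have e1' := congrArg (Subtype.val : h.k → ℂ) e1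
  have e2' := congrArg (Subtype.val : h.k → ℂ) e2
  push_cast at e1' e2'
  rw [coe_incl, coe_incl] at e1' e2'
  rw [RingHom.comp_apply, RingHom.comp_apply, coe_incl, e2',
    h.isQuadL.coe_conj (a := u) (b := v * a) (h.isQuadR.le u.2)
      (mul_mem (h.isQuadR.le v.2) h.a_mem_R) (by rw [coe_incl, e1']; ring)]
  ring

theorem Setup.nmI_L_ext (B : FI h.k) : nmI h.isQuadL.quadInv (extI (incl h.k_le_L) B) =
    extI (incl h.isQuadR.le) (nmI h.isQuadk.quadInv B) := by
  apply extI_injective (incl h.isQuadL.le)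
  rw [extI_nmI, extI_comp, h.conj_comp_incl, ← extI_comp h.isQuadk.conj (incl h.k_le_L), ← map_mul,
    ← extI_nmI h.isQuadk.quadInv,
    extI_incl h.isQuadk.le h.k_le_L (h.isQuadR.le.trans h.isQuadL.le),
    extI_incl h.isQuadR.le h.isQuadL.le (h.isQuadR.le.trans h.isQuadL.le)]

/-- The prime above `2` in the degree `16` field is not a square in the class group. -/
theorem Setup.not_sq_K {B : FI h.k} {D : FI h.K} {d : Q0ˣ} (hd : (d : Q0) = 2)
    (hB : nmI h.isQuadk.quadInv B = prin Q0 d) (hD : D ^ 4 = extI (incl h.k_le_K) B) :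
    ¬∃ x, cl h.K D = x ^ 2 := by
  intro hsq
  have := Fact.mk h.qp
  obtain ⟨y, J, hDJ⟩ := exists_of_cl_eq_sq hsq
  have h1 : nmI h.isQuadL2.quadInv (nmI h.isQuadKL.quadInv D) = extI (incl h.k_le_L) B :=
    h.isQuadL2.quadInv.nmI_nmI_eq h.isQuadKL.quadInv (by
      rw [hD, extI_incl _ _ (h.k_le_L.trans h.isQuadL2.le), extI_incl])
  obtain ⟨y1, -, hy1⟩ := nmI_prin h.isQuadKL.quadInv y
  obtain ⟨y2, -, hy2⟩ := nmI_prin h.isQuadL2.quadInv y1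
  rw [hDJ, map_mul, map_pow, hy1, map_mul, map_pow, hy2] at h1
  have h3 := h.nmI_L_ext B
  rw [hB, extI_prin] at h3
  obtain ⟨u, hu, x, z, e⟩ := h.isQuadL.norm_descent h.odd_R (n := q) (by rw [h.cI2]; simp) h3 h1.symm
  have e' : (2 : h.R) = u * (x ^ 2 + q * z ^ 2) := by
    rw [← show ((q : ℤ) : h.R) = q by simp, ← e]
    exact (congrArg (incl h.isQuadR.le) hd |>.trans (map_ofNat _ 2)).symm
  have hpos : ∀ f : h.R →+* ℝ, 0 < f u := fun f => by
    have h4 := congrArg f e'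
    simp only [map_mul, map_add, map_pow, map_natCast, map_ofNat] at h4
    have h5 : (0 : ℝ) ≤ f x ^ 2 + q * f z ^ 2 := by positivity
    by_contra h6
    nlinarith
  obtain ⟨f⟩ := h.allReal_R.exists_real
  obtain ⟨w, hw⟩ := h.sq_of_pos hu f (hpos f) (hpos (f.comp h.isQuadR.conj))
  obtain ⟨g⟩ := h.exists_hom_R
  have h4 := congrArg g e'
  rw [hw] at h4
  simp only [map_mul, map_add, map_pow, map_natCast, map_ofNat] at h4
  refine one_ne_zero (padic_form_anisotropic (l := q) h.two_q (s := 1) (w := 1) (x := g w * g x)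
    (y := g w * g z) ?_ ?_)
  · exact fun hd => h.qp.one_lt.ne' (by exact_mod_cast Int.eq_one_of_dvd_one (by positivity) hd)
  · push_cast
    linear_combination h4

/-- The class of the prime above `2` in `ℚ(√(-pq))` has order dividing the one upstairs. -/
theorem Setup.orderOf_dvd {B : FI h.k} {D : FI h.K} (hD : D ^ 4 = extI (incl h.k_le_K) B)
    (h2 : ¬∃ (J : FI h.k) (z : (h.k)ˣ), (z : h.k) = 2 ∧ J ^ 2 = prin h.k z) :
    orderOf (cl h.k B) ∣ orderOf (cl h.K D) := by
  set n := orderOf (cl h.K D) with hn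
  obtain ⟨x, hx⟩ := cl_eq_one_iff.1 (show cl h.K (D ^ n) = 1 by rw [map_pow, pow_orderOf_eq_one])
  have h1 : nmI h.isQuadM.quadInv (nmI h.isQuadKM.quadInv D) = extI (incl h.isQuadF.le) B :=
    h.isQuadM.quadInv.nmI_nmI_eq h.isQuadKM.quadInv (by
      rw [hD, extI_incl _ _ (h.isQuadF.le.trans h.isQuadM.le), extI_incl])
  obtain ⟨y1, -, hy1⟩ := nmI_prin h.isQuadKM.quadInv x
  obtain ⟨y, -, hy⟩ := nmI_prin h.isQuadM.quadInv y1
  have h3 : extI (incl h.isQuadF.le) (B ^ n) = prin h.F y := by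
    rw [map_pow, ← h1, ← map_pow, ← map_pow, ← hx, hy1, hy]
  set σ := h.isQuadF.conj with hσ
  have hinv : ∀ z : h.F, σ (σ z) = z := h.isQuadF.quadInv.invol
  have h4 : prin h.F (um σ y) = prin h.F y := by
    rw [← extI_prin σ, ← h3, extI_fix h.isQuadF.quadInv]
  have hv : y * (um σ y)⁻¹ ∈ (prin h.F).ker := by
    rw [MonoidHom.mem_ker, map_mul, map_inv, h4, mul_inv_cancel]
  have hσy : σ (y : h.F) ≠ 0 := (um σ y).ne_zero
  have hval : ((y * (um σ y)⁻¹ : (h.F)ˣ) : h.F) = y / σ y := by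
    rw [Units.val_mul, Units.val_inv_eq_inv_val, div_eq_mul_inv]; rfl
  obtain ⟨w, hw, e⟩ := h.unit_F hv (by
    rw [hval, map_div₀, ← hσ, hinv]
    field_simp)
  rw [hval, ← hσ, div_mul_eq_mul_div, div_eq_iff hσy, div_eq_iff hσy] at e
  set t := y * um σ w with ht
  have hpt : prin h.F t = extI (incl h.isQuadF.le) (B ^ n) := by
    rw [ht, map_mul, h3, MonoidHom.mem_ker.1 (um_mem_prin_ker σ hw), mul_one]
  have htv : (t : h.F) = y * σ w := rfl
  have hσt : σ t = σ y * w := by rw [htv, map_mul, hinv]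
  rw [orderOf_dvd_iff_pow_eq_one, ← map_pow, cl_eq_one_iff]
  rcases e with e | e
  · obtain ⟨z, hz⟩ := h.isQuadF.eq_incl (z := (t : h.F)) (by
      rw [← hσ, hσt, htv, e, mul_comm])
    have hz0 : z ≠ 0 := by
      rintro rfl
      exact t.ne_zero (Subtype.ext (by simp at hz))
    refine ⟨Units.mk0 z hz0, extI_injective (incl h.isQuadF.le) ?_⟩
    rw [← hpt, extI_prin]
    congr 1
    exact Units.ext (Subtype.ext hz.symm)
  · obtain ⟨z, hz⟩ := h.isQuadF.eq_mul_gen (z := (t : h.F)) (by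
      rw [← hσ, hσt, htv]
      linear_combination e)
    have hz0 : z ≠ 0 := by
      rintro rfl
      exact t.ne_zero (Subtype.ext (by simp at hz))
    refine absurd ⟨B ^ n * (prin h.k (Units.mk0 z hz0))⁻¹, Units.mk0 2 two_ne_zero, rfl,
      extI_injective (incl h.isQuadF.le) ?_⟩ h2
    rw [map_pow, map_mul, ← hpt, map_inv, extI_prin, extI_prin, ← map_inv, ← map_mul, ← map_pow]
    congr 1
    refine Units.ext (Subtype.ext ?_)
    have hz0' : (z : ℂ) ≠ 0 := by exact_mod_cast hz0
    rw [sq]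
    show ((t : h.F) : ℂ) * (z : ℂ)⁻¹ * (((t : h.F) : ℂ) * (z : ℂ)⁻¹) = 2
    rw [hz, ← h.b2]
    field_simp

end

section

section
variable {X K : Type*} [Field X] [NumberField X] [Field K] [NumberField K]

/-- Fractional ideals with an odd power that becomes principal after extension. -/
def oddPrin (f : X →+* K) : Subgroup (FI X) where
  carrier := {J | ∃ n, Odd n ∧ ∃ x, prin K x = extI f J ^ n}
  one_mem' := ⟨1, odd_one, 1, by simp⟩
  mul_mem' := by
    rintro J J' ⟨n, hn, x, hx⟩ ⟨m, hm, y, hy⟩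
    refine ⟨n * m, hn.mul hm, x ^ m * y ^ n, ?_⟩
    rw [map_mul, map_pow, map_pow, hx, hy, map_mul, mul_pow, ← pow_mul, ← pow_mul, mul_comm m n]
  inv_mem' := by
    rintro J ⟨n, hn, x, hx⟩
    exact ⟨n, hn, x⁻¹, by rw [map_inv, map_inv, hx, inv_pow]⟩

theorem mem_oddPrin {f : X →+* K} {J : FI X} :
    J ∈ oddPrin f ↔ ∃ n, Odd n ∧ ∃ x, prin K x = extI f J ^ n := Iff.rfl

theorem prin_mem_oddPrin (f : X →+* K) (x : Xˣ) : prin X x ∈ oddPrin f :=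
  ⟨1, odd_one, um f x, by rw [extI_prin, pow_one]⟩

theorem mem_oddPrin_of_extI {Y : Type*} [Field Y] [NumberField Y] {f : X →+* K} {g : Y →+* K}
    (hodd : Odd (Nat.card (ClassGroup (𝓞 Y)))) {J : FI X} {J' : FI Y}
    (e : extI f J = extI g J') : J ∈ oddPrin f := by
  obtain ⟨x, hx⟩ := pow_card_class J'
  exact ⟨_, hodd, um g x, by rw [e, ← map_pow, ← hx, extI_prin]⟩

theorem eq_top_of_map_eq_top (f : X →+* K) {J : Ideal (𝓞 X)}
    (e : J.map (RingOfIntegers.mapRingHom f) = ⊤) : J = ⊤ := by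
  have h0 : J ≠ ⊥ := by
    rintro rfl
    rw [Ideal.map_bot] at e
    exact bot_ne_top e
  have h1 : extI f (mkI J h0) = extI f (mkI ⊤ top_ne_bot) := by
    rw [extI_mkI, extI_mkI]
    simp only [e, Ideal.map_top]
  exact mkI_inj (extI_injective f h1)

end

section
variable {R : Type*} [CommRing R] {s x r k : R}

theorem span_pair_mul_span_pair_shift (e : x * (x + r) = s ^ 2 * k) (hc : IsCoprime (s ^ 2) r) :
    Ideal.span {s, x} * Ideal.span {s, x + r} = Ideal.span {s} := by
  rw [Ideal.span_pair_mul_span_pair]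
  apply le_antisymm
  · rw [Ideal.span_le]
    rintro y hy
    simp only [Set.mem_insert_iff, Set.mem_singleton_iff] at hy
    rw [SetLike.mem_coe, Ideal.mem_span_singleton]
    rcases hy with rfl | rfl | rfl | rfl
    · exact dvd_mul_right _ _
    · exact dvd_mul_right _ _
    · exact dvd_mul_left _ _
    · exact ⟨s * k, by rw [e]; ring⟩
  · rw [Ideal.span_singleton_le_iff_mem]
    obtain ⟨u, v, huv⟩ := hc
    set J := Ideal.span {s * s, s * (x + r), x * s, x * (x + r)} with hJ
    have h1 : s * s ∈ J := Ideal.subset_span (by simp)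
    have h2 : s * (x + r) ∈ J := Ideal.subset_span (by simp)
    have h3 : x * s ∈ J := Ideal.subset_span (by simp)
    convert add_mem (J.mul_mem_left (u * s) h1) (J.mul_mem_left v (sub_mem h2 h3)) using 1
    linear_combination -s * huv

theorem span_pair_sq_shift (e : x * (x + r) = s ^ 2 * k) (hc : IsCoprime (s ^ 2) r) :
    Ideal.span {s, x} ^ 2 = Ideal.span {s ^ 2, x} := by
  rw [sq, Ideal.span_pair_mul_span_pair]
  apply le_antisymm
  · rw [Ideal.span_le]
    have h1 : s ^ 2 ∈ Ideal.span {s ^ 2, x} := Ideal.subset_span (by simp)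
    have h2 : x ∈ Ideal.span {s ^ 2, x} := Ideal.subset_span (by simp)
    rintro y hy
    simp only [Set.mem_insert_iff, Set.mem_singleton_iff] at hy
    rw [SetLike.mem_coe]
    rcases hy with rfl | rfl | rfl | rfl
    · rwa [← sq]
    · exact Ideal.mul_mem_left _ _ h2
    · exact Ideal.mul_mem_right _ _ h2
    · exact Ideal.mul_mem_left _ _ h2
  · obtain ⟨u, v, huv⟩ := hc
    set J := Ideal.span {s * s, s * x, x * s, x * x} with hJ
    have h1 : s * s ∈ J := Ideal.subset_span (by simp)
    have h2 : x * x ∈ J := Ideal.subset_span (by simp)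
    rw [Ideal.span_le]
    rintro y hy
    simp only [Set.mem_insert_iff, Set.mem_singleton_iff] at hy
    rcases hy with rfl | rfl
    · rwa [sq]
    · rw [SetLike.mem_coe]
      convert add_mem (J.mul_mem_left (u * y + v * k) h1) (J.mul_mem_left (-v) h2) using 1
      linear_combination -y * huv + v * e

end

theorem coe_mapRingHom_incl {X K : IntermediateField ℚ ℂ} (hXK : X ≤ K) (x : 𝓞 X) :
    ((RingOfIntegers.mapRingHom (incl hXK) x : K) : ℂ) = ((x : X) : ℂ) := rfl

variable {p q : ℕ} {a b c : ℂ} (h : Setup p q a b c)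
include h

theorem Setup.S_le_K : h.S ≤ h.K := by
  rw [Setup.S, IntermediateField.adjoin_le_iff]
  rintro x (rfl | rfl | hx)
  · exact h.c_mem_K
  · exact h.a_mem_K
  · exact absurd hx (Set.notMem_empty _)

theorem Setup.L_le_K : h.L ≤ h.K := h.isQuadL2.le.trans h.isQuadKL.le

/-- The ramified primes of `ℚ(√p, √(-q)) / ℚ(√p)` have an odd power that becomes principal in the
degree `16` field. -/
theorem Setup.ramified_mem_oddPrin {P : Ideal (𝓞 h.L)} (h0 : P ≠ ⊥) (hP : P.IsPrime) {s : 𝓞 h.L}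
    (hs : ((s : h.L) : ℂ) = c * I) (hsP : s ∈ P) : mkI P h0 ∈ oddPrin (incl h.L_le_K) := by
  obtain ⟨αR, hαR⟩ := exists_sqrt_int h.a_mem_R p (by rw [h.a2]; simp)
  obtain ⟨α, hα⟩ := exists_sqrt_int h.a_mem_L p (by rw [h.a2]; simp)
  obtain ⟨αS, hαS⟩ := exists_sqrt_int h.a_mem_S p (by rw [h.a2]; simp)
  obtain ⟨γ, hγ⟩ := exists_sqrt_int h.c_mem_S q (by rw [h.c2]; simp)
  obtain ⟨i, hi⟩ := exists_sqrt_int h.I_mem_K (-1) (by simp)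
  have hs2 : s ^ 2 = -(q : 𝓞 h.L) := oext (by push_cast; rw [hs, h.cI2])
  have hα2 : α ^ 2 = (p : 𝓞 h.L) := oext (by push_cast; rw [hα, h.a2])
  -- the two factors of the ramified prime
  have main : ∀ t : ℤ, (q : ℤ) ∣ t ^ 2 - p → α - t ∈ P → mkI P h0 ∈ oddPrin (incl h.L_le_K) := by
    intro t ht htP
    have hqt : ¬(q : ℤ) ∣ t := fun hd => by
      apply h.q_not_dvd_p
      have := dvd_sub (dvd_pow hd two_ne_zero) ht
      simpa using this
    have hco : IsCoprime (s ^ 2) (2 * t : 𝓞 h.L) := by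
      have h1 : IsCoprime (q : ℤ) (2 * t) := by
        rw [Prime.coprime_iff_not_dvd (Nat.prime_iff_prime_int.1 h.qp)]
        intro hd
        rcases (Nat.prime_iff_prime_int.1 h.qp).dvd_mul.1 hd with h2 | h2
        · have h3 : q ∣ 2 := by exact_mod_cast h2
          exact h.q_ne_two ((Nat.prime_dvd_prime_iff_eq h.qp Nat.prime_two).1 h3)
        · exact hqt h2
      rw [hs2, IsCoprime.neg_left_iff]
      simpa using h1.map (Int.castRingHom (𝓞 h.L))
    obtain ⟨k, hk⟩ := ht
    have hk' : (t : 𝓞 h.L) ^ 2 - p = q * k := by exact_mod_cast congrArg (Int.cast (R := 𝓞 h.L)) hk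
    have e1 : (α - t) * (α - t + 2 * t) = s ^ 2 * k := by
      rw [hs2]; linear_combination hα2 - hk'
    have e2 : (α - t + 2 * t) * (α - t + 2 * t + -(2 * t)) = s ^ 2 * k := by
      rw [← e1]; ring
    set Q := Ideal.span {s, α - t} with hQ
    set Q' := Ideal.span {s, α - t + 2 * t} with hQ'
    have hQQ' : Q * Q' = Ideal.span {s} := span_pair_mul_span_pair_shift e1 hco
    have hQP : Q ≤ P := by
      rw [hQ, Ideal.span_le]
      rintro x (rfl | rfl)
      · exact hsP
      · exact htP
    have hQtop : Q ≠ ⊤ := fun e => hP.ne_top (top_le_iff.1 (e ▸ hQP))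
    have hs0 : s ≠ 0 := fun e => by
      rw [e] at hs2
      have h3 : (q : 𝓞 h.L) = 0 := by simpa using hs2.symm
      exact h.qp.ne_zero (by exact_mod_cast h3)
    have hmapα : RingOfIntegers.mapRingHom (incl h.isQuadL.le) αR = α :=
      oext (by rw [coe_mapRingHom_incl, hαR, hα])
    have hspan : ∀ x : 𝓞 h.L, Ideal.span {s ^ 2, x} = Ideal.span {(q : 𝓞 h.L), x} := fun x => by
      rw [hs2]
      simp only [Ideal.span_insert, Ideal.span_singleton_neg]
    have hQ'top : Q' ≠ ⊤ := by
      intro e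
      have h1 := span_pair_sq_shift e2 hco.neg_right
      rw [← hQ', e, hspan, Ideal.top_pow] at h1
      have h2 : Ideal.span {(q : 𝓞 h.R), αR + t} = ⊤ := by
        apply eq_top_of_map_eq_top (incl h.isQuadL.le)
        rw [Ideal.map_span, Set.image_pair, map_natCast, map_add, map_intCast, hmapα, h1]
        congr 3
        ring
      have h3 : Ideal.span {(q : 𝓞 h.R), αR - t} = ⊤ := by
        rw [Ideal.eq_top_iff_one, Ideal.mem_span_pair] at h2 ⊢
        obtain ⟨u, v, huv⟩ := h2
        set τ := RingOfIntegers.mapRingHom h.isQuadR.conj with hτ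
        have hτα : τ αR = -αR := oext (by
          rw [hτ, coe_mapRingHom, h.isQuadR.coe_conj (a := 0) (b := 1) (zero_mem _) (one_mem _)
            (by rw [hαR]; ring)]
          push_cast
          rw [hαR]; ring)
        refine ⟨τ u, -τ v, ?_⟩
        have h4 := congrArg τ huv
        rw [map_add, map_mul, map_mul, map_natCast, map_add, map_intCast, hτα, map_one] at h4
        linear_combination h4
      have h4 := span_pair_sq_shift e1 hco
      have h5 := congrArg (Ideal.map (RingOfIntegers.mapRingHom (incl h.isQuadL.le))) h3
      rw [Ideal.map_span, Set.image_pair, map_natCast, map_sub, map_intCast, hmapα, Ideal.map_top,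
        ← hspan, ← h4, ← hQ] at h5
      exact hQtop (top_le_iff.1 (h5 ▸ Ideal.pow_le_self two_ne_zero))
    have hnorm : Ideal.absNorm Q * Ideal.absNorm Q' = q ^ 2 := by
      have h1 : (Ideal.absNorm Q * Ideal.absNorm Q') ^ 2 = (q ^ 2) ^ 2 := by
        rw [← map_mul, hQQ', ← map_pow, Ideal.span_singleton_pow, hs2, Ideal.span_singleton_neg,
          absNorm_span_nat, h.finrank_L, ← pow_mul]
      exact Nat.pow_left_injective two_ne_zero h1
    have hQn : Ideal.absNorm Q = q :=
      ((Nat.Prime.mul_eq_prime_sq_iff h.qp (by rwa [Ne, Ideal.absNorm_eq_one_iff])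
        (by rwa [Ne, Ideal.absNorm_eq_one_iff])).1 hnorm).1
    have hQp : Q.IsPrime := Ideal.isPrime_of_irreducible_absNorm (by rw [hQn]; exact h.qp)
    have hQ0 : Q ≠ ⊥ := fun e => hs0 (by
      have : s ∈ Q := Ideal.subset_span (by simp)
      rw [e] at this
      simpa using this)
    have hQP' : Q = P := (hQp.isMaximal hQ0).eq_of_le hP.ne_top hQP
    have hT0 : Ideal.span {γ, αS - t} ≠ ⊥ := fun e => by
      have : γ ∈ Ideal.span {γ, αS - t} := Ideal.subset_span (by simp)
      rw [e] at this
      have h1 : γ = 0 := by simpa using this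
      rw [h1] at hγ
      apply h.qp.ne_zero
      have := h.c2
      rw [← hγ] at this
      exact_mod_cast (by simpa using this.symm : (q : ℂ) = 0)
    apply mem_oddPrin_of_extI (g := incl h.S_le_K) h.odd_S (J' := mkI (Ideal.span {γ, αS - t}) hT0)
    rw [extI_mkI, extI_mkI]
    have : P.map (RingOfIntegers.mapRingHom (incl h.L_le_K)) =
        (Ideal.span {γ, αS - t}).map (RingOfIntegers.mapRingHom (incl h.S_le_K)) := by
      rw [← hQP', hQ, Ideal.map_span, Ideal.map_span, Set.image_pair, Set.image_pair, map_sub,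
        map_sub, map_intCast, map_intCast]
      have h1 : RingOfIntegers.mapRingHom (incl h.L_le_K) α =
          RingOfIntegers.mapRingHom (incl h.S_le_K) αS :=
        oext (by rw [coe_mapRingHom_incl, coe_mapRingHom_incl, hα, hαS])
      have h2 : RingOfIntegers.mapRingHom (incl h.L_le_K) s =
          RingOfIntegers.mapRingHom (incl h.S_le_K) γ * i :=
        oext (by
          push_cast
          rw [coe_mapRingHom_incl, coe_mapRingHom_incl, hs, hγ, hi])
      have hiu : IsUnit i := IsUnit.of_mul_eq_one (-i) (oext (by
        push_cast
        rw [hi]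
        linear_combination -I_sq))
      rw [h1, h2, Ideal.span_insert, Ideal.span_insert, Ideal.span_singleton_mul_right_unit hiu]
    simp only [this]
  obtain ⟨t, ht⟩ := h.leg
  have hmem : (α - t) * (α + t) ∈ P := by
    obtain ⟨k, hk⟩ := ht
    have hk' : (t : 𝓞 h.L) ^ 2 - p = q * k := by exact_mod_cast congrArg (Int.cast (R := 𝓞 h.L)) hk
    have : (α - t) * (α + t) = s * (s * k) := by
      linear_combination hα2 - hk' - (k : 𝓞 h.L) * hs2
    rw [this]
    exact P.mul_mem_right _ hsP
  rcases hP.mem_or_mem hmem with h1 | h1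
  · exact main t ht h1
  · exact main (-t) (by simpa using ht) (by simpa using h1)

theorem Setup.invariant_mem_oddPrin {J : FI h.L} (hJ : extI h.isQuadL.conj J = J) :
    J ∈ oddPrin (incl h.L_le_K) := by
  refine invariant_le h.isQuadL.quadInv (oddPrin (incl h.L_le_K)) ?_ ?_ ?_
  · rintro _ ⟨J, rfl⟩
    exact mem_oddPrin_of_extI (g := incl (h.isQuadL.le.trans h.L_le_K)) h.odd_R
      (extI_incl h.isQuadL.le h.L_le_K _ J)
  · intro P h0 hP hs
    by_cases hα : ∀ α, RingOfIntegers.mapRingHom h.isQuadL.conj α - α ∈ P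
    · obtain ⟨w, hw⟩ := h.exists_half_cI h.cI_mem_L
      obtain ⟨x, hx⟩ := exists_sqrt_int h.cI_mem_L (-q) (by rw [h.cI2]; simp)
      exact h.ramified_mem_oddPrin h0 hP hx (h.isQuadL.ramified_mem hα (x := w) (y := x) (a := 1 / 2)
        (b := 1 / 2) (div_mem (one_mem _) (ofNat_mem _ 2)) (div_mem (one_mem _) (ofNat_mem _ 2))
        (by rw [hw]; ring) (by rw [hx]; ring))
    · push Not at hα
      obtain ⟨α, hα⟩ := hα
      obtain ⟨J, hJ⟩ := unramified_mem h.isQuadL.quadInv P h0 hs hα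
      rw [← hJ]
      exact mem_oddPrin_of_extI (g := incl (h.isQuadL.le.trans h.L_le_K)) h.odd_R
        (extI_incl h.isQuadL.le h.L_le_K _ J)
  · rw [mem_ker_df, hJ]

end

section

/-- An explicit form of Hilbert 90 for an element whose norm is a square. -/
theorem IsQuad.exists_sq_eq_mul {X K : IntermediateField ℚ ℂ} {s : ℂ} [NumberField X] [NumberField K]
    (h : IsQuad X K s) {β c : K} (hc : c ≠ 0) (hσc : h.conj c = c)
    (e : β * h.conj β = c ^ 2) : ∃ (γ : Kˣ) (δ : Xˣ), (γ : K) ^ 2 = β * incl h.le δ := by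
  suffices ∃ γ δ : K, γ ≠ 0 ∧ h.conj δ = δ ∧ γ ^ 2 = β * δ by
    obtain ⟨γ, δ, hγ, hδ, e1⟩ := this
    obtain ⟨x, hx⟩ := h.eq_incl hδ
    have hx' : δ = incl h.le x := Subtype.ext hx
    have hx0 : x ≠ 0 := by
      rintro rfl
      rw [hx', map_zero, mul_zero] at e1
      exact hγ (pow_eq_zero_iff two_ne_zero |>.1 e1)
    exact ⟨Units.mk0 γ hγ, Units.mk0 x hx0, by rw [Units.val_mk0, Units.val_mk0, e1, hx']⟩
  by_cases h0 : β + c = 0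
  · exact ⟨c, -c, hc, by rw [map_neg, hσc], by rw [eq_neg_of_add_eq_zero_left h0]; ring⟩
  · refine ⟨β + c, β + h.conj β + 2 * c, h0, ?_, by linear_combination -e⟩
    have hi : h.conj (h.conj β) = β := h.quadInv.invol β
    rw [map_add, map_add, map_mul, map_ofNat, hσc, hi, add_comm (h.conj β)]

variable {p q : ℕ} {a b c : ℂ} (h : Setup p q a b c)
include h

theorem Setup.norm_k_nonneg (z : h.k) {y : Q0} (hy : incl h.isQuadk.le y = z * h.isQuadk.conj z) :
    0 ≤ homQ0 ℝ y := by
  obtain ⟨u, v, e1, e2⟩ := h.isQuadk.eq_coords z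
  have h1 : y = u ^ 2 + p * q * v ^ 2 := (incl h.isQuadk.le).injective (by
    have h2 : (⟨a * c * I, h.isQuadk.mem⟩ : h.k) ^ 2 = -(p * q) := Subtype.ext (by
      have := h.acI2
      push_cast at this ⊢
      exact this)
    rw [hy, e2, e1]
    simp only [map_add, map_mul, map_pow, map_natCast]
    linear_combination -(incl h.isQuadk.le v) ^ 2 * h2)
  rw [h1]
  simp only [map_add, map_mul, map_pow, map_natCast]
  positivity

/-- The order of the prime above `2` in the degree `16` field divides, up to an odd factor, its
order in `ℚ(√(-pq))`. -/
theorem Setup.orderOf_dvd_mul_odd {B : FI h.k} {D : FI h.K} {d : Q0ˣ} (hd : (d : Q0) = 2)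
    (hB : nmI h.isQuadk.quadInv B = prin Q0 d) (hD : D ^ 4 = extI (incl h.k_le_K) B)
    {n : ℕ} {P : FI h.k} {u z : (h.k)ˣ} (hu : (u : h.k) = p) (hP : P ^ 2 = prin h.k u)
    (hBP : B ^ (2 * n) = prin h.k z * P) :
    ∃ m, Odd m ∧ orderOf (cl h.K D) ∣ 4 * n * m := by
  have hp0 : p ≠ 0 := h.pp.ne_zero
  have ha0 : (⟨a, h.a_mem_L⟩ : h.L) ≠ 0 := fun e => by
    have h1 := h.a2
    rw [show a = 0 from congrArg Subtype.val e] at h1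
    apply hp0
    exact_mod_cast (by simpa using h1.symm : (p : ℂ) = 0)
  set α : (h.L)ˣ := Units.mk0 ⟨a, h.a_mem_L⟩ ha0 with hα
  have hPα : extI (incl h.k_le_L) P = prin h.L α := by
    apply FI_pow_left_injective two_ne_zero
    show extI (incl h.k_le_L) P ^ 2 = prin h.L α ^ 2
    rw [← map_pow, hP, extI_prin, ← map_pow]
    congr 1
    have h1 : incl h.k_le_L u = (⟨a, h.a_mem_L⟩ : h.L) ^ 2 := by
      rw [hu, map_natCast]
      exact Subtype.ext (by push_cast; exact h.a2.symm)
    exact Units.ext h1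
  set β : (h.L)ˣ := um (incl h.k_le_L) z * α with hβ
  set C := extI (incl h.k_le_L) (B ^ n) with hC
  have hβC : prin h.L β = C ^ 2 := by
    rw [hβ, map_mul, ← hPα, hC, ← map_pow, ← pow_mul, mul_comm n 2, hBP, map_mul, extI_prin]
  -- the relative norm of `β` is `4 ^ n`
  obtain ⟨y, hy, hyz⟩ := nmI_prin h.isQuadk.quadInv z
  set v : Q0ˣ := Units.mk0 p (by exact_mod_cast hp0) with hv
  have hPv : nmI h.isQuadk.quadInv P = prin Q0 v := by
    have h1 : P ^ (2 * 1) = extI (incl h.isQuadk.le) (prin Q0 v) := by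
      rw [mul_one, hP, extI_prin]
      congr 1
      exact Units.ext (by rw [hu]; exact (map_natCast (incl h.isQuadk.le) p).symm)
    simpa using h.isQuadk.quadInv.nmI_pow_eq h1
  have hker : y * v * (d ^ (2 * n))⁻¹ ∈ (prin Q0).ker := by
    have h1 := congrArg (nmI h.isQuadk.quadInv) hBP
    rw [map_pow, map_mul, hB, hyz, hPv] at h1
    rw [MonoidHom.mem_ker, map_mul, map_mul, map_inv, map_pow, h1, mul_inv_cancel]
  have hyv : (y : Q0) * p = 2 ^ (2 * n) := by
    have hv' : (v : Q0) = p := rfl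
    have h2n : (0 : ℝ) < 2 ^ (2 * n) := by positivity
    rcases unit_Q0 hker with h1 | h1 <;> push_cast at h1 <;>
      rw [← div_eq_mul_inv, div_eq_iff (pow_ne_zero _ d.ne_zero), hd, hv'] at h1
    · rw [h1, one_mul]
    · have h2 := congrArg (homQ0 ℝ) h1
      simp only [map_mul, map_pow, map_neg, map_one, map_natCast, map_ofNat] at h2
      have h3 := mul_nonneg (h.norm_k_nonneg z hy) (Nat.cast_nonneg (α := ℝ) p)
      linarith
  have hN : (β : h.L) * h.isQuadL.conj β = (2 ^ n) ^ 2 := by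
    have h1 : h.isQuadL.conj (α : h.L) = α := by
      refine Subtype.ext ?_
      rw [h.isQuadL.coe_conj (a := a) (b := 0) h.a_mem_R (zero_mem _) (by simp [hα])]
      simp [hα]
    have h2 : h.isQuadL.conj (incl h.k_le_L z) = incl h.k_le_L (h.isQuadk.conj z) :=
      RingHom.congr_fun h.conj_comp_incl z
    have h3 : (β : h.L) = incl h.k_le_L z * α := rfl
    have h4 : (α : h.L) ^ 2 = p := Subtype.ext (by simpa [hα] using h.a2)
    have h5 : incl h.k_le_L z * incl h.k_le_L (h.isQuadk.conj z) * p = 2 ^ (2 * n) := by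
      rw [← map_mul, ← show incl h.isQuadk.le y = z * h.isQuadk.conj z from hy]
      have := congrArg ((incl h.k_le_L).comp (incl h.isQuadk.le)) hyv
      simp only [map_mul, map_pow, map_natCast, map_ofNat] at this
      exact this
    rw [h3, map_mul, h1, h2, ← pow_mul, mul_comm n 2, ← h5, ← h4]
    ring
  obtain ⟨γ, δ, hγ⟩ := h.isQuadL.exists_sq_eq_mul (pow_ne_zero n two_ne_zero)
    (by rw [map_pow, map_ofNat]) hN
  have hγ' : prin h.L γ ^ 2 = C ^ 2 * extI (incl h.isQuadL.le) (prin h.R δ) := by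
    rw [← hβC, extI_prin, ← map_mul, ← map_pow]
    congr 1
    exact Units.ext hγ
  have hg : prin h.L γ * C⁻¹ ∈ oddPrin (incl h.L_le_K) := by
    apply h.invariant_mem_oddPrin
    apply FI_pow_left_injective two_ne_zero
    show extI h.isQuadL.conj (prin h.L γ * C⁻¹) ^ 2 = (prin h.L γ * C⁻¹) ^ 2
    have : (prin h.L γ * C⁻¹) ^ 2 = extI (incl h.isQuadL.le) (prin h.R δ) := by
      rw [mul_pow, hγ', inv_pow, mul_right_comm, mul_inv_cancel, one_mul]
    rw [← map_pow, this]
    exact extI_fix h.isQuadL.quadInv _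
  have hCo : C ∈ oddPrin (incl h.L_le_K) := by
    have := mul_mem (inv_mem hg) (prin_mem_oddPrin (incl h.L_le_K) γ)
    rwa [mul_inv, inv_inv, mul_right_comm, inv_mul_cancel, one_mul] at this
  obtain ⟨m, hm, x, hx⟩ := mem_oddPrin.1 hCo
  refine ⟨m, hm, ?_⟩
  rw [orderOf_dvd_iff_pow_eq_one, ← map_pow, cl_eq_one_iff]
  refine ⟨x, ?_⟩
  rw [hx, hC, extI_incl h.k_le_L h.L_le_K h.k_le_K, map_pow, ← hD, ← pow_mul, ← pow_mul, mul_assoc]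

/-- The class numbers of `ℚ(√2, √p, √q, i)` and `ℚ(√(-pq))` have the same `2`-part. -/
theorem Setup.factorization_card_K : (Nat.card (ClassGroup (𝓞 h.K))).factorization 2 =
    (Nat.card (ClassGroup (𝓞 h.k))).factorization 2 := by
  obtain ⟨B, D, d, hd, hB, hD⟩ := h.exists_prime_two
  obtain ⟨h1, h2, n, P, u, z, hn, ho, hu, hP, hBP⟩ := h.class_group_k hd hB
  obtain ⟨m, hm, hdvd⟩ := h.orderOf_dvd_mul_odd hd hB hD hu hP hBP
  rw [← ho] at hdvd
  have hBD := h.orderOf_dvd hD h2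
  have hB0 := (orderOf_pos (cl h.k B)).ne'
  have hm0 : m ≠ 0 := hm.pos.ne'
  rw [← factorization_two_orderOf h.card_K (h.not_sq_K hd hB hD), ← h1]
  refine le_antisymm ?_ ((Nat.factorization_le_iff_dvd hB0 (orderOf_pos _).ne').2 hBD 2)
  refine ((Nat.factorization_le_iff_dvd (orderOf_pos _).ne' (mul_ne_zero hB0 hm0)).2 hdvd 2).trans ?_
  rw [Nat.factorization_mul hB0 hm0, Finsupp.add_apply,
    Nat.factorization_eq_zero_of_not_dvd hm.not_two_dvd_nat, add_zero]

end

end TwoClass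

theorem twoClassNum_Qsqrt2_sqrtp_sqrtq_i_legendre_one
    (p q : ℕ) [Fact (Nat.Prime p)] [Fact (Nat.Prime q)]
    (hp : p % 8 = 5) (hq : q % 8 = 3) (hleg : legendreSym q (p : ℤ) = 1) :
    twoClassNum (IntermediateField.adjoin ℚ
        {((Real.sqrt 2 : ℝ) : ℂ), ((Real.sqrt p : ℝ) : ℂ),
          ((Real.sqrt q : ℝ) : ℂ), Complex.I}) =
    twoClassNum (IntermediateField.adjoin ℚ
        {((Real.sqrt (p * q) : ℝ) : ℂ) * Complex.I}) := by
  have hs : ∀ x : ℝ, 0 ≤ x → ((Real.sqrt x : ℝ) : ℂ) ^ 2 = (x : ℂ) := fun x hx => by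
    rw [← Complex.ofReal_pow, Real.sq_sqrt hx]
  have h : TwoClass.Setup p q (Real.sqrt p : ℝ) (Real.sqrt 2 : ℝ) (Real.sqrt q : ℝ) :=
    { pp := Fact.out
      qp := Fact.out
      p8 := hp
      q8 := hq
      leg := TwoClass.sq_of_legendre hleg
      a2 := by simpa using hs p p.cast_nonneg
      b2 := by simpa using hs 2 zero_le_two
      c2 := by simpa using hs q q.cast_nonneg }
  have hK : IntermediateField.adjoin ℚ {((Real.sqrt 2 : ℝ) : ℂ), ((Real.sqrt p : ℝ) : ℂ),
      ((Real.sqrt q : ℝ) : ℂ), Complex.I} = h.K := by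
    apply le_antisymm
    · rw [IntermediateField.adjoin_le_iff]
      rintro x (rfl | rfl | rfl | rfl)
      · exact h.b_mem_K
      · exact h.a_mem_K
      · exact h.c_mem_K
      · exact h.I_mem_K
    · rw [TwoClass.Setup.K, IntermediateField.adjoin_le_iff]
      have hmem := IntermediateField.subset_adjoin ℚ
        {((Real.sqrt 2 : ℝ) : ℂ), ((Real.sqrt p : ℝ) : ℂ), ((Real.sqrt q : ℝ) : ℂ), Complex.I}
      rintro x (rfl | rfl | rfl | rfl | hx)
      · exact mul_mem (hmem (by simp)) (hmem (by simp))
      · exact hmem (by simp)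
      · exact mul_mem (hmem (by simp)) (hmem (by simp))
      · exact hmem (by simp)
      · exact absurd hx (Set.notMem_empty _)
  have hk : IntermediateField.adjoin ℚ {((Real.sqrt (p * q) : ℝ) : ℂ) * Complex.I} = h.k := by
    rw [TwoClass.Setup.k, Real.sqrt_mul p.cast_nonneg, Complex.ofReal_mul, insert_empty_eq]
  rw [hK, hk, twoClassNum, twoClassNum]
  exact congrArg _ h.factorization_card_K
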